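/- There exist constants C₀ > 0 and Δ₀ such that for every finite simple graph G = (V,E) with maximum degree Δ ≥ Δ₀ and minimum degree δ ≥ Δ/4, and every assignment of finite lists L_e to the edges with |L_e| ≥ Δ + ⌊C₀·Δ^(1/2)·(log Δ)^4⌋, there exists a proper edge colouring c of G with c(e) ∈ L_e for every edge e, such that for every edge uv ∈ E with d(u) = d(v) the symmetric difference of the palettes satisfies |S_c(u) △ S_c(v)| ≥ (1/64)·(log Δ)². -/

import Mathlib

namespace AVD

open Finset

section ProductExpectation

variable {ι α : Type*} [Fintype ι] [Fintype α]

/-- A family of probability weights on `α`, indexed by `ι`. -/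
structure IsProbWeight (w : ι → α → ℝ) : Prop where
  nonneg : ∀ i a, 0 ≤ w i a
  sum_eq_one : ∀ i, ∑ a, w i a = 1

lemma weight_nonneg {w : ι → α → ℝ} (hw : IsProbWeight w) (ω : ι → α) : 0 ≤ ∏ i, w i (ω i) :=
  prod_nonneg fun i _ => hw.nonneg i _

variable [DecidableEq ι]

/-- Expectation with respect to the product of the weights `w i`. -/
noncomputable def pE (w : ι → α → ℝ) (g : (ι → α) → ℝ) : ℝ :=
  ∑ ω, (∏ i, w i (ω i)) * g ω

/-- Probability of an event with respect to the product of the weights `w i`. -/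
noncomputable def pP (w : ι → α → ℝ) (A : Set (ι → α)) : ℝ :=
  pE w (A.indicator 1)

/-- Average of `g` over the coordinates in `S`, the others being those of `ω₀`. -/
noncomputable def pAvg (w : ι → α → ℝ) (S : Finset ι) (g : (ι → α) → ℝ) (ω₀ : ι → α) : ℝ :=
  pE w fun ω => g (S.piecewise ω ω₀)

variable {w : ι → α → ℝ}

lemma pE_prod (w : ι → α → ℝ) (f : ι → α → ℝ) :
    pE w (fun ω => ∏ i, f i (ω i)) = ∏ i, ∑ a, w i a * f i a := by
  simp only [pE, ← prod_mul_distrib]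
  rw [Finset.prod_univ_sum]
  simp

lemma pE_add (g h : (ι → α) → ℝ) : pE w (fun ω => g ω + h ω) = pE w g + pE w h := by
  simp [pE, mul_add, sum_add_distrib]

lemma pE_sub (g h : (ι → α) → ℝ) : pE w (fun ω => g ω - h ω) = pE w g - pE w h := by
  simp [pE, mul_sub, sum_sub_distrib]

lemma pE_const_mul (c : ℝ) (g : (ι → α) → ℝ) : pE w (fun ω => c * g ω) = c * pE w g := by
  simp only [pE, mul_sum]
  exact sum_congr rfl fun _ _ => by ring

lemma pE_mul_const (c : ℝ) (g : (ι → α) → ℝ) : pE w (fun ω => g ω * c) = pE w g * c := by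
  simp only [pE, sum_mul]
  exact sum_congr rfl fun _ _ => by ring

lemma pE_sum {J : Type*} (s : Finset J) (g : J → (ι → α) → ℝ) :
    pE w (fun ω => ∑ j ∈ s, g j ω) = ∑ j ∈ s, pE w (g j) := by
  simp only [pE, mul_sum]
  exact sum_comm

lemma pE_const (hw : IsProbWeight w) (c : ℝ) : pE w (fun _ => c) = c := by
  have h := pE_prod w fun _ _ => 1
  simp only [mul_one, hw.sum_eq_one, prod_const_one] at h
  have := pE_const_mul (w := w) c fun _ => 1
  simpa [h] using this

lemma pE_mono (hw : IsProbWeight w) {g h : (ι → α) → ℝ} (hgh : ∀ ω, g ω ≤ h ω) :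
    pE w g ≤ pE w h :=
  sum_le_sum fun ω _ => mul_le_mul_of_nonneg_left (hgh ω) (weight_nonneg hw ω)

lemma pE_nonneg (hw : IsProbWeight w) {g : (ι → α) → ℝ} (hg : ∀ ω, 0 ≤ g ω) : 0 ≤ pE w g :=
  sum_nonneg fun ω _ => mul_nonneg (weight_nonneg hw ω) (hg ω)

lemma pE_abs_le (hw : IsProbWeight w) {g : (ι → α) → ℝ} {b : ℝ} (hg : ∀ ω, |g ω| ≤ b) :
    |pE w g| ≤ b := by
  rw [abs_le]
  constructor
  · have := pE_mono hw (g := fun _ => -b) (h := g) fun ω => (abs_le.1 (hg ω)).1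
    rwa [pE_const hw] at this
  · have := pE_mono hw (g := g) (h := fun _ => b) fun ω => (abs_le.1 (hg ω)).2
    rwa [pE_const hw] at this

/-- Two independent samples may exchange their coordinates in `S`. -/
lemma pE_pE_piecewise (S : Finset ι) (F : (ι → α) → (ι → α) → ℝ) :
    pE w (fun ω₀ => pE w fun ω => F (S.piecewise ω ω₀) (S.piecewise ω₀ ω)) =
      pE w (fun ω₀ => pE w fun ω => F ω ω₀) := by
  simp only [pE, mul_sum, ← sum_product', univ_product_univ]
  let e : ((ι → α) × (ι → α)) ≃ ((ι → α) × (ι → α)) :=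
    Function.Involutive.toPerm
      (fun q => (S.piecewise q.1 q.2, S.piecewise q.2 q.1)) (by
        rintro ⟨a, b⟩
        ext i <;> by_cases h : i ∈ S <;> simp [h])
  refine Fintype.sum_equiv e _ _ ?_
  rintro ⟨a, b⟩
  change (∏ i, w i (a i)) * ((∏ i, w i (b i)) * F (S.piecewise b a) (S.piecewise a b)) =
    (∏ i, w i (S.piecewise a b i)) *
      ((∏ i, w i (S.piecewise b a i)) * F (S.piecewise b a) (S.piecewise a b))
  rw [← mul_assoc, ← mul_assoc, ← prod_mul_distrib, ← prod_mul_distrib]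
  congr 1
  refine prod_congr rfl fun i _ => ?_
  by_cases h : i ∈ S <;> simp [h, mul_comm]

lemma pE_pAvg (hw : IsProbWeight w) (S : Finset ι) (g : (ι → α) → ℝ) :
    pE w (pAvg w S g) = pE w g := by
  have := pE_pE_piecewise (w := w) S fun a _ => g a
  rw [pE_const hw] at this
  exact this

lemma pAvg_insert (i : ι) (S : Finset ι) (hi : i ∉ S) (g : (ι → α) → ℝ) (ω₀ : ι → α)
    (hw : IsProbWeight w) :
    pAvg w (insert i S) g ω₀ = ∑ a, w i a * pAvg w S g (Function.update ω₀ i a) := by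
  classical
  have key : ∀ G : (ι → α) → ℝ, (∀ ω ω', ω i = ω' i → G ω = G ω') →
      ∀ ω₁ : ι → α, pE w G = ∑ a, w i a * G (Function.update ω₁ i a) := by
    intro G hG ω₁
    have h1 : ∀ ω, G ω = ∑ a, (if ω i = a then 1 else 0) * G (Function.update ω₁ i a) := by
      intro ω
      simp only [ite_mul, one_mul, zero_mul, sum_ite_eq, mem_univ, if_true]
      exact hG _ _ (by simp)
    have h2 : ∀ a, pE w (fun ω => if ω i = a then (1 : ℝ) else 0) = w i a := by
      intro a
      have := pE_prod w fun j b => if j = i then (if b = a then (1 : ℝ) else 0) else 1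
      simp only [Finset.prod_ite_eq', mem_univ, if_true] at this
      rw [this, Fintype.prod_eq_single i]
      · simp
      · intro j hj
        simp [hj, hw.sum_eq_one]
    calc pE w G = pE w fun ω => ∑ a, (if ω i = a then 1 else 0) * G (Function.update ω₁ i a) := by
          simp only [← h1]
      _ = ∑ a, w i a * G (Function.update ω₁ i a) := by
          rw [pE_sum]
          exact sum_congr rfl fun a _ => by rw [pE_mul_const, h2]
  have h3 := pE_pE_piecewise (w := w) S fun a _ => g ((insert i S).piecewise a ω₀)
  rw [pE_const hw] at h3
  unfold pAvg
  rw [← h3, key _ ?_ ω₀]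
  · refine sum_congr rfl fun a _ => ?_
    congr 2
    ext ω
    congr 1
    ext j
    by_cases hj : j ∈ S
    · simp [hj]
    · by_cases hji : j = i
      · subst hji; simp [hj]
      · simp [hj, hji]
  · intro ω ω' h
    congr 1
    ext η
    congr 1
    ext j
    by_cases hj : j ∈ S
    · simp [hj]
    · by_cases hji : j = i
      · subst hji; simp [hj, h]
      · simp [hj, hji]

lemma pAvg_empty (hw : IsProbWeight w) (g : (ι → α) → ℝ) (ω₀ : ι → α) :
    pAvg w ∅ g ω₀ = g ω₀ := by
  simp [pAvg, pE_const hw]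

lemma pAvg_univ (g : (ι → α) → ℝ) (ω₀ : ι → α) : pAvg w univ g ω₀ = pE w g := by
  simp [pAvg]

/-- Functions of disjoint sets of coordinates are independent. -/
lemma pE_mul_of_disjoint (hw : IsProbWeight w) (S : Finset ι) {g h : (ι → α) → ℝ}
    (hg : ∀ ω ω', (∀ i ∈ S, ω i = ω' i) → g ω = g ω')
    (hh : ∀ ω ω', (∀ i ∉ S, ω i = ω' i) → h ω = h ω') :
    pE w (fun ω => g ω * h ω) = pE w g * pE w h := by
  have h1 := pE_pE_piecewise (w := w) S fun a _ => g a * h a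
  rw [pE_const hw] at h1
  rw [← h1]
  have h2 : ∀ ω₀ ω, g (S.piecewise ω ω₀) * h (S.piecewise ω ω₀) = g ω * h ω₀ := by
    intro ω₀ ω
    rw [hg (S.piecewise ω ω₀) ω fun i hi => by simp [hi],
      hh (S.piecewise ω ω₀) ω₀ fun i hi => by simp [hi]]
  simp only [h2, pE_mul_const]
  rw [pE_const_mul]

lemma pP_mono (hw : IsProbWeight w) {A B : Set (ι → α)} (h : A ⊆ B) : pP w A ≤ pP w B :=
  pE_mono hw fun ω => Set.indicator_le_indicator_of_subset h (fun _ => zero_le_one) ω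

lemma pP_nonneg (hw : IsProbWeight w) (A : Set (ι → α)) : 0 ≤ pP w A :=
  pE_nonneg hw fun ω => Set.indicator_nonneg (fun _ _ => zero_le_one) ω

/-- Probability of a cylinder event. -/
lemma pP_cylinder (hw : IsProbWeight w) (S : Finset ι) (A : ι → Finset α) :
    pP w {ω | ∀ i ∈ S, ω i ∈ A i} = ∏ i ∈ S, ∑ a ∈ A i, w i a := by
  classical
  have h := pE_prod w fun i a => if i ∈ S then (if a ∈ A i then (1 : ℝ) else 0) else 1
  have h1 : ∀ ω : ι → α, (Set.indicator {ω : ι → α | ∀ i ∈ S, ω i ∈ A i} 1 ω : ℝ) =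
      ∏ i, if i ∈ S then (if ω i ∈ A i then (1 : ℝ) else 0) else 1 := by
    intro ω
    rw [prod_ite_mem, univ_inter]
    by_cases hω : ∀ i ∈ S, ω i ∈ A i
    · rw [Set.indicator_of_mem (by exact hω), prod_congr rfl fun i hi => if_pos (hω i hi)]
      simp
    · rw [Set.indicator_of_notMem (by exact hω)]
      push Not at hω
      obtain ⟨i, hi, hiA⟩ := hω
      exact (prod_eq_zero hi (if_neg hiA)).symm
  unfold pP
  rw [funext h1, h, ← prod_subset (subset_univ S)]
  · refine prod_congr rfl fun i hi => ?_
    simp [hi]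
  · intro i _ hi
    simp [hi, hw.sum_eq_one]

end ProductExpectation
section LocalLemma

variable {ι α : Type*} [Fintype ι] [Fintype α] [DecidableEq ι] {w : ι → α → ℝ}

lemma pP_sdiff (A B : Set (ι → α)) : pP w (B \ A) = pP w B - pP w (A ∩ B) := by
  unfold pP
  rw [← pE_sub]
  congr 1
  ext ω
  by_cases hA : ω ∈ A <;> by_cases hB : ω ∈ B <;> simp [hA, hB]

lemma exists_of_pP_pos (hw : IsProbWeight w) {A : Set (ι → α)} (h : 0 < pP w A) :
    ∃ ω ∈ A, ∀ i, 0 < w i (ω i) := by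
  obtain ⟨ω, -, hω⟩ := exists_lt_of_sum_lt (s := univ) (f := fun _ : ι → α => (0 : ℝ))
    (g := fun ω => (∏ i, w i (ω i)) * A.indicator 1 ω) (by simpa [pP, pE] using h)
  have hωA : ω ∈ A := by
    by_contra hA
    simp [hA] at hω
  refine ⟨ω, hωA, fun i => (hw.nonneg i _).lt_of_ne fun h0 => ?_⟩
  rw [prod_eq_zero (mem_univ i) h0.symm] at hω
  simp at hω

/-- The Lovász local lemma in the variable setting. -/
theorem exists_avoiding (hw : IsProbWeight w) {J : Type*} [Fintype J] [DecidableEq J]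
    (A : J → Set (ι → α)) (vbl : J → Finset ι)
    (hA : ∀ j ω ω', (∀ i ∈ vbl j, ω i = ω' i) → (ω ∈ A j ↔ ω' ∈ A j))
    (x : J → ℝ) (hx0 : ∀ j, 0 ≤ x j) (hx1 : ∀ j, x j < 1)
    (hP : ∀ j, pP w (A j) ≤
      x j * ∏ k ∈ univ.filter (fun k => k ≠ j ∧ ¬Disjoint (vbl j) (vbl k)), (1 - x k)) :
    ∃ ω, (∀ j, ω ∉ A j) ∧ ∀ i, 0 < w i (ω i) := by
  set N : Finset J → Set (ι → α) := fun S => {ω | ∀ k ∈ S, ω ∉ A k} with hN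
  have hN_anti : ∀ S T, S ⊆ T → N T ⊆ N S := fun S T h ω hω k hk => hω k (h hk)
  have hN_insert : ∀ k S, N (insert k S) = N S \ A k := by
    intro k S
    ext ω
    simp only [hN, Set.mem_ofPred_eq, forall_mem_insert, Set.mem_sdiff]
    tauto
  have hprod : ∀ S₀ T : Finset J,
      (∀ k ∈ T, ∀ S : Finset J, S ⊆ S₀ ∪ T.erase k → k ∉ S →
        pP w (A k ∩ N S) ≤ x k * pP w (N S)) → Disjoint T S₀ →
      (∏ k ∈ T, (1 - x k)) * pP w (N S₀) ≤ pP w (N (S₀ ∪ T)) := by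
    intro S₀ T
    induction T using Finset.induction_on with
    | empty => intro _ _; simp
    | insert k T hk ih =>
      intro h hd
      rw [disjoint_insert_left] at hd
      have h1 := ih (fun k' hk' S hS hk'S => h k' (mem_insert_of_mem hk') S
        (hS.trans (union_subset_union_right (erase_subset_erase _ (subset_insert _ _)))) hk'S) hd.2
      have h2 := h k (mem_insert_self _ _) (S₀ ∪ T) (by rw [erase_insert hk])
        (by simp [hk, hd.1])
      rw [union_insert, hN_insert, pP_sdiff, prod_insert hk]
      nlinarith [mul_le_mul_of_nonneg_left h1 (sub_nonneg.2 (hx1 k).le)]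
  have claim : ∀ S : Finset J, ∀ j ∉ S, pP w (A j ∩ N S) ≤ x j * pP w (N S) := by
    intro S
    induction S using Finset.strongInduction with
    | H S ih =>
      intro j hj
      set S₁ := S.filter fun k => ¬Disjoint (vbl j) (vbl k) with hS₁
      set S₂ := S.filter fun k => Disjoint (vbl j) (vbl k) with hS₂
      have hS : S₂ ∪ S₁ = S := filter_union_filter_not_eq _ S
      have h1 : pP w (A j ∩ N S) ≤ pP w (A j) * pP w (N S₂) := by
        calc pP w (A j ∩ N S) ≤ pP w (A j ∩ N S₂) :=
              pP_mono hw (Set.inter_subset_inter_right _ (hN_anti _ _ (filter_subset _ _)))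
          _ = pP w (A j) * pP w (N S₂) := by
              unfold pP
              rw [← pE_mul_of_disjoint hw (vbl j)]
              · congr 1
                ext ω
                rw [Set.inter_indicator_one]
                rfl
              · intro ω ω' h
                by_cases hω : ω ∈ A j
                · simp [hω, (hA j ω ω' h).1 hω]
                · simp [hω, mt (hA j ω ω' h).2 hω]
              · intro ω ω' h
                have : ω ∈ N S₂ ↔ ω' ∈ N S₂ := by
                  refine forall₂_congr fun k hk => not_congr (hA k ω ω' fun i hi => h i ?_)
                  exact fun hi' => disjoint_left.1 (mem_filter.1 hk).2 hi' hi
                by_cases hω : ω ∈ N S₂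
                · simp [hω, this.1 hω]
                · simp [hω, mt this.2 hω]
      have h2 : (∏ k ∈ S₁, (1 - x k)) * pP w (N S₂) ≤ pP w (N S) := by
        rw [← hS]
        refine hprod S₂ S₁ (fun k hk T hT hkT => ih T ?_ k hkT)
          (disjoint_filter_filter_not _ _ _).symm
        have hkS : k ∈ S := (mem_filter.1 hk).1
        refine ssubset_of_subset_of_ne (hT.trans ?_) fun h => hkT (h ▸ hkS)
        rw [← hS]
        exact union_subset_union_right (erase_subset _ _)
      have h3 : ∏ k ∈ univ.filter (fun k => k ≠ j ∧ ¬Disjoint (vbl j) (vbl k)), (1 - x k) ≤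
          ∏ k ∈ S₁, (1 - x k) := by
        refine Finset.prod_le_prod_of_subset_of_le_one ?_ (fun k _ => sub_nonneg.2 (hx1 k).le)
          fun k _ _ => by linarith [hx0 k]
        intro k hk
        simp only [hS₁, mem_filter, mem_univ, true_and] at hk ⊢
        exact ⟨fun h => hj (h ▸ hk.1), hk.2⟩
      calc pP w (A j ∩ N S) ≤ pP w (A j) * pP w (N S₂) := h1
        _ ≤ (x j * ∏ k ∈ S₁, (1 - x k)) * pP w (N S₂) :=
            mul_le_mul_of_nonneg_right ((hP j).trans (mul_le_mul_of_nonneg_left h3 (hx0 j)))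
              (pP_nonneg hw _)
        _ = x j * ((∏ k ∈ S₁, (1 - x k)) * pP w (N S₂)) := by ring
        _ ≤ x j * pP w (N S) := mul_le_mul_of_nonneg_left h2 (hx0 j)
  have hpos : 0 < pP w (N univ) := by
    have h := hprod ∅ univ (fun k _ S _ hkS => claim S k hkS) (disjoint_empty_right _)
    have h0 : pP w (N ∅) = 1 := by
      have : N ∅ = Set.univ := by simp [hN]
      rw [this, pP, Set.indicator_univ]
      exact pE_const hw 1
    rw [h0, mul_one, empty_union] at h
    exact (prod_pos fun k _ => sub_pos.2 (hx1 k)).trans_le h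
  obtain ⟨ω, hω, hpos⟩ := exists_of_pP_pos hw hpos
  exact ⟨ω, fun j => hω j (mem_univ j), hpos⟩

lemma exp_neg_two_mul_le {x : ℝ} (h0 : 0 ≤ x) (h1 : x ≤ 1 / 2) : Real.exp (-(2 * x)) ≤ 1 - x := by
  rw [Real.exp_neg, inv_le_comm₀ (Real.exp_pos _) (by linarith)]
  calc (1 - x)⁻¹ ≤ 2 * x + 1 := by
        rw [inv_le_iff_one_le_mul₀ (by linarith)]
        nlinarith
    _ ≤ _ := Real.add_one_le_exp _

/-- The local lemma when every coordinate is used by events of bounded total weight. -/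
theorem exists_avoiding_of_sum_le (hw : IsProbWeight w) {J : Type*} [Fintype J] [DecidableEq J]
    (A : J → Set (ι → α)) (vbl : J → Finset ι)
    (hA : ∀ j ω ω', (∀ i ∈ vbl j, ω i = ω' i) → (ω ∈ A j ↔ ω' ∈ A j))
    (x : J → ℝ) (hx0 : ∀ j, 0 ≤ x j) (hx1 : ∀ j, x j ≤ 1 / 2) (ξ : ℝ)
    (hξ : ∀ i, ∑ k ∈ univ.filter (fun k => i ∈ vbl k), x k ≤ ξ)
    (hP : ∀ j, pP w (A j) ≤ x j * Real.exp (-(2 * (ξ * (vbl j).card)))) :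
    ∃ ω, (∀ j, ω ∉ A j) ∧ ∀ i, 0 < w i (ω i) := by
  refine exists_avoiding hw A vbl hA x hx0 (fun j => by linarith [hx1 j]) fun j =>
    (hP j).trans (mul_le_mul_of_nonneg_left ?_ (hx0 j))
  set Γ := univ.filter (fun k => k ≠ j ∧ ¬Disjoint (vbl j) (vbl k))
  have h1 : ∑ k ∈ Γ, x k ≤ ξ * (vbl j).card := by
    calc ∑ k ∈ Γ, x k ≤ ∑ k, ∑ i ∈ vbl j, if i ∈ vbl k then x k else 0 := by
          have h0 : ∀ k, ∀ i ∈ vbl j, 0 ≤ if i ∈ vbl k then x k else 0 := by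
            intro k i _
            split_ifs
            exacts [hx0 k, le_rfl]
          refine (sum_le_sum fun k hk => ?_).trans
            (sum_le_univ_sum_of_nonneg fun k => sum_nonneg (h0 k))
          obtain ⟨i, hi, hi'⟩ := not_disjoint_iff.1 (mem_filter.1 hk).2.2
          refine le_trans ?_ (single_le_sum (h0 k) hi)
          rw [if_pos hi']
      _ = ∑ i ∈ vbl j, ∑ k ∈ univ.filter (fun k => i ∈ vbl k), x k := by
          rw [sum_comm]
          simp only [sum_filter]
      _ ≤ ∑ i ∈ vbl j, ξ := sum_le_sum fun i _ => hξ i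
      _ = ξ * (vbl j).card := by rw [sum_const, nsmul_eq_mul, mul_comm]
  calc Real.exp (-(2 * (ξ * (vbl j).card))) ≤ Real.exp (∑ k ∈ Γ, -(2 * x k)) := by
        rw [sum_neg_distrib, ← mul_sum]
        gcongr
    _ = ∏ k ∈ Γ, Real.exp (-(2 * x k)) := Real.exp_sum _ _
    _ ≤ ∏ k ∈ Γ, (1 - x k) :=
        prod_le_prod (fun _ _ => (Real.exp_pos _).le) fun k _ => exp_neg_two_mul_le (hx0 k) (hx1 k)

end LocalLemma
section MomentGeneratingFunction

variable {ι α : Type*} [Fintype ι] [Fintype α] [DecidableEq ι] [DecidableEq α] {w : ι → α → ℝ}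

lemma sum_mul_exp_le {u : α → ℝ} (hu : ∀ a, 0 ≤ u a) (hu1 : ∑ a, u a = 1) (o : α) {m : α → ℝ}
    {p b s : ℝ} (hp : ∑ a ∈ univ.erase o, u a ≤ p) (hm : ∀ a, |m a - m o| ≤ b)
    (hs : 2 * |s| * b ≤ 1) :
    ∑ a, u a * Real.exp (s * m a) ≤ Real.exp (s * ∑ a, u a * m a + s ^ 2 * (p * b ^ 2)) := by
  set μ := ∑ a, u a * m a with hμ
  have hμo : |μ - m o| ≤ b := by
    have : μ - m o = ∑ a, u a * (m a - m o) := by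
      simp only [mul_sub, sum_sub_distrib, ← sum_mul, hu1, one_mul, hμ]
    rw [this]
    calc |∑ a, u a * (m a - m o)| ≤ ∑ a, |u a * (m a - m o)| := abs_sum_le_sum_abs _ _
      _ ≤ ∑ a, u a * b := sum_le_sum fun a _ => by
          rw [abs_mul, abs_of_nonneg (hu a)]
          exact mul_le_mul_of_nonneg_left (hm a) (hu a)
      _ = b := by rw [← sum_mul, hu1, one_mul]
  have h1 : ∀ a, Real.exp (s * (m a - μ)) ≤ 1 + s * (m a - μ) + (s * (m a - μ)) ^ 2 := by
    intro a
    have hab : |m a - μ| ≤ 2 * b := by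
      have := abs_sub_le (m a) (m o) μ
      rw [abs_sub_comm (m o) μ] at this
      linarith [hm a]
    have : |s * (m a - μ)| ≤ 1 := by
      rw [abs_mul]
      nlinarith [mul_le_mul_of_nonneg_left hab (abs_nonneg s)]
    linarith [(abs_le.1 (Real.abs_exp_sub_one_sub_id_le this)).2]
  have h2 : ∑ a, u a * (m a - μ) = 0 := by
    simp only [mul_sub, sum_sub_distrib, ← sum_mul, hu1, one_mul, hμ, sub_self]
  have h3 : ∑ a, u a * (m a - μ) ^ 2 ≤ p * b ^ 2 := by
    have e1 : ∑ a, u a * (m a - m o) ^ 2 = ∑ a, u a * (m a - μ) ^ 2 + (μ - m o) ^ 2 := by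
      have : ∀ a, u a * (m a - m o) ^ 2 =
          u a * (m a - μ) ^ 2 + 2 * (μ - m o) * (u a * (m a - μ)) + u a * (μ - m o) ^ 2 := by
        intro a; ring
      simp only [this, sum_add_distrib, ← mul_sum, ← sum_mul, hu1, h2]
      ring
    have e2 : ∑ a, u a * (m a - m o) ^ 2 ≤ p * b ^ 2 := by
      rw [← add_sum_erase _ _ (mem_univ o), sub_self]
      calc u o * 0 ^ 2 + ∑ a ∈ univ.erase o, u a * (m a - m o) ^ 2
          ≤ ∑ a ∈ univ.erase o, u a * b ^ 2 := by
            simp only [ne_eq, OfNat.ofNat_ne_zero, not_false_eq_true, zero_pow, mul_zero, zero_add]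
            refine sum_le_sum fun a _ => mul_le_mul_of_nonneg_left ?_ (hu a)
            rw [← sq_abs]
            exact pow_le_pow_left₀ (abs_nonneg _) (hm a) 2
        _ ≤ p * b ^ 2 := by
            rw [← sum_mul]
            exact mul_le_mul_of_nonneg_right hp (sq_nonneg b)
    nlinarith [sq_nonneg (μ - m o)]
  calc ∑ a, u a * Real.exp (s * m a) = Real.exp (s * μ) * ∑ a, u a * Real.exp (s * (m a - μ)) := by
        rw [mul_sum]
        refine sum_congr rfl fun a _ => ?_
        rw [mul_left_comm, ← Real.exp_add]
        ring_nf
    _ ≤ Real.exp (s * μ) * ∑ a, u a * (1 + s * (m a - μ) + (s * (m a - μ)) ^ 2) := by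
        gcongr with a
        · exact hu a
        · exact h1 a
    _ = Real.exp (s * μ) * (1 + s ^ 2 * ∑ a, u a * (m a - μ) ^ 2) := by
        have : ∀ a, u a * (1 + s * (m a - μ) + (s * (m a - μ)) ^ 2) =
            u a + s * (u a * (m a - μ)) + s ^ 2 * (u a * (m a - μ) ^ 2) := by
          intro a; ring
        simp only [this, sum_add_distrib, ← mul_sum, hu1, h2]
        ring
    _ ≤ Real.exp (s * μ) * (1 + s ^ 2 * (p * b ^ 2)) := by gcongr
    _ ≤ Real.exp (s * μ) * Real.exp (s ^ 2 * (p * b ^ 2)) := by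
        gcongr
        linarith [Real.add_one_le_exp (s ^ 2 * (p * b ^ 2))]
    _ = _ := by rw [Real.exp_add]

/-- Moment generating function of a function of independent coordinates that changes little
when a coordinate is reset to its default value `o`. -/
lemma pAvg_exp_le (hw : IsProbWeight w) (o : α) {p b : ι → ℝ} {s : ℝ} {g : (ι → α) → ℝ}
    (S : Finset ι) (hp : ∀ i ∈ S, ∑ a ∈ univ.erase o, w i a ≤ p i)
    (hs : ∀ i ∈ S, 2 * |s| * b i ≤ 1) (ω₀ : ι → α)
    (hg : ∀ i ∈ S, ∀ ω, (∀ j ∉ S, ω j = ω₀ j) → |g ω - g (Function.update ω i o)| ≤ b i) :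
    pAvg w S (fun ω => Real.exp (s * g ω)) ω₀ ≤
      Real.exp (s * pAvg w S g ω₀ + s ^ 2 * ∑ i ∈ S, p i * b i ^ 2) := by
  induction S using Finset.induction_on generalizing ω₀ with
  | empty => simp [pAvg_empty hw]
  | insert i S hi ih =>
    rw [pAvg_insert i S hi _ _ hw, pAvg_insert i S hi _ _ hw]
    have hIH : ∀ a, pAvg w S (fun ω => Real.exp (s * g ω)) (Function.update ω₀ i a) ≤
        Real.exp (s * pAvg w S g (Function.update ω₀ i a) + s ^ 2 * ∑ i ∈ S, p i * b i ^ 2) := by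
      intro a
      refine ih (fun j hj => hp j (mem_insert_of_mem hj)) (fun j hj => hs j (mem_insert_of_mem hj))
        _ fun j hj ω hω => hg j (mem_insert_of_mem hj) ω fun k hk => ?_
      rw [mem_insert, not_or] at hk
      rw [hω k hk.2, Function.update_of_ne hk.1]
    have hm : ∀ a, |pAvg w S g (Function.update ω₀ i a) - pAvg w S g (Function.update ω₀ i o)| ≤
        b i := by
      intro a
      unfold pAvg
      rw [← pE_sub]
      refine pE_abs_le hw fun ω => ?_
      have h := hg i (mem_insert_self _ _) (S.piecewise ω (Function.update ω₀ i a)) fun j hj => by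
        rw [mem_insert, not_or] at hj
        rw [piecewise_eq_of_notMem _ _ _ hj.2, Function.update_of_ne hj.1]
      convert h using 4
      ext j
      by_cases hj : j = i
      · subst hj; simp [hi]
      · by_cases hjS : j ∈ S <;> simp [hj, hjS]
    calc ∑ a, w i a * pAvg w S (fun ω => Real.exp (s * g ω)) (Function.update ω₀ i a)
        ≤ ∑ a, w i a * (Real.exp (s * pAvg w S g (Function.update ω₀ i a)) *
            Real.exp (s ^ 2 * ∑ i ∈ S, p i * b i ^ 2)) := by
          refine sum_le_sum fun a _ => mul_le_mul_of_nonneg_left ?_ (hw.nonneg i a)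
          rw [← Real.exp_add]
          exact hIH a
      _ = (∑ a, w i a * Real.exp (s * pAvg w S g (Function.update ω₀ i a))) *
            Real.exp (s ^ 2 * ∑ i ∈ S, p i * b i ^ 2) := by
          rw [sum_mul]
          exact sum_congr rfl fun a _ => by ring
      _ ≤ Real.exp (s * ∑ a, w i a * pAvg w S g (Function.update ω₀ i a) +
            s ^ 2 * (p i * b i ^ 2)) * Real.exp (s ^ 2 * ∑ i ∈ S, p i * b i ^ 2) := by
          gcongr
          exact sum_mul_exp_le (hw.nonneg i) (hw.sum_eq_one i) o (hp i (mem_insert_self _ _)) hm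
            (hs i (mem_insert_self _ _))
      _ = _ := by
          rw [← Real.exp_add, sum_insert hi]
          ring_nf

end MomentGeneratingFunction
section Nibble

variable {X E : Type*} [DecidableEq X] [Fintype E]

/-- Linear hypergraphs with edges of size at most three and maximum degree at most `D`. -/
structure IsNibble (inc : E → Finset X) (D : ℕ) : Prop where
  card_le : ∀ H, (inc H).card ≤ 3
  linear : ∀ ⦃H H' x y⦄, x ≠ y → x ∈ inc H → x ∈ inc H' → y ∈ inc H → y ∈ inc H' → H = H'
  deg_le : ∀ x, (univ.filter fun H => x ∈ inc H).card ≤ D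
  pos : 0 < D

/-- The hyperedges through `x`. -/
def hStar (inc : E → Finset X) (x : X) : Finset E := univ.filter fun H => x ∈ inc H

/-- Activation probability. -/
noncomputable def nibP (D : ℕ) : ℝ := 1 / (12 * D)

variable {inc : E → Finset X} {D : ℕ}

@[simp] lemma mem_hStar {x : X} {H : E} : H ∈ hStar inc x ↔ x ∈ inc H := by simp [hStar]

lemma nibP_pos (h : IsNibble inc D) : 0 < nibP D := by
  have := h.pos
  unfold nibP
  positivity

lemma nibP_mul (h : IsNibble inc D) : nibP D * D = 1 / 12 := by
  have : (D : ℝ) ≠ 0 := by exact_mod_cast h.pos.ne'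
  unfold nibP
  field_simp

lemma nibP_le (h : IsNibble inc D) : nibP D ≤ 1 / 12 := by
  have h1 : (1 : ℝ) ≤ D := by exact_mod_cast h.pos
  nlinarith [nibP_mul h, nibP_pos h]

lemma one_sub_nibP_pow_ge (h : IsNibble inc D) (n : ℕ) : 1 - n * nibP D ≤ (1 - nibP D) ^ n := by
  have := one_add_mul_le_pow (a := -nibP D) (by linarith [nibP_le h]) n
  calc 1 - n * nibP D = 1 + n * -nibP D := by ring
    _ ≤ _ := this
    _ = _ := by ring_nf

variable [DecidableEq E]

/-- The hyperedges meeting `H`, other than `H`. -/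
def hNbr (inc : E → Finset X) (H : E) : Finset E :=
  univ.filter fun F => F ≠ H ∧ ¬Disjoint (inc H) (inc F)

/-- Probability that an activated hyperedge is alive. -/
noncomputable def nibA (inc : E → Finset X) (D : ℕ) (H : E) : ℝ :=
  3 / 4 / (1 - nibP D) ^ (hNbr inc H).card

/-- The random state of a hyperedge: inactive (`none`), alive (`some true`) or dead
(`some false`). -/
noncomputable def nibW (inc : E → Finset X) (D : ℕ) (H : E) : Option Bool → ℝ
  | none => 1 - nibP D
  | some true => nibP D * nibA inc D H
  | some false => nibP D * (1 - nibA inc D H)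

/-- A hyperedge is kept if it is alive and all the hyperedges meeting it are inactive. -/
def Kept (inc : E → Finset X) (ω : E → Option Bool) (H : E) : Prop :=
  ω H = some true ∧ ∀ H' ∈ hNbr inc H, ω H' = none

/-- A vertex is covered if it lies in a kept hyperedge. -/
def Covered (inc : E → Finset X) (ω : E → Option Bool) (x : X) : Prop :=
  ∃ H ∈ hStar inc x, Kept inc ω H

/-- The hyperedges whose state may influence whether `H` is kept, for some `H` meeting `Y`. -/
def nibVbl (inc : E → Finset X) (Y : Finset X) : Finset E :=
  Y.biUnion (hStar inc) ∪ (Y.biUnion (hStar inc)).biUnion (hNbr inc)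

@[simp] lemma mem_hNbr {H H' : E} : H' ∈ hNbr inc H ↔ H' ≠ H ∧ ¬Disjoint (inc H) (inc H') := by
  simp [hNbr]

lemma mem_hNbr_comm {H H' : E} : H' ∈ hNbr inc H ↔ H ∈ hNbr inc H' := by
  rw [mem_hNbr, mem_hNbr, ne_comm, disjoint_comm]

lemma card_hNbr_le (h : IsNibble inc D) (H : E) : (hNbr inc H).card ≤ 3 * D := by
  calc (hNbr inc H).card ≤ ((inc H).biUnion (hStar inc)).card := by
        refine card_le_card fun H' hH' => ?_
        obtain ⟨x, hx, hx'⟩ := not_disjoint_iff.1 (mem_hNbr.1 hH').2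
        exact mem_biUnion.2 ⟨x, hx, by simpa⟩
    _ ≤ (inc H).card * D := card_biUnion_le_card_mul _ _ _ fun x _ => h.deg_le x
    _ ≤ 3 * D := Nat.mul_le_mul_right _ (h.card_le H)

lemma nibA_mul (h : IsNibble inc D) (H : E) :
    nibA inc D H * (1 - nibP D) ^ (hNbr inc H).card = 3 / 4 := by
  have : 0 < 1 - nibP D := by linarith [nibP_le h]
  unfold nibA
  field_simp

lemma nibA_nonneg (h : IsNibble inc D) (H : E) : 0 ≤ nibA inc D H := by
  have : 0 < 1 - nibP D := by linarith [nibP_le h]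
  unfold nibA
  positivity

lemma nibA_le_one (h : IsNibble inc D) (H : E) : nibA inc D H ≤ 1 := by
  have h0 : 0 < 1 - nibP D := by linarith [nibP_le h]
  unfold nibA
  rw [div_le_one (by positivity)]
  refine le_trans ?_ (one_sub_nibP_pow_ge h _)
  have h1 : ((hNbr inc H).card : ℝ) ≤ 3 * D := by exact_mod_cast card_hNbr_le h H
  nlinarith [nibP_mul h, nibP_pos h]

lemma isProbWeight_nibW (h : IsNibble inc D) : IsProbWeight (nibW inc D) where
  nonneg H a := by
    have h0 := nibP_pos h
    have h1 := nibP_le h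
    have h2 := nibA_nonneg h H
    have h3 := nibA_le_one h H
    rcases a with _ | _ | _ <;> simp only [nibW]
    · linarith
    · exact mul_nonneg h0.le (by linarith)
    · exact mul_nonneg h0.le h2
  sum_eq_one H := by
    simp only [nibW, Fintype.sum_option, Fintype.sum_bool]
    ring

lemma sum_erase_nibW (H : E) : ∑ a ∈ univ.erase none, nibW inc D H a = nibP D := by
  have h1 := add_sum_erase univ (nibW inc D H) (mem_univ none)
  have h2 : ∑ a, nibW inc D H a = 1 := by
    simp only [nibW, Fintype.sum_option, Fintype.sum_bool]
    ring
  rw [h2] at h1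
  simp only [nibW] at h1 ⊢
  linarith

lemma Kept.eq_of_mem {ω : E → Option Bool} {H H' : E} {x : X} (h : Kept inc ω H)
    (h' : Kept inc ω H') (hx : x ∈ inc H) (hx' : x ∈ inc H') : H = H' := by
  by_contra hne
  have := h.2 H' (mem_hNbr.2 ⟨Ne.symm hne, not_disjoint_iff.2 ⟨x, hx, hx'⟩⟩)
  rw [h'.1] at this
  cases this

open Classical in
/-- Indicator of the event that a hyperedge is kept. -/
noncomputable def keptInd (inc : E → Finset X) (H : E) (ω : E → Option Bool) : ℝ :=
  if Kept inc ω H then 1 else 0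

open Classical in
/-- Indicator of the event that a vertex is covered. -/
noncomputable def covInd (inc : E → Finset X) (x : X) (ω : E → Option Bool) : ℝ :=
  if Covered inc ω x then 1 else 0

lemma covInd_eq_sum (x : X) (ω : E → Option Bool) :
    covInd inc x ω = ∑ H ∈ hStar inc x, keptInd inc H ω := by
  unfold covInd keptInd
  split_ifs with h
  · obtain ⟨H, hH, hk⟩ := h
    rw [sum_eq_single_of_mem H hH]
    · rw [if_pos hk]
    · intro H' hH' hne
      rw [if_neg fun hk' => hne (hk'.eq_of_mem hk (mem_hStar.1 hH') (mem_hStar.1 hH))]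
  · refine (sum_eq_zero fun H hH => if_neg fun hk => h ⟨H, hH, hk⟩).symm

lemma pE_keptInd (h : IsNibble inc D) (H : E) :
    pE (nibW inc D) (keptInd inc H) = 1 / (16 * D) := by
  have hD : (D : ℝ) ≠ 0 := by exact_mod_cast h.pos.ne'
  have hH : H ∉ hNbr inc H := by simp
  have := pP_cylinder (isProbWeight_nibW h) (insert H (hNbr inc H))
    fun H' => if H' = H then {some true} else {none}
  rw [prod_insert hH] at this
  have h1 : pE (nibW inc D) (keptInd inc H) = nibW inc D H (some true) *
      ∏ H' ∈ hNbr inc H, nibW inc D H' none := by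
    refine Eq.trans ?_ (this.trans ?_)
    · unfold pP
      congr 1
      ext ω
      unfold keptInd
      simp only [Set.indicator_apply, Set.mem_ofPred_eq, Pi.one_apply, Kept]
      congr 1
      rw [forall_mem_insert]
      simp only [if_true, mem_singleton]
      refine propext (and_congr_right fun _ => forall₂_congr fun H' hH' => ?_)
      rw [if_neg (mem_hNbr.1 hH').1, mem_singleton]
    · congr 1
      · simp
      · refine prod_congr rfl fun H' hH' => ?_
        rw [if_neg (mem_hNbr.1 hH').1, sum_singleton]
  rw [h1]
  simp only [nibW, prod_const]
  rw [mul_assoc, nibA_mul h, nibP]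
  field_simp
  norm_num

lemma card_hNbr_inter_le (h : IsNibble inc D) {H H' : E} (hd : Disjoint (inc H) (inc H')) :
    (hNbr inc H ∩ hNbr inc H').card ≤ 9 := by
  calc (hNbr inc H ∩ hNbr inc H').card
      ≤ ((inc H ×ˢ inc H').biUnion fun z => hStar inc z.1 ∩ hStar inc z.2).card := by
        refine card_le_card fun K hK => ?_
        rw [mem_inter, mem_hNbr, mem_hNbr] at hK
        obtain ⟨x, hx, hx'⟩ := not_disjoint_iff.1 hK.1.2
        obtain ⟨y, hy, hy'⟩ := not_disjoint_iff.1 hK.2.2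
        exact mem_biUnion.2 ⟨(x, y), by simp [hx, hy], by simp [hx', hy']⟩
    _ ≤ (inc H ×ˢ inc H').card * 1 := by
        refine card_biUnion_le_card_mul _ _ _ fun z hz => card_le_one.2 fun K hK K' hK' => ?_
        rw [mem_product] at hz
        simp only [mem_inter, mem_hStar] at hK hK'
        exact h.linear (disjoint_left.1 hd hz.1 |> fun hn => fun (e : z.1 = z.2) => hn (e ▸ hz.2))
          hK.1 hK'.1 hK.2 hK'.2
    _ ≤ 9 := by
        rw [mul_one, card_product]
        exact Nat.mul_le_mul (h.card_le H) (h.card_le H')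

lemma pE_keptInd_mul (h : IsNibble inc D) {H H' : E} (hne : H ≠ H')
    (hd : Disjoint (inc H) (inc H')) :
    (1 / (16 * D) : ℝ) ^ 2 ≤ pE (nibW inc D) (fun ω => keptInd inc H ω * keptInd inc H' ω) ∧
    pE (nibW inc D) (fun ω => keptInd inc H ω * keptInd inc H' ω) ≤
      (1 / (16 * D) : ℝ) ^ 2 * (1 + 36 * nibP D) := by
  have hD : (D : ℝ) ≠ 0 := by exact_mod_cast h.pos.ne'
  have hp := nibP_pos h
  have hp' := nibP_le h
  set N := hNbr inc H ∪ hNbr inc H' with hN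
  have hHN : H ∉ N := by simp [hN, disjoint_comm, hd]
  have hHN' : H' ∉ N := by simp [hN, hd]
  have := pP_cylinder (isProbWeight_nibW h) (insert H (insert H' N))
    fun K => if K = H ∨ K = H' then {some true} else {none}
  rw [prod_insert (by simp [hHN, hne]), prod_insert hHN'] at this
  have hcyl : pE (nibW inc D) (fun ω => keptInd inc H ω * keptInd inc H' ω) =
      nibW inc D H (some true) * (nibW inc D H' (some true) * ∏ K ∈ N, nibW inc D K none) := by
    refine Eq.trans ?_ (this.trans ?_)
    · unfold pP
      congr 1
      ext ω
      unfold keptInd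
      rw [ite_zero_mul_ite_zero, one_mul]
      simp only [Set.indicator_apply, Set.mem_ofPred_eq, Pi.one_apply, Kept]
      congr 1
      rw [forall_mem_insert, forall_mem_insert]
      simp only [true_or, or_true, if_true, mem_singleton]
      have h1 : (∀ K ∈ N, ω K ∈ (if K = H ∨ K = H' then ({some true} : Finset (Option Bool))
          else {none})) ↔ ∀ K ∈ N, ω K = none := by
        refine forall₂_congr fun K hK => ?_
        rw [if_neg, mem_singleton]
        rintro (rfl | rfl)
        exacts [hHN hK, hHN' hK]
      rw [h1, hN, forall_mem_union]
      exact propext (by tauto)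
    · simp only [true_or, or_true, if_true, sum_singleton]
      congr 2
      refine prod_congr rfl fun K hK => ?_
      rw [if_neg, sum_singleton]
      rintro (rfl | rfl)
      exacts [hHN hK, hHN' hK]
  have hcard := card_union_add_card_inter (hNbr inc H) (hNbr inc H')
  rw [hcyl]
  simp only [nibW, prod_const]
  set k := (hNbr inc H ∩ hNbr inc H').card with hk
  have hk9 : k ≤ 9 := card_hNbr_inter_le h hd
  have e1 : nibP D * nibA inc D H * (nibP D * nibA inc D H' * (1 - nibP D) ^ N.card) *
      (1 - nibP D) ^ k = (1 / (16 * D) : ℝ) ^ 2 := by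
    have e2 : (1 - nibP D) ^ N.card * (1 - nibP D) ^ k =
        (1 - nibP D) ^ (hNbr inc H).card * (1 - nibP D) ^ (hNbr inc H').card := by
      rw [← pow_add, ← pow_add, ← hcard]
    calc _ = nibP D ^ 2 * (nibA inc D H * nibA inc D H' *
          ((1 - nibP D) ^ N.card * (1 - nibP D) ^ k)) := by ring
      _ = nibP D ^ 2 * ((nibA inc D H * (1 - nibP D) ^ (hNbr inc H).card) *
          (nibA inc D H' * (1 - nibP D) ^ (hNbr inc H').card)) := by rw [e2]; ring
      _ = _ := by
        rw [nibA_mul h, nibA_mul h, nibP]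
        field_simp
        norm_num
  set Z := nibP D * nibA inc D H * (nibP D * nibA inc D H' * (1 - nibP D) ^ N.card) with hZ
  have hZ0 : 0 ≤ Z := by
    have := nibA_nonneg h H
    have := nibA_nonneg h H'
    have : 0 ≤ 1 - nibP D := by linarith
    positivity
  have hk1 : (1 - nibP D) ^ k ≤ 1 := pow_le_one₀ (by linarith) (by linarith)
  have hk2 : 1 - 9 * nibP D ≤ (1 - nibP D) ^ k := by
    refine le_trans ?_ (one_sub_nibP_pow_ge h k)
    have : (k : ℝ) ≤ 9 := by exact_mod_cast hk9
    nlinarith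
  rw [← e1]
  constructor
  · exact mul_le_of_le_one_right hZ0 hk1
  · have : 1 ≤ (1 - nibP D) ^ k * (1 + 36 * nibP D) := by nlinarith
    calc Z = Z * 1 := by ring
      _ ≤ Z * ((1 - nibP D) ^ k * (1 + 36 * nibP D)) := by gcongr
      _ = _ := by ring

lemma keptInd_mul_of_not_disjoint {H H' : E} (hne : H ≠ H') (hd : ¬Disjoint (inc H) (inc H'))
    (ω : E → Option Bool) : keptInd inc H ω * keptInd inc H' ω = 0 := by
  obtain ⟨x, hx, hx'⟩ := not_disjoint_iff.1 hd
  unfold keptInd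
  by_cases h : Kept inc ω H
  · rw [if_neg fun h' => hne (h.eq_of_mem h' hx hx'), mul_zero]
  · rw [if_neg h, zero_mul]

lemma pE_covInd (h : IsNibble inc D) (x : X) :
    pE (nibW inc D) (covInd inc x) = (hStar inc x).card / (16 * D) := by
  rw [funext (covInd_eq_sum x), pE_sum]
  simp only [show ∀ H, pE (nibW inc D) (fun ω => keptInd inc H ω) = 1 / (16 * D) from pE_keptInd h]
  rw [sum_const, nsmul_eq_mul]
  ring

lemma card_hStar_inter_le (h : IsNibble inc D) {x y : X} (hxy : x ≠ y) :
    (hStar inc x ∩ hStar inc y).card ≤ 1 :=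
  card_le_one.2 fun K hK K' hK' => by
    simp only [mem_inter, mem_hStar] at hK hK'
    exact h.linear hxy hK.1 hK'.1 hK.2 hK'.2

lemma card_touching_le (h : IsNibble inc D) {x y : X} (hxy : x ≠ y) :
    ((hStar inc x ×ˢ hStar inc y).filter fun K => ¬Disjoint (inc K.1) (inc K.2)).card ≤ 4 * D := by
  have hsub : ((hStar inc x ×ˢ hStar inc y).filter fun K => ¬Disjoint (inc K.1) (inc K.2)) ⊆
      (hStar inc x ∩ hStar inc y) ×ˢ hStar inc y ∪
      (hStar inc x).biUnion fun H => ((inc H).erase y).biUnion fun z =>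
        {H} ×ˢ (hStar inc z ∩ hStar inc y) := by
    rintro ⟨H, H'⟩ hK
    simp only [mem_filter, mem_product, mem_hStar] at hK
    obtain ⟨⟨hx, hy⟩, hd⟩ := hK
    obtain ⟨z, hz, hz'⟩ := not_disjoint_iff.1 hd
    by_cases hyH : y ∈ inc H
    · simp [hx, hy, hyH]
    · have hzy : z ≠ y := fun e => hyH (e ▸ hz)
      refine mem_union_right _ (mem_biUnion.2 ⟨H, by simpa, mem_biUnion.2 ⟨z, ?_, ?_⟩⟩)
      · simp [hz, hzy]
      · simp [hz', hy]
  refine (card_le_card hsub).trans ((card_union_le _ _).trans ?_)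
  have h1 : ((hStar inc x ∩ hStar inc y) ×ˢ hStar inc y).card ≤ 1 * D := by
    rw [card_product]
    exact Nat.mul_le_mul (card_hStar_inter_le h hxy) (h.deg_le y)
  have h2 : ((hStar inc x).biUnion fun H => ((inc H).erase y).biUnion fun z =>
        ({H} : Finset E) ×ˢ (hStar inc z ∩ hStar inc y)).card ≤ D * 3 := by
    refine (card_biUnion_le_card_mul _ _ 3 fun H _ => ?_).trans
      (Nat.mul_le_mul_right _ (h.deg_le x))
    refine (card_biUnion_le_card_mul _ _ 1 fun z hz => ?_).trans ?_
    · rw [card_product, card_singleton, one_mul]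
      exact card_hStar_inter_le h (ne_of_mem_erase hz)
    · rw [mul_one]
      exact (card_le_card (erase_subset _ _)).trans (h.card_le H)
  omega

lemma abs_pE_covInd_mul_sub_le (h : IsNibble inc D) {x y : X} (hxy : x ≠ y) :
    |pE (nibW inc D) (fun ω => covInd inc x ω * covInd inc y ω) -
      (hStar inc x).card / (16 * D) * ((hStar inc y).card / (16 * D))| ≤ nibP D := by
  have hp := nibP_pos h
  have hpD := nibP_mul h
  have hD0 : (0 : ℝ) < D := by exact_mod_cast h.pos
  set q : ℝ := 1 / (16 * D) with hq
  have hqp : q = 3 / 4 * nibP D := by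
    rw [hq, nibP]
    field_simp
    norm_num
  have hq0 : 0 ≤ q := by rw [hqp]; positivity
  set P := hStar inc x ×ˢ hStar inc y with hP
  set F : E × E → ℝ := fun K =>
    pE (nibW inc D) (fun ω => keptInd inc K.1 ω * keptInd inc K.2 ω) with hF
  have hexp : pE (nibW inc D) (fun ω => covInd inc x ω * covInd inc y ω) = ∑ K ∈ P, F K := by
    simp only [covInd_eq_sum, sum_mul_sum, hP, sum_product, hF, pE_sum]
  have hprod : (hStar inc x).card / (16 * D) * ((hStar inc y).card / (16 * D)) =
      ∑ K ∈ P, q ^ 2 := by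
    rw [sum_const, hP, card_product, nsmul_eq_mul, hq]
    push_cast
    ring
  rw [hexp, hprod]
  have hdiag : ∀ H, F (H, H) = q := by
    intro H
    have : ∀ ω, keptInd inc H ω * keptInd inc H ω = keptInd inc H ω := by
      intro ω; unfold keptInd; split_ifs <;> simp
    simp only [hF, this]
    exact pE_keptInd h H
  have hF0 : ∀ K, 0 ≤ F K := fun K => pE_nonneg (isProbWeight_nibW h) fun ω => by
    unfold keptInd; split_ifs <;> simp
  have hcase : ∀ K : E × E, K.1 ≠ K.2 → ¬Disjoint (inc K.1) (inc K.2) → F K = 0 := by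
    intro K hne hd
    simp only [hF, keptInd_mul_of_not_disjoint hne hd]
    exact pE_const (isProbWeight_nibW h) 0
  have hPD : ∑ K ∈ P, q ^ 2 ≤ 1 / 256 := by
    rw [← hprod]
    have e : ∀ z, ((hStar inc z).card : ℝ) / (16 * D) ≤ 1 / 16 := by
      intro z
      rw [div_le_div_iff₀ (by positivity) (by norm_num)]
      have : ((hStar inc z).card : ℝ) ≤ D := by exact_mod_cast h.deg_le z
      linarith
    calc _ ≤ (1 / 16 : ℝ) * (1 / 16) := mul_le_mul (e x) (e y) (by positivity) (by norm_num)
      _ = _ := by norm_num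
  rw [abs_le]
  constructor
  · have h1 : ∀ K ∈ P, q ^ 2 - (if ¬Disjoint (inc K.1) (inc K.2) then q ^ 2 else 0) ≤ F K := by
      intro K _
      by_cases hd : Disjoint (inc K.1) (inc K.2)
      · rw [if_neg (not_not.2 hd)]
        by_cases hne : K.1 = K.2
        · have : F K = q := by
            have := hdiag K.1
            rwa [show (K.1, K.1) = K from Prod.ext rfl hne] at this
          rw [this]
          have : q ≤ 1 := by rw [hqp]; linarith [nibP_le h]
          nlinarith
        · rw [sub_zero]
          exact (pE_keptInd_mul h hne hd).1
      · rw [if_pos hd, sub_self]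
        exact hF0 K
    have h2 := sum_le_sum h1
    rw [sum_sub_distrib, ← sum_filter, sum_const (s := filter _ _), nsmul_eq_mul] at h2
    have h3 : ((P.filter fun K => ¬Disjoint (inc K.1) (inc K.2)).card : ℝ) ≤ 4 * D := by
      exact_mod_cast card_touching_le h hxy
    have h4 := mul_le_mul_of_nonneg_right h3 (sq_nonneg q)
    have h5 : 4 * D * q ^ 2 ≤ nibP D := by
      rw [hqp]
      nlinarith
    linarith
  · have h1 : ∀ K ∈ P, F K ≤ q ^ 2 * (1 + 36 * nibP D) + (if K.1 = K.2 then q else 0) := by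
      intro K _
      split_ifs with hne
      · have : F K = q := by
          have := hdiag K.1
          rwa [show (K.1, K.1) = K from Prod.ext rfl hne] at this
        rw [this]
        have : 0 ≤ q ^ 2 * (1 + 36 * nibP D) := by positivity
        linarith
      · rw [add_zero]
        by_cases hd : Disjoint (inc K.1) (inc K.2)
        · exact (pE_keptInd_mul h hne hd).2
        · rw [hcase K hne hd]; positivity
    have h2 := sum_le_sum h1
    rw [sum_add_distrib, ← sum_filter, sum_const (s := filter _ _), nsmul_eq_mul, ← sum_mul] at h2
    have h3 : (P.filter fun K => K.1 = K.2).card ≤ 1 := by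
      refine le_trans ?_ (card_hStar_inter_le h hxy)
      refine card_le_card_of_injOn Prod.fst ?_ ?_
      · rintro ⟨H, H'⟩ hK
        simp only [hP, coe_filter, mem_product, mem_hStar, Set.mem_ofPred_eq] at hK
        obtain ⟨⟨hx, hy⟩, rfl⟩ := hK
        simp [hx, hy]
      · rintro ⟨H, H'⟩ hK ⟨K, K'⟩ hK' hh
        simp only [coe_filter, Set.mem_ofPred_eq] at hK hK'
        obtain ⟨-, rfl⟩ := hK
        obtain ⟨-, rfl⟩ := hK'
        simp_all
    have h4 : ((P.filter fun K => K.1 = K.2).card : ℝ) * q ≤ q := by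
      have : ((P.filter fun K => K.1 = K.2).card : ℝ) ≤ 1 := by exact_mod_cast h3
      nlinarith
    nlinarith

end Nibble
section Concentration

variable {X E γ : Type*} [DecidableEq X] [Fintype E] [DecidableEq E]
  {inc : E → Finset X} {D : ℕ}

open Classical in
/-- The number of sets `Y j`, `j ∈ J`, none of whose elements is covered. -/
noncomputable def uncCount (inc : E → Finset X) (J : Finset γ) (Y : γ → Finset X)
    (ω : E → Option Bool) : ℝ :=
  ((J.filter fun j => ∀ y ∈ Y j, ¬Covered inc ω y).card : ℝ)

lemma abs_uncCount_sub_le {J : Finset γ} {Y : γ → Finset X}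
    (hY : ∀ j ∈ J, ∀ j' ∈ J, j ≠ j' → Disjoint (Y j) (Y j')) {ω ω' : E → Option Bool}
    {W : Finset X} (hW : ∀ y ∈ J.biUnion Y, y ∉ W → (Covered inc ω y ↔ Covered inc ω' y)) :
    |uncCount inc J Y ω - uncCount inc J Y ω'| ≤ W.card := by
  classical
  have key : ∀ ω ω' : E → Option Bool,
      (∀ y ∈ J.biUnion Y, y ∉ W → (Covered inc ω y ↔ Covered inc ω' y)) →
      uncCount inc J Y ω ≤ uncCount inc J Y ω' + W.card := by
    intro ω ω' hW
    unfold uncCount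
    have hsub : (J.filter fun j => ∀ y ∈ Y j, ¬Covered inc ω y) ⊆
        (J.filter fun j => ∀ y ∈ Y j, ¬Covered inc ω' y) ∪
          W.biUnion fun x => J.filter fun j => x ∈ Y j := by
      intro j hj
      rw [mem_filter] at hj
      rw [mem_union, mem_filter, mem_biUnion]
      by_cases h : ∃ x ∈ W, x ∈ Y j
      · obtain ⟨x, hx, hxj⟩ := h
        exact Or.inr ⟨x, hx, by simp [hj.1, hxj]⟩
      · push Not at h
        refine Or.inl ⟨hj.1, fun y hy => ?_⟩
        rw [← hW y (mem_biUnion.2 ⟨j, hj.1, hy⟩) fun hyW => h y hyW hy]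
        exact hj.2 y hy
    have h1 : (W.biUnion fun x => J.filter fun j => x ∈ Y j).card ≤ W.card * 1 := by
      refine card_biUnion_le_card_mul _ _ _ fun x _ => card_le_one.2 fun j hj j' hj' => ?_
      rw [mem_filter] at hj hj'
      by_contra hne
      exact disjoint_left.1 (hY j hj.1 j' hj'.1 hne) hj.2 hj'.2
    have h2 := (card_le_card hsub).trans (card_union_le _ _)
    rw [mul_one] at h1
    exact_mod_cast h2.trans (Nat.add_le_add_left h1 _)
  rw [abs_le]
  have h1 := key ω ω' hW
  have h2 := key ω' ω fun y hy hyW => (hW y hy hyW).symm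
  constructor <;> linarith

lemma kept_update_iff {ω : E → Option Bool} {i H : E} (hne : H ≠ i) (hi : H ∉ hNbr inc i) :
    Kept inc ω H ↔ Kept inc (Function.update ω i none) H := by
  unfold Kept
  rw [Function.update_of_ne hne]
  refine and_congr_right fun _ => forall₂_congr fun H' hH' => ?_
  rw [Function.update_of_ne]
  rintro rfl
  exact hi (mem_hNbr_comm.1 hH')

open Classical in
/-- The vertices whose coverage may change when the state of `i` is reset. -/
noncomputable def resetSet (inc : E → Finset X) (ω : E → Option Bool) (i : E) : Finset X :=
  inc i ∪ ((hNbr inc i).filter fun H => Kept inc (Function.update ω i none) H).biUnion inc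

lemma covered_update_iff {ω : E → Option Bool} {i : E} {x : X} (hx : x ∉ resetSet inc ω i) :
    Covered inc ω x ↔ Covered inc (Function.update ω i none) x := by
  classical
  by_cases hω : ω i = none
  · rw [← hω, Function.update_eq_self]
  rw [resetSet, mem_union, not_or] at hx
  unfold Covered
  refine exists_congr fun H => and_congr_right fun hH => ?_
  rw [mem_hStar] at hH
  have hne : H ≠ i := by
    rintro rfl
    exact hx.1 hH
  by_cases hi : H ∈ hNbr inc i
  · refine iff_of_false (fun hk => hω (hk.2 i (mem_hNbr_comm.1 hi))) fun hk => hx.2 ?_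
    exact mem_biUnion.2 ⟨H, mem_filter.2 ⟨hi, hk⟩, hH⟩
  · exact kept_update_iff hne hi

lemma card_resetSet_le (h : IsNibble inc D) (ω : E → Option Bool) (i : E) :
    (resetSet inc ω i).card ≤ 12 := by
  classical
  unfold resetSet
  set K := (hNbr inc i).filter fun H => Kept inc (Function.update ω i none) H
  have hK : K.card ≤ 3 := by
    calc K.card ≤ ((inc i).biUnion fun z => K ∩ hStar inc z).card := by
          refine card_le_card fun H hH => ?_
          obtain ⟨x, hx, hx'⟩ := not_disjoint_iff.1 (mem_hNbr.1 (mem_filter.1 hH).1).2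
          exact mem_biUnion.2 ⟨x, hx, by simp [hH, hx']⟩
      _ ≤ (inc i).card * 1 := by
          refine card_biUnion_le_card_mul _ _ _ fun z _ => card_le_one.2 fun H hH H' hH' => ?_
          rw [mem_inter, mem_hStar] at hH hH'
          exact (mem_filter.1 hH.1).2.eq_of_mem (mem_filter.1 hH'.1).2 hH.2 hH'.2
      _ ≤ 3 := by rw [mul_one]; exact h.card_le i
  have h1 := card_union_le (inc i) (K.biUnion inc)
  have h2 : (K.biUnion inc).card ≤ K.card * 3 :=
    card_biUnion_le_card_mul _ _ _ fun H _ => h.card_le H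
  have h3 := h.card_le i
  omega

lemma uncCount_update_le (h : IsNibble inc D) {J : Finset γ} {Y : γ → Finset X}
    (hY : ∀ j ∈ J, ∀ j' ∈ J, j ≠ j' → Disjoint (Y j) (Y j')) (ω : E → Option Bool) (i : E) :
    |uncCount inc J Y ω - uncCount inc J Y (Function.update ω i none)| ≤ 12 := by
  refine (abs_uncCount_sub_le hY fun y _ hy => covered_update_iff hy).trans ?_
  exact_mod_cast card_resetSet_le h ω i

lemma uncCount_update_eq {J : Finset γ} {Y : γ → Finset X}
    (ω : E → Option Bool) {i : E} (hi : i ∉ (J.biUnion Y).biUnion (hStar inc))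
    (hω : ∀ H ∈ (J.biUnion Y).biUnion (hStar inc), H ∈ hNbr inc i → ω H = none) :
    uncCount inc J Y ω = uncCount inc J Y (Function.update ω i none) := by
  classical
  unfold uncCount
  congr 2
  refine filter_congr fun j hj => forall₂_congr fun y hy => not_congr ?_
  refine covered_update_iff fun hy' => ?_
  have hyJ : y ∈ J.biUnion Y := mem_biUnion.2 ⟨j, hj, hy⟩
  rw [resetSet, mem_union, mem_biUnion] at hy'
  rcases hy' with hy' | ⟨H, hH, hyH⟩
  · exact hi (mem_biUnion.2 ⟨y, hyJ, by simpa⟩)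
  · rw [mem_filter] at hH
    have h1 := hω H (mem_biUnion.2 ⟨y, hyJ, by simpa⟩) hH.1
    have h2 := hH.2.1
    rw [Function.update_of_ne (mem_hNbr.1 hH.1).1, h1] at h2
    cases h2

lemma covered_congr {ω ω' : E → Option Bool} {Y : Finset X}
    (hω : ∀ i ∈ nibVbl inc Y, ω i = ω' i) {y : X} (hy : y ∈ Y) :
    Covered inc ω y ↔ Covered inc ω' y := by
  unfold Covered
  refine exists_congr fun H => and_congr_right fun hH => ?_
  have hH' : H ∈ Y.biUnion (hStar inc) := mem_biUnion.2 ⟨y, hy, hH⟩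
  unfold Kept
  rw [hω H (mem_union_left _ hH')]
  refine and_congr_right fun _ => forall₂_congr fun H'' hH'' => ?_
  rw [hω H'' (mem_union_right _ (mem_biUnion.2 ⟨H, hH', hH''⟩))]

lemma uncCount_congr {J : Finset γ} {Y : γ → Finset X} {ω ω' : E → Option Bool}
    (hω : ∀ i ∈ nibVbl inc (J.biUnion Y), ω i = ω' i) :
    uncCount inc J Y ω = uncCount inc J Y ω' := by
  classical
  unfold uncCount
  congr 2
  refine filter_congr fun j hj => forall₂_congr fun y hy => not_congr ?_
  exact covered_congr hω (mem_biUnion.2 ⟨j, hj, hy⟩)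

lemma card_touch_le (h : IsNibble inc D) {Y : Finset X} {m : ℕ} (hY : Y.card ≤ 2 * m) :
    (Y.biUnion (hStar inc)).card ≤ 2 * m * D :=
  (card_biUnion_le_card_mul _ _ _ fun x _ => h.deg_le x).trans (Nat.mul_le_mul_right _ hY)

lemma card_nibVbl_le (h : IsNibble inc D) {Y : Finset X} {m : ℕ} (hY : Y.card ≤ 2 * m) :
    (nibVbl inc Y).card ≤ 2 * m * D * (1 + 3 * D) := by
  have h1 := card_touch_le h hY
  have h2 : ((Y.biUnion (hStar inc)).biUnion (hNbr inc)).card ≤ 2 * m * D * (3 * D) :=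
    (card_biUnion_le_card_mul _ _ _ fun x _ => card_hNbr_le h x).trans
      (Nat.mul_le_mul_right _ h1)
  calc (nibVbl inc Y).card ≤ _ := card_union_le _ _
    _ ≤ 2 * m * D + 2 * m * D * (3 * D) := Nat.add_le_add h1 h2
    _ = _ := by ring

lemma pE_exp_uncCount_le (h : IsNibble inc D) {J : Finset γ} {Y : γ → Finset X}
    (hY : ∀ j ∈ J, ∀ j' ∈ J, j ≠ j' → Disjoint (Y j) (Y j')) {m : ℕ}
    (hm : (J.biUnion Y).card ≤ 2 * m) {s : ℝ} (hs : |s| ≤ 1 / 28) :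
    pE (nibW inc D) (fun ω => Real.exp (s * uncCount inc J Y ω)) ≤
      Real.exp (s * pE (nibW inc D) (uncCount inc J Y) + 40 * s ^ 2 * m) := by
  classical
  have hw := isProbWeight_nibW h
  set f := uncCount inc J Y with hf
  set E₁ := (J.biUnion Y).biUnion (hStar inc) with hE₁
  set S : (E → Option Bool) → Finset E := fun ω => E₁.filter fun H => ω H ≠ none with hS
  set g := pAvg (nibW inc D) E₁ᶜ f with hg
  have hp := nibP_pos h
  have hsum : ∀ H, ∑ a ∈ univ.erase none, nibW inc D H a ≤ nibP D :=
    fun H => (sum_erase_nibW H).le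
  have round₂ : ∀ ω, pAvg (nibW inc D) E₁ᶜ (fun ω => Real.exp (s * f ω)) ω ≤
      Real.exp (s * (g ω + 36 * s * (S ω).card)) := by
    intro ω
    set B := (S ω).biUnion (hNbr inc) with hB
    have hlip := pAvg_exp_le hw none (p := fun _ => nibP D) (b := fun i => if i ∈ B then 12 else 0)
      (s := s) (g := f) E₁ᶜ (fun i _ => hsum i) ?_ ω ?_
    · refine hlip.trans (Real.exp_le_exp.2 ?_)
      have h1 : ∑ i ∈ E₁ᶜ, nibP D * (if i ∈ B then (12 : ℝ) else 0) ^ 2 ≤ 36 * (S ω).card := by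
        calc ∑ i ∈ E₁ᶜ, nibP D * (if i ∈ B then (12 : ℝ) else 0) ^ 2
            ≤ ∑ i, nibP D * (if i ∈ B then (12 : ℝ) else 0) ^ 2 :=
              sum_le_univ_sum_of_nonneg fun i => by positivity
          _ = nibP D * (144 * B.card) := by
              rw [← mul_sum]
              simp only [ite_pow, ne_eq, OfNat.ofNat_ne_zero, not_false_eq_true, zero_pow]
              rw [← sum_filter, sum_const, nsmul_eq_mul, filter_mem_eq_inter, univ_inter]
              ring
          _ ≤ nibP D * (144 * ((S ω).card * (3 * D))) := by
              have : B.card ≤ (S ω).card * (3 * D) :=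
                card_biUnion_le_card_mul _ _ _ fun H _ => card_hNbr_le h H
              have : (B.card : ℝ) ≤ (S ω).card * (3 * D) := by exact_mod_cast this
              gcongr
          _ = (nibP D * D) * (432 * (S ω).card) := by ring
          _ = _ := by rw [nibP_mul h]; ring
      have := mul_le_mul_of_nonneg_left h1 (sq_nonneg s)
      rw [← hg]
      linarith
    · intro i _
      split_ifs
      · linarith
      · linarith
    · intro i hi ω' hω'
      split_ifs with hiB
      · exact uncCount_update_le h hY ω' i
      · rw [hf, ← uncCount_update_eq ω' (mem_compl.1 hi), sub_self, abs_zero]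
        intro H hH hHi
        by_contra hne
        refine hiB (mem_biUnion.2 ⟨H, mem_filter.2 ⟨hH, ?_⟩, mem_hNbr_comm.1 hHi⟩)
        rwa [← hω' H (fun hc => mem_compl.1 hc hH)]
  have hgdep : ∀ ω i, i ∉ E₁ → g ω = g (Function.update ω i none) := by
    intro ω i hi
    simp only [hg, pAvg]
    congr 1
    ext η
    congr 1
    ext j
    by_cases hj : j ∈ E₁
    · have : j ≠ i := fun e => hi (e ▸ hj)
      simp [hj, this]
    · simp [hj]
  have hglip : ∀ ω i, i ∈ E₁ → |g ω - g (Function.update ω i none)| ≤ 12 := by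
    intro ω i hi
    simp only [hg, pAvg]
    rw [← pE_sub]
    refine pE_abs_le hw fun η => ?_
    have : E₁ᶜ.piecewise η (Function.update ω i none) =
        Function.update (E₁ᶜ.piecewise η ω) i none := by
      ext j
      by_cases hji : j = i
      · subst hji; simp [hi]
      · by_cases hj : j ∈ E₁ <;> simp [hj, hji]
    rw [this]
    exact uncCount_update_le h hY _ i
  have hScard : ∀ ω, ((S ω).card : ℝ) = ∑ H ∈ E₁, if ω H ≠ none then 1 else 0 := by
    intro ω
    simp only [hS, card_filter]
    push_cast
    rfl
  have hSdep : ∀ ω i, i ∉ E₁ → (S ω).card = (S (Function.update ω i none)).card := by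
    intro ω i hi
    simp only [hS]
    congr 1
    refine filter_congr fun H hH => ?_
    rw [Function.update_of_ne]
    rintro rfl
    exact hi hH
  have hSlip : ∀ ω i, |((S ω).card : ℝ) - (S (Function.update ω i none)).card| ≤ 1 := by
    intro ω i
    have h1 : S (Function.update ω i none) ⊆ S ω := by
      intro H hH
      simp only [hS, mem_filter] at hH ⊢
      refine ⟨hH.1, fun h0 => hH.2 ?_⟩
      by_cases e : H = i
      · subst e; simp
      · rw [Function.update_of_ne e, h0]
    have h2 : S ω ⊆ insert i (S (Function.update ω i none)) := by
      intro H hH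
      simp only [hS, mem_insert, mem_filter] at hH ⊢
      by_cases e : H = i
      · exact Or.inl e
      · exact Or.inr ⟨hH.1, by rw [Function.update_of_ne e]; exact hH.2⟩
    have h3 : ((S (Function.update ω i none)).card : ℝ) ≤ (S ω).card := by
      exact_mod_cast card_le_card h1
    have h4 : ((S ω).card : ℝ) ≤ (S (Function.update ω i none)).card + 1 := by
      exact_mod_cast (card_le_card h2).trans (card_insert_le _ _)
    rw [abs_le]
    constructor <;> linarith
  have hES : pE (nibW inc D) (fun ω => ((S ω).card : ℝ)) = E₁.card * nibP D := by
    simp only [hScard]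
    rw [pE_sum]
    have : ∀ H : E, pE (nibW inc D) (fun ω => if ω H ≠ none then (1 : ℝ) else 0) = nibP D := by
      intro H
      have h1 := pP_cylinder hw {H} fun _ => univ.erase none
      rw [prod_singleton, sum_erase_nibW] at h1
      rw [← h1]
      unfold pP
      congr 1
      ext ω
      simp [Set.indicator_apply]
    rw [sum_congr rfl fun H _ => this H, sum_const, nsmul_eq_mul]
  have hE₁p : E₁.card * nibP D ≤ m / 6 := by
    have h1 : (E₁.card : ℝ) ≤ 2 * m * D := by exact_mod_cast card_touch_le h hm
    calc E₁.card * nibP D ≤ 2 * m * D * nibP D := by gcongr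
      _ = 2 * m * (nibP D * D) := by ring
      _ = _ := by rw [nibP_mul h]; ring
  have round₁ := pAvg_exp_le hw none (p := fun _ => nibP D)
    (b := fun i => if i ∈ E₁ then 14 else 0) (s := s)
    (g := fun ω => g ω + 36 * s * (S ω).card) univ (fun i _ => hsum i) ?_ (fun _ => none) ?_
  · rw [pAvg_univ, pAvg_univ] at round₁
    refine (((pE_pAvg hw _ _).symm.le.trans (pE_mono hw round₂)).trans round₁).trans ?_
    rw [Real.exp_le_exp, pE_add, pE_const_mul, hES, hg, pE_pAvg hw]
    have h1 : ∑ i, nibP D * (if i ∈ E₁ then (14 : ℝ) else 0) ^ 2 =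
        196 * (E₁.card * nibP D) := by
      rw [← mul_sum]
      simp only [ite_pow, ne_eq, OfNat.ofNat_ne_zero, not_false_eq_true, zero_pow]
      rw [← sum_filter, sum_const, nsmul_eq_mul, filter_mem_eq_inter, univ_inter]
      ring
    rw [h1]
    have h2 := mul_le_mul_of_nonneg_left hE₁p (sq_nonneg s)
    have h3 : (0 : ℝ) ≤ s ^ 2 * m := by positivity
    nlinarith
  · intro i _
    split_ifs
    · linarith
    · linarith
  · intro i _ ω _
    split_ifs with hi
    · have e : g ω + 36 * s * (S ω).card - (g (Function.update ω i none) +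
          36 * s * (S (Function.update ω i none)).card) = (g ω - g (Function.update ω i none)) +
          36 * s * ((S ω).card - (S (Function.update ω i none)).card) := by ring
      rw [e]
      refine (abs_add_le _ _).trans ?_
      have h1 := hglip ω i hi
      have h2 : |36 * s * (((S ω).card : ℝ) - (S (Function.update ω i none)).card)| ≤ 36 / 28 := by
        rw [abs_mul, abs_mul, abs_of_pos (by norm_num : (0 : ℝ) < 36)]
        have := mul_le_mul hs (hSlip ω i) (abs_nonneg _) (by norm_num)
        nlinarith
      linarith
    · rw [← hgdep ω i hi, ← hSdep ω i hi, sub_self, abs_zero]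

/-- Concentration of the number of uncovered sets. -/
lemma pP_uncCount_le (h : IsNibble inc D) {J : Finset γ} {Y : γ → Finset X}
    (hY : ∀ j ∈ J, ∀ j' ∈ J, j ≠ j' → Disjoint (Y j) (Y j')) {m : ℕ}
    (hm : (J.biUnion Y).card ≤ 2 * m) {M lam : ℝ} (hM : 0 < M) (hmM : (m : ℝ) ≤ M) (hlam : 0 ≤ lam)
    (hlam' : lam ≤ 2 * √M) :
    pP (nibW inc D) {ω | lam * √M ≤
      |uncCount inc J Y ω - pE (nibW inc D) (uncCount inc J Y)|} ≤
      2 * Real.exp (-(lam ^ 2 / 160)) := by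
  classical
  have hw := isProbWeight_nibW h
  set f := uncCount inc J Y with hf
  set μ := pE (nibW inc D) f with hμ
  have hsM : 0 < √M := Real.sqrt_pos.2 hM
  have hsq : √M ^ 2 = M := Real.sq_sqrt hM.le
  set s := lam / (80 * √M) with hs
  have hs0 : 0 ≤ s := by positivity
  have hs1 : s ≤ 1 / 28 := by
    rw [hs, div_le_div_iff₀ (by positivity) (by norm_num)]
    linarith
  have key : ∀ σ : ℝ, |σ| = s →
      pE (nibW inc D) (fun ω => Real.exp (σ * (f ω - μ) - s * (lam * √M))) ≤
        Real.exp (-(lam ^ 2 / 160)) := by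
    intro σ hσ
    have e : ∀ ω, Real.exp (σ * (f ω - μ) - s * (lam * √M)) =
        Real.exp (-(σ * μ) - s * (lam * √M)) * Real.exp (σ * f ω) := by
      intro ω
      rw [← Real.exp_add]
      ring_nf
    simp only [e]
    rw [pE_const_mul]
    calc Real.exp (-(σ * μ) - s * (lam * √M)) * pE (nibW inc D) (fun ω => Real.exp (σ * f ω))
        ≤ Real.exp (-(σ * μ) - s * (lam * √M)) * Real.exp (σ * μ + 40 * σ ^ 2 * m) := by
          gcongr
          exact pE_exp_uncCount_le h hY hm (by rw [hσ]; exact hs1)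
      _ ≤ Real.exp (-(lam ^ 2 / 160)) := by
          rw [← Real.exp_add, Real.exp_le_exp, ← sq_abs σ, hσ]
          have h1 : s ^ 2 * m ≤ s ^ 2 * M := by gcongr
          have h2 : s * √M = lam / 80 := by rw [hs]; field_simp
          have h3 : s ^ 2 * M = lam ^ 2 / 6400 := by
            rw [← hsq, ← mul_pow, h2]; ring
          have h4 : s * (lam * √M) = lam ^ 2 / 80 := by
            calc s * (lam * √M) = lam * (s * √M) := by ring
              _ = _ := by rw [h2]; ring
          rw [h4]
          nlinarith
  have hsum : pP (nibW inc D) {ω | lam * √M ≤ |f ω - μ|} ≤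
      pE (nibW inc D) (fun ω => Real.exp (s * (f ω - μ) - s * (lam * √M)) +
        Real.exp (-s * (f ω - μ) - s * (lam * √M))) := by
    refine pE_mono hw fun ω => ?_
    rw [Set.indicator_apply]
    split_ifs with hω
    · rw [Set.mem_ofPred_eq] at hω
      rw [Pi.one_apply]
      rcases le_abs.1 hω with h1 | h1
      · have : 0 ≤ s * (f ω - μ) - s * (lam * √M) := by nlinarith
        linarith [Real.one_le_exp this, Real.exp_pos (-s * (f ω - μ) - s * (lam * √M))]
      · have : 0 ≤ -s * (f ω - μ) - s * (lam * √M) := by nlinarith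
        linarith [Real.one_le_exp this, Real.exp_pos (s * (f ω - μ) - s * (lam * √M))]
    · positivity
  refine hsum.trans ?_
  rw [pE_add]
  have h1 := key s (abs_of_nonneg hs0)
  have h2 := key (-s) (by rw [abs_neg, abs_of_nonneg hs0])
  linarith

lemma uncCount_eq_sum {J : Finset γ} {Y : γ → Finset X} (ω : E → Option Bool) :
    uncCount inc J Y ω = ∑ j ∈ J, uncCount inc {j} Y ω := by
  classical
  unfold uncCount
  simp only [card_filter, sum_singleton]
  push_cast
  rfl

/-- Expected number of uncovered singletons. -/
lemma pE_uncCount_singleton (h : IsNibble inc D) (J : Finset γ) (y : γ → X) :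
    pE (nibW inc D) (uncCount inc J fun j => {y j}) =
      ∑ j ∈ J, (1 - ((hStar inc (y j)).card : ℝ) / (16 * D)) := by
  classical
  have hw := isProbWeight_nibW h
  rw [funext uncCount_eq_sum, pE_sum]
  refine sum_congr rfl fun j _ => ?_
  rw [← pE_covInd h]
  refine Eq.trans ?_ (congrArg (· - pE (nibW inc D) (covInd inc (y j))) (pE_const hw 1))
  rw [← pE_sub]
  congr 1
  ext ω
  unfold uncCount covInd
  by_cases hc : Covered inc ω (y j) <;> simp [hc, filter_singleton]

/-- Expected number of uncovered pairs. -/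
lemma abs_pE_uncCount_pair_le (h : IsNibble inc D) (J : Finset γ) (y z : γ → X)
    (hyz : ∀ j ∈ J, y j ≠ z j) :
    |pE (nibW inc D) (uncCount inc J fun j => {y j, z j}) -
      ∑ j ∈ J, (1 - ((hStar inc (y j)).card : ℝ) / (16 * D)) *
        (1 - ((hStar inc (z j)).card : ℝ) / (16 * D))| ≤ J.card * nibP D := by
  classical
  have hw := isProbWeight_nibW h
  rw [funext uncCount_eq_sum, pE_sum, ← sum_sub_distrib]
  refine (abs_sum_le_sum_abs _ _).trans ?_
  rw [← nsmul_eq_mul]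
  refine sum_le_card_nsmul _ _ _ fun j hj => ?_
  have e : ∀ ω, uncCount inc {j} (fun j => {y j, z j}) ω =
      1 - covInd inc (y j) ω - covInd inc (z j) ω + covInd inc (y j) ω * covInd inc (z j) ω := by
    intro ω
    unfold uncCount covInd
    by_cases hc : Covered inc ω (y j) <;> by_cases hc' : Covered inc ω (z j) <;>
      simp [hc, hc', filter_singleton]
  have e2 : pE (nibW inc D) (fun ω => uncCount inc {j} (fun j => {y j, z j}) ω) =
      1 - ((hStar inc (y j)).card : ℝ) / (16 * D) - ((hStar inc (z j)).card : ℝ) / (16 * D) +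
        pE (nibW inc D) (fun ω => covInd inc (y j) ω * covInd inc (z j) ω) := by
    simp only [e]
    rw [pE_add, pE_sub, pE_sub, pE_const hw]
    simp only [show ∀ x, pE (nibW inc D) (fun ω => covInd inc x ω) =
      ((hStar inc x).card : ℝ) / (16 * D) from pE_covInd h]
  have h1 := abs_pE_covInd_mul_sub_le h (hyz j hj)
  rw [e2]
  refine (congrArg abs ?_).trans_le h1
  ring

end Concentration
section ColouringHypergraph

lemma card_toFinset_le_two {V : Type*} [DecidableEq V] (e : Sym2 V) : e.toFinset.card ≤ 2 := by
  rw [Sym2.card_toFinset]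
  split_ifs <;> omega

variable {V β : Type*} [Fintype V] [DecidableEq V] [Fintype β] [DecidableEq β]

/-- The edges of `U` at `v` having `c` in their list. -/
def colDeg (U : Finset (Sym2 V)) (R : Sym2 V → Finset β) (v : V) (c : β) : Finset (Sym2 V) :=
  U.filter fun e => v ∈ e ∧ c ∈ R e

/-- The pairs of an edge of `U` and a colour of its list. -/
def realPairs (U : Finset (Sym2 V)) (R : Sym2 V → Finset β) : Finset (Sym2 V × β) :=
  univ.filter fun q => q.1 ∈ U ∧ q.2 ∈ R q.1

/-- Dummy hyperedges making the degree of every pair of a vertex and a colour equal to `t`. -/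
def dummyPairs (U : Finset (Sym2 V)) (R : Sym2 V → Finset β) (t : ℕ) : Finset ((V × β) × ℕ) :=
  (univ ×ˢ range t).filter fun q => q.2 < t - (colDeg U R q.1.1 q.1.2).card

/-- The hypergraph whose matchings are the partial list colourings of `U`. -/
def colInc (U : Finset (Sym2 V)) (R : Sym2 V → Finset β) (t : ℕ) :
    realPairs U R ⊕ dummyPairs U R t → Finset (Sym2 V ⊕ V × β) :=
  Sum.elim (fun q => insert (Sum.inl q.1.1) (q.1.1.toFinset.image fun v => Sum.inr (v, q.1.2)))
    fun q => {Sum.inr q.1.1}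

variable {U : Finset (Sym2 V)} {R : Sym2 V → Finset β} {t : ℕ}

lemma mem_realPairs {q : Sym2 V × β} : q ∈ realPairs U R ↔ q.1 ∈ U ∧ q.2 ∈ R q.1 := by
  simp [realPairs]

lemma mem_dummyPairs {q : (V × β) × ℕ} :
    q ∈ dummyPairs U R t ↔ q.2 < t - (colDeg U R q.1.1 q.1.2).card := by
  simp only [dummyPairs, mem_filter, mem_product, mem_univ, mem_range, true_and]
  omega

@[simp] lemma inl_mem_colInc_inl {e : Sym2 V} {q : realPairs U R} :
    Sum.inl e ∈ colInc U R t (Sum.inl q) ↔ e = q.1.1 := by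
  simp [colInc]

@[simp] lemma inr_mem_colInc_inl {v : V} {c : β} {q : realPairs U R} :
    Sum.inr (v, c) ∈ colInc U R t (Sum.inl q) ↔ v ∈ q.1.1 ∧ c = q.1.2 := by
  simp [colInc, eq_comm]

@[simp] lemma mem_colInc_inr {x : Sym2 V ⊕ V × β} {q : dummyPairs U R t} :
    x ∈ colInc U R t (Sum.inr q) ↔ x = Sum.inr q.1.1 := by
  simp [colInc]

lemma card_filter_sum {A B : Type*} [Fintype A] [Fintype B] (P : A ⊕ B → Prop)
    [DecidablePred P] : (univ.filter P).card =
      (univ.filter fun a => P (Sum.inl a)).card + (univ.filter fun b => P (Sum.inr b)).card := by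
  simp only [card_filter, Fintype.sum_sum_type]

lemma card_hStar_inl {e : Sym2 V} (he : e ∈ U) :
    (hStar (colInc U R t) (Sum.inl e)).card = (R e).card := by
  rw [hStar, card_filter_sum]
  have h0 : (univ.filter fun b : dummyPairs U R t => Sum.inl e ∈ colInc U R t (Sum.inr b)) = ∅ := by
    simp
  rw [h0, card_empty, add_zero]
  symm
  refine card_bij (fun c hc => ⟨(e, c), mem_realPairs.2 ⟨he, hc⟩⟩) (fun c hc => by simp)
    (fun c hc c' hc' h => by simpa using h) ?_
  rintro ⟨⟨e', c⟩, hq⟩ h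
  simp only [inl_mem_colInc_inl, mem_filter, mem_univ, true_and] at h
  subst h
  exact ⟨c, (mem_realPairs.1 hq).2, rfl⟩

lemma card_hStar_inl_of_notMem {e : Sym2 V} (he : e ∉ U) :
    (hStar (colInc U R t) (Sum.inl e)).card = 0 := by
  rw [card_eq_zero, hStar, filter_eq_empty_iff]
  rintro (⟨q, hq⟩ | q) -
  · simp only [inl_mem_colInc_inl]
    rintro rfl
    exact he (mem_realPairs.1 hq).1
  · simp

lemma card_hStar_inr {v : V} {c : β} (ht : (colDeg U R v c).card ≤ t) :
    (hStar (colInc U R t) (Sum.inr (v, c))).card = t := by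
  rw [hStar, card_filter_sum]
  have h1 : (univ.filter fun q : realPairs U R =>
      Sum.inr (v, c) ∈ colInc U R t (Sum.inl q)).card = (colDeg U R v c).card := by
    symm
    refine card_bij (fun e he => ⟨(e, c), mem_realPairs.2
      ⟨(mem_filter.1 he).1, (mem_filter.1 he).2.2⟩⟩) (fun e he => ?_)
      (fun e he e' he' h => by simpa using h) ?_
    · simpa using (mem_filter.1 he).2.1
    · rintro ⟨⟨e, c'⟩, hq⟩ h
      simp only [inr_mem_colInc_inl, mem_filter, mem_univ, true_and] at h
      obtain ⟨hv, rfl⟩ := h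
      rw [mem_realPairs] at hq
      exact ⟨e, mem_filter.2 ⟨hq.1, hv, hq.2⟩, rfl⟩
  have h2 : (univ.filter fun q : dummyPairs U R t =>
      Sum.inr (v, c) ∈ colInc U R t (Sum.inr q)).card = t - (colDeg U R v c).card := by
    rw [← card_range (t - (colDeg U R v c).card)]
    symm
    refine card_bij (fun j hj => ⟨((v, c), j), mem_dummyPairs.2 (mem_range.1 hj)⟩)
      (fun j hj => by simp) (fun j hj j' hj' h => by simpa using h) ?_
    rintro ⟨⟨⟨v', c'⟩, j⟩, hq⟩ h
    simp only [mem_colInc_inr, mem_filter, mem_univ, true_and, Sum.inr.injEq, Prod.mk.injEq] at h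
    obtain ⟨rfl, rfl⟩ := h
    exact ⟨j, mem_range.2 (mem_dummyPairs.1 hq), rfl⟩
  rw [h1, h2]
  omega

lemma isNibble_colInc {l : ℕ} (hl : 0 < l) (hR : ∀ e ∈ U, (R e).card = l)
    (ht : ∀ v c, (colDeg U R v c).card ≤ t) (htl : t ≤ l) : IsNibble (colInc U R t) l where
  card_le := by
    rintro (q | q)
    · have h1 := card_insert_le (Sum.inl q.1.1 : Sym2 V ⊕ V × β)
        (q.1.1.toFinset.image fun v => Sum.inr (v, q.1.2))
      have h2 : (q.1.1.toFinset.image fun v => (Sum.inr (v, q.1.2) : Sym2 V ⊕ V × β)).card ≤ 2 :=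
        card_image_le.trans (card_toFinset_le_two _)
      simp only [colInc, Sum.elim_inl]
      omega
    · simp [colInc]
  linear := by
    rintro (⟨⟨e, c⟩, hq⟩ | q) (⟨⟨e', c'⟩, hq'⟩ | q') x y hxy hx hx' hy hy'
    · rcases x with x | ⟨x, a⟩ <;> rcases y with y | ⟨y, b⟩ <;>
        simp only [inl_mem_colInc_inl, inr_mem_colInc_inl] at hx hx' hy hy'
      · exact absurd (congrArg Sum.inl (hx.trans hy.symm)) hxy
      · simp only [Sum.inl.injEq, Subtype.mk.injEq, Prod.mk.injEq]
        exact ⟨hx.symm.trans hx', hy.2.symm.trans hy'.2⟩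
      · simp only [Sum.inl.injEq, Subtype.mk.injEq, Prod.mk.injEq]
        exact ⟨hy.symm.trans hy', hx.2.symm.trans hx'.2⟩
      · have hne : x ≠ y := by
          rintro rfl
          exact hxy (by rw [hx.2, hy.2])
        simp only [Sum.inl.injEq, Subtype.mk.injEq, Prod.mk.injEq]
        exact ⟨((Sym2.mem_and_mem_iff hne).1 ⟨hx.1, hy.1⟩).trans
          ((Sym2.mem_and_mem_iff hne).1 ⟨hx'.1, hy'.1⟩).symm, hx.2.symm.trans hx'.2⟩
    · rw [mem_colInc_inr] at hx' hy'
      exact absurd (hx'.trans hy'.symm) hxy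
    · rw [mem_colInc_inr] at hx hy
      exact absurd (hx.trans hy.symm) hxy
    · rw [mem_colInc_inr] at hx hy
      exact absurd (hx.trans hy.symm) hxy
  deg_le := by
    rintro (e | ⟨v, c⟩)
    · by_cases he : e ∈ U
      · exact ((card_hStar_inl he).trans (hR e he)).le
      · exact (card_hStar_inl_of_notMem he).trans_le (Nat.zero_le _)
    · exact (card_hStar_inr (ht v c)).trans_le htl
  pos := hl

end ColouringHypergraph
section Statistics

variable {X E : Type*} [DecidableEq X] [Fintype E] [DecidableEq E]
  {inc : E → Finset X} {D : ℕ}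

/-- The event that the number of uncovered sets is far from its expectation. -/
def farEvent {γ : Type*} (inc : E → Finset X) (D : ℕ) (J : Finset γ) (Y : γ → Finset X) (r : ℝ) :
    Set (E → Option Bool) :=
  {ω | r ≤ |uncCount inc J Y ω - pE (nibW inc D) (uncCount inc J Y)|}

lemma mem_farEvent_congr {γ : Type*} {J : Finset γ} {Y : γ → Finset X} {r : ℝ}
    {ω ω' : E → Option Bool}
    (hω : ∀ i ∈ nibVbl inc (J.biUnion Y), ω i = ω' i) :
    ω ∈ farEvent inc D J Y r ↔ ω' ∈ farEvent inc D J Y r := by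
  unfold farEvent
  rw [Set.mem_ofPred_eq, Set.mem_ofPred_eq, uncCount_congr hω]

/-- The vertices of the hyperedges equal to or meeting `i`. -/
def vtxNear (inc : E → Finset X) (i : E) : Finset X := inc i ∪ (hNbr inc i).biUnion inc

lemma card_vtxNear_le (h : IsNibble inc D) (i : E) : (vtxNear inc i).card ≤ 12 * D := by
  have h1 : ((hNbr inc i).biUnion inc).card ≤ 3 * D * 3 :=
    (card_biUnion_le_card_mul _ _ _ fun H _ => h.card_le H).trans
      (Nat.mul_le_mul_right _ (card_hNbr_le h i))
  have h2 := card_union_le (inc i) ((hNbr inc i).biUnion inc)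
  have h3 := h.card_le i
  have h4 := h.pos
  unfold vtxNear
  omega

lemma exists_of_mem_nibVbl {i : E} {Y : Finset X} (h : i ∈ nibVbl inc Y) :
    ∃ y ∈ vtxNear inc i, y ∈ Y := by
  rw [nibVbl, mem_union] at h
  rcases h with h | h
  · obtain ⟨y, hy, hi⟩ := mem_biUnion.1 h
    exact ⟨y, mem_union_left _ (mem_hStar.1 hi), hy⟩
  · obtain ⟨H, hH, hi⟩ := mem_biUnion.1 h
    obtain ⟨y, hy, hH⟩ := mem_biUnion.1 hH
    exact ⟨y, mem_union_right _ (mem_biUnion.2 ⟨H, mem_hNbr_comm.1 hi, mem_hStar.1 hH⟩), hy⟩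

/-- Simultaneous concentration of local statistics of the nibble. -/
lemma exists_forall_notMem_farEvent (h : IsNibble inc D) {K : Type*} [Fintype K] [DecidableEq K]
    {γ : K → Type*} {J : ∀ k, Finset (γ k)} {Y : ∀ k, γ k → Finset X} {Q : ℕ} {mf : K → ℕ} {lam : ℝ}
    (hY : ∀ k, ∀ j ∈ J k, ∀ j' ∈ J k, j ≠ j' → Disjoint (Y k j) (Y k j'))
    (hcard : ∀ k, ((J k).biUnion (Y k)).card ≤ 2 * mf k)
    (hpos : ∀ k, 0 < mf k) (hmQ : ∀ k, mf k ≤ Q) (hDQ : D ≤ Q)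
    (hK : ∀ y, (univ.filter fun k => y ∈ (J k).biUnion (Y k)).card ≤ 4 * Q)
    (hlam : 0 ≤ lam) (hlam' : ∀ k, lam ≤ 2 * √(mf k))
    (hQ : 6144 * (Q : ℝ) ^ 5 * Real.exp (-(lam ^ 2 / 160)) ≤ 1) :
    ∃ ω, ∀ k, ω ∉ farEvent inc D (J k) (Y k) (lam * √(mf k)) := by
  classical
  have hw := isProbWeight_nibW h
  set x : ℝ := 4 * Real.exp (-(lam ^ 2 / 160)) with hx
  have hx0 : 0 < x := by positivity
  have hQ1 : (1 : ℝ) ≤ Q := by exact_mod_cast h.pos.trans_le hDQ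
  have hxQ : 768 * (Q : ℝ) ^ 5 * x ≤ 1 / 2 := by rw [hx]; linarith
  have hx1 : x ≤ 1 / 2 := by
    have : 1 ≤ (Q : ℝ) ^ 5 := one_le_pow₀ hQ1
    nlinarith
  suffices hex : ∃ ω, (∀ k, ω ∉ farEvent inc D (J k) (Y k) (lam * √(mf k))) ∧
      ∀ i, 0 < nibW inc D i (ω i) from hex.imp fun _ h => h.1
  refine exists_avoiding_of_sum_le hw
    (fun k => farEvent inc D (J k) (Y k) (lam * √(mf k)))
    (fun k => nibVbl inc ((J k).biUnion (Y k)))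
    (fun k ω ω' h => mem_farEvent_congr h) (fun _ => x) (fun _ => hx0.le) (fun _ => hx1)
    (48 * Q ^ 2 * x) ?_ ?_
  · intro i
    rw [sum_const, nsmul_eq_mul]
    have h1 : (univ.filter fun k => i ∈ nibVbl inc ((J k).biUnion (Y k))).card ≤
        12 * D * (4 * Q) := by
      calc _ ≤ ((vtxNear inc i).biUnion fun y =>
            univ.filter fun k => y ∈ (J k).biUnion (Y k)).card := by
            refine card_le_card fun k hk => ?_
            obtain ⟨y, hy, hy'⟩ := exists_of_mem_nibVbl (mem_filter.1 hk).2
            exact mem_biUnion.2 ⟨y, hy, mem_filter.2 ⟨mem_univ _, hy'⟩⟩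
        _ ≤ (vtxNear inc i).card * (4 * Q) := card_biUnion_le_card_mul _ _ _ fun y _ => hK y
        _ ≤ _ := Nat.mul_le_mul_right _ (card_vtxNear_le h i)
    have h2 : 12 * D * (4 * Q) ≤ 48 * Q ^ 2 := by nlinarith
    have h3 : ((univ.filter fun k => i ∈ nibVbl inc ((J k).biUnion (Y k))).card : ℝ) ≤
        48 * Q ^ 2 := by exact_mod_cast h1.trans h2
    gcongr
  · intro k
    have h1 : pP (nibW inc D) (farEvent inc D (J k) (Y k) (lam * √(mf k))) ≤ x / 2 := by
      refine (pP_uncCount_le h (hY k) (hcard k) (M := mf k) (by exact_mod_cast hpos k) le_rfl hlam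
        (hlam' k)).trans ?_
      rw [hx]
      linarith
    refine h1.trans ?_
    have h2 : (nibVbl inc ((J k).biUnion (Y k))).card ≤ 8 * Q ^ 3 := by
      refine (card_nibVbl_le h (hcard k)).trans ?_
      calc 2 * mf k * D * (1 + 3 * D) ≤ 2 * Q * Q * (Q + 3 * Q) := by
            have := hmQ k
            have := h.pos
            gcongr
            omega
        _ = _ := by ring
    have h3 : ((nibVbl inc ((J k).biUnion (Y k))).card : ℝ) ≤ 8 * Q ^ 3 := by exact_mod_cast h2
    have h4 : 2 * (48 * Q ^ 2 * x * (nibVbl inc ((J k).biUnion (Y k))).card) ≤ 1 / 2 := by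
      calc 2 * (48 * Q ^ 2 * x * (nibVbl inc ((J k).biUnion (Y k))).card)
          ≤ 2 * (48 * Q ^ 2 * x * (8 * Q ^ 3)) := by gcongr
        _ = 768 * (Q : ℝ) ^ 5 * x := by ring
        _ ≤ _ := hxQ
    have h5 := Real.add_one_le_exp
      (-(2 * (48 * Q ^ 2 * x * (nibVbl inc ((J k).biUnion (Y k))).card)))
    nlinarith

end Statistics
section PartialColouring

variable {V β : Type*}

/-- A partial proper list colouring `φ` of the edge set `Ed`, with uncoloured edges `U`, together
with lists `R` of colours still available at the uncoloured edges. -/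
structure PartialCol (Ed : Finset (Sym2 V)) (L : Sym2 V → Finset β) (U : Finset (Sym2 V))
    (φ : Sym2 V → β) (R : Sym2 V → Finset β) : Prop where
  subset : U ⊆ Ed
  mem : ∀ e ∈ Ed, e ∉ U → φ e ∈ L e
  proper : ∀ e ∈ Ed, e ∉ U → ∀ f ∈ Ed, f ∉ U → e ≠ f → ∀ w, w ∈ e → w ∈ f → φ e ≠ φ f
  list_subset : ∀ e ∈ U, R e ⊆ L e
  avail : ∀ e ∈ U, ∀ f ∈ Ed, f ∉ U → ∀ w, w ∈ e → w ∈ f → φ f ∉ R e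

variable {Ed U : Finset (Sym2 V)} {L R : Sym2 V → Finset β} {φ : Sym2 V → β}

/-- The lists of a partial colouring can be shrunk to a prescribed size. -/
lemma PartialCol.exists_card_eq (h : PartialCol Ed L U φ R) {l : ℕ}
    (hl : ∀ e ∈ U, l ≤ (R e).card) :
    ∃ R', PartialCol Ed L U φ R' ∧ (∀ e, R' e ⊆ R e) ∧ (∀ e ∈ U, (R' e).card = l) ∧
      ∀ e ∉ U, R' e = ∅ := by
  have hex : ∀ e, ∃ S, S ⊆ R e ∧ (e ∈ U → S.card = l) ∧ (e ∉ U → S = ∅) := fun e => by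
    by_cases he : e ∈ U
    · obtain ⟨S, hS, hc⟩ := exists_subset_card_eq (hl e he)
      exact ⟨S, hS, fun _ => hc, fun h => absurd he h⟩
    · exact ⟨∅, empty_subset _, fun h => absurd h he, fun _ => rfl⟩
  choose R' h1 h2 h3 using hex
  refine ⟨R', ⟨h.subset, h.mem, h.proper, fun e he => (h1 e).trans (h.list_subset e he),
    fun e he f hf hfU w hwe hwf hR => h.avail e he f hf hfU w hwe hwf (h1 e hR)⟩, h1, h2, h3⟩

variable [DecidableEq V] [DecidableEq β]

lemma colDeg_subset {R' : Sym2 V → Finset β} (h : ∀ e, R' e ⊆ R e) (v : V) (c : β) :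
    colDeg U R' v c ⊆ colDeg U R v c := by
  intro e he
  rw [colDeg, mem_filter] at he ⊢
  exact ⟨he.1, he.2.1, h e he.2.2⟩

variable [Fintype V] [Fintype β] {t : ℕ} {ω : realPairs U R ⊕ dummyPairs U R t → Option Bool}

open Classical in
/-- The edges left uncoloured after one nibble. -/
noncomputable def nextUncol (U : Finset (Sym2 V)) (R : Sym2 V → Finset β) (t : ℕ)
    (ω : realPairs U R ⊕ dummyPairs U R t → Option Bool) : Finset (Sym2 V) :=
  U.filter fun e => ¬ Covered (colInc U R t) ω (Sum.inl e)

open Classical in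
/-- The lists after one nibble. -/
noncomputable def nextList (U : Finset (Sym2 V)) (R : Sym2 V → Finset β) (t : ℕ)
    (ω : realPairs U R ⊕ dummyPairs U R t → Option Bool) (e : Sym2 V) : Finset β :=
  (R e).filter fun c => ∀ v ∈ e, ¬ Covered (colInc U R t) ω (Sum.inr (v, c))

lemma mem_nextUncol {e : Sym2 V} :
    e ∈ nextUncol U R t ω ↔ e ∈ U ∧ ¬ Covered (colInc U R t) ω (Sum.inl e) := by
  classical exact mem_filter

lemma mem_nextList {e : Sym2 V} {c : β} :
    c ∈ nextList U R t ω e ↔ c ∈ R e ∧ ∀ v ∈ e, ¬ Covered (colInc U R t) ω (Sum.inr (v, c)) := by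
  classical exact mem_filter

/-- The pair `q` of an edge and a colour is selected by the nibble. -/
def Selected (ω : realPairs U R ⊕ dummyPairs U R t → Option Bool) (q : Sym2 V × β) : Prop :=
  ∃ h : q ∈ realPairs U R, Kept (colInc U R t) ω (Sum.inl ⟨q, h⟩)

open Classical in
/-- The colouring after one nibble. -/
noncomputable def nextCol (φ : Sym2 V → β) (ω : realPairs U R ⊕ dummyPairs U R t → Option Bool)
    (e : Sym2 V) : β :=
  if h : ∃ c, Selected ω (e, c) then h.choose else φ e

lemma covered_inl_iff {e : Sym2 V} :
    Covered (colInc U R t) ω (Sum.inl e) ↔ ∃ c, Selected ω (e, c) := by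
  constructor
  · rintro ⟨q | q, hq, hk⟩
    · rw [mem_hStar, inl_mem_colInc_inl] at hq
      subst hq
      exact ⟨q.1.2, q.2, hk⟩
    · rw [mem_hStar, mem_colInc_inr] at hq
      exact absurd hq (by simp)
  · rintro ⟨c, hc, hk⟩
    exact ⟨_, mem_hStar.2 (inl_mem_colInc_inl.2 rfl), hk⟩

lemma Selected.mem {e : Sym2 V} {c : β} (h : Selected ω (e, c)) : e ∈ U ∧ c ∈ R e :=
  mem_realPairs.1 h.1

lemma Selected.covered {e : Sym2 V} {c : β} (h : Selected ω (e, c)) {v : V} (hv : v ∈ e) :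
    Covered (colInc U R t) ω (Sum.inr (v, c)) :=
  ⟨_, mem_hStar.2 (inr_mem_colInc_inl.2 ⟨hv, rfl⟩), h.2⟩

lemma Selected.eq {e f : Sym2 V} {c : β} (h : Selected ω (e, c)) (h' : Selected ω (f, c)) {v : V}
    (hv : v ∈ e) (hv' : v ∈ f) : e = f := by
  have := h.2.eq_of_mem h'.2 (x := Sum.inr (v, c)) (inr_mem_colInc_inl.2 ⟨hv, rfl⟩)
    (inr_mem_colInc_inl.2 ⟨hv', rfl⟩)
  simpa using this

lemma selected_nextCol {e : Sym2 V} (h : Covered (colInc U R t) ω (Sum.inl e)) :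
    Selected ω (e, nextCol φ ω e) := by
  rw [covered_inl_iff] at h
  rw [nextCol, dif_pos h]
  exact h.choose_spec

lemma nextCol_of_notMem {e : Sym2 V} (h : e ∉ U) : nextCol φ ω e = φ e := by
  rw [nextCol, dif_neg]
  rintro ⟨c, hc⟩
  exact h hc.mem.1

lemma selected_or_of_notMem_nextUncol {e : Sym2 V} (h : e ∉ nextUncol U R t ω) :
    Selected ω (e, nextCol φ ω e) ∨ e ∉ U ∧ nextCol φ ω e = φ e := by
  by_cases he : e ∈ U
  · refine Or.inl (selected_nextCol ?_)
    by_contra hc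
    exact h (mem_nextUncol.2 ⟨he, hc⟩)
  · exact Or.inr ⟨he, nextCol_of_notMem he⟩

lemma PartialCol.next (h : PartialCol Ed L U φ R) :
    PartialCol Ed L (nextUncol U R t ω) (nextCol φ ω) (nextList U R t ω) where
  subset := fun e he => h.subset (mem_nextUncol.1 he).1
  mem := fun e he heU => by
    rcases selected_or_of_notMem_nextUncol (φ := φ) heU with hs | ⟨hs, h'⟩
    · exact h.list_subset e hs.mem.1 hs.mem.2
    · rw [h']
      exact h.mem e he hs
  proper := fun e he heU f hf hfU hne w hwe hwf heq => by
    rcases selected_or_of_notMem_nextUncol (φ := φ) heU with hs | ⟨hs, h'⟩ <;>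
      rcases selected_or_of_notMem_nextUncol (φ := φ) hfU with hs₁ | ⟨hs₁, h₁⟩
    · rw [heq] at hs
      exact hne (hs.eq hs₁ hwe hwf)
    · refine h.avail e hs.mem.1 f hf hs₁ w hwe hwf ?_
      rw [← h₁, ← heq]
      exact hs.mem.2
    · refine h.avail f hs₁.mem.1 e he hs w hwf hwe ?_
      rw [← h', heq]
      exact hs₁.mem.2
    · rw [h', h₁] at heq
      exact h.proper e he hs f hf hs₁ hne w hwe hwf heq
  list_subset := fun e he c hc =>
    h.list_subset e (mem_nextUncol.1 he).1 (mem_nextList.1 hc).1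
  avail := fun e he f hf hfU w hwe hwf hR => by
    obtain ⟨hR, hc⟩ := mem_nextList.1 hR
    rcases selected_or_of_notMem_nextUncol (φ := φ) hfU with hs | ⟨hs, h'⟩
    · exact hc w hwe (hs.covered hwf)
    · rw [h'] at hR
      exact h.avail e (mem_nextUncol.1 he).1 f hf hs w hwe hwf hR

end PartialColouring
section Step

variable {V β : Type}

lemma mk_out (e : Sym2 V) : s((Quot.out e).1, (Quot.out e).2) = e := Quot.out_eq e

variable [DecidableEq V]

/-- The end of `e` other than `v`. -/
def oth (v : V) (e : Sym2 V) : V := if h : v ∈ e then Sym2.Mem.other' h else v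

lemma mk_oth {v : V} {e : Sym2 V} (h : v ∈ e) : s(v, oth v e) = e := by
  rw [oth, dif_pos h, Sym2.other_spec']

lemma oth_mem {v : V} {e : Sym2 V} (h : v ∈ e) : oth v e ∈ e := by
  have h1 := Sym2.mem_mk_right v (oth v e)
  rwa [mk_oth h] at h1

/-- The index types of the local statistics: colours at an edge, edges at a vertex. -/
def StatIdx (V β : Type) : Sym2 V ⊕ (V × β) ⊕ V → Type
  | Sum.inl _ => β
  | Sum.inr _ => Sym2 V

/-- The edges of `U` at `v`. -/
def edgesAt (U : Finset (Sym2 V)) (v : V) : Finset (Sym2 V) := U.filter (v ∈ ·)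

lemma mem_edgesAt {U : Finset (Sym2 V)} {v : V} {e : Sym2 V} :
    e ∈ edgesAt U v ↔ e ∈ U ∧ v ∈ e := mem_filter

variable [DecidableEq β]

/-- The local statistics: available colours at an edge, edges at a vertex with a given available
colour, and edges at a vertex. -/
def statSet (U : Finset (Sym2 V)) (R : Sym2 V → Finset β) :
    ∀ k : Sym2 V ⊕ (V × β) ⊕ V, Finset (StatIdx V β k)
  | Sum.inl e => R e
  | Sum.inr (Sum.inl (v, c)) => colDeg U R v c
  | Sum.inr (Sum.inr v) => edgesAt U v

/-- The vertices of the colouring hypergraph that must remain uncovered. -/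
noncomputable def statVtx :
    ∀ k : Sym2 V ⊕ (V × β) ⊕ V, StatIdx V β k → Finset (Sym2 V ⊕ V × β)
  | Sum.inl e => fun c : β => {Sum.inr ((Quot.out e).1, c), Sum.inr ((Quot.out e).2, c)}
  | Sum.inr (Sum.inl (v, c)) => fun e : Sym2 V => {Sum.inl e, Sum.inr (oth v e, c)}
  | Sum.inr (Sum.inr _) => fun e : Sym2 V => {Sum.inl e}

/-- Upper bounds for the local statistics. -/
def statBd (V β : Type) (l M : ℕ) : Sym2 V ⊕ (V × β) ⊕ V → ℕ
  | Sum.inl _ => l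
  | Sum.inr (Sum.inl _) => l
  | Sum.inr (Sum.inr _) => M

variable {U : Finset (Sym2 V)} {R : Sym2 V → Finset β} {l t M Q : ℕ}

lemma disjoint_statVtx (k : Sym2 V ⊕ (V × β) ⊕ V) :
    ∀ j ∈ statSet U R k, ∀ j' ∈ statSet U R k, j ≠ j' →
      Disjoint (statVtx k j) (statVtx k j') := by
  rcases k with e | ⟨v, c⟩ | v
  · intro (j : β) _ (j' : β) _ hne
    replace hne : @Ne β j j' := hne
    change Disjoint ({_, _} : Finset (Sym2 V ⊕ V × β)) {_, _}
    simp [hne.symm]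
  · intro (j : Sym2 V) hj (j' : Sym2 V) hj' hne
    have hj : j ∈ colDeg U R v c := hj
    have hj' : j' ∈ colDeg U R v c := hj'
    change Disjoint ({_, _} : Finset (Sym2 V ⊕ V × β)) {_, _}
    replace hne : @Ne (Sym2 V) j j' := hne
    have h1 : oth v j ≠ oth v j' := fun h => hne <| by
      rw [← mk_oth (mem_filter.1 hj).2.1, ← mk_oth (mem_filter.1 hj').2.1, h]
    simp [hne.symm, h1.symm]
  · intro (j : Sym2 V) _ (j' : Sym2 V) _ hne
    replace hne : @Ne (Sym2 V) j j' := hne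
    change Disjoint ({_} : Finset (Sym2 V ⊕ V × β)) {_}
    simp [hne]

lemma card_biUnion_statVtx_le (hR : ∀ e, (R e).card ≤ l) (hc : ∀ v c, (colDeg U R v c).card ≤ l)
    (hM : ∀ v, (edgesAt U v).card ≤ M) (k : Sym2 V ⊕ (V × β) ⊕ V) :
    ((statSet U R k).biUnion (statVtx k)).card ≤ 2 * statBd V β l M k := by
  rw [mul_comm]
  have h2 : ∀ j ∈ statSet U R k, (statVtx k j).card ≤ 2 := by
    rcases k with e | ⟨v, c⟩ | v
    · intro _ _
      exact card_le_two
    · intro _ _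
      exact card_le_two
    · intro _ _
      exact (card_singleton _).trans_le one_le_two
  refine (card_biUnion_le_card_mul _ _ 2 h2).trans (Nat.mul_le_mul_right _ ?_)
  rcases k with e | ⟨v, c⟩ | v
  · exact hR e
  · exact hc v c
  · exact hM v

variable [Fintype V] [Fintype β]

lemma card_stat_mem_le (hl : 1 ≤ l) (hlQ : l ≤ Q) (hMQ : M ≤ Q) (hR : ∀ e, (R e).card ≤ l)
    (hR0 : ∀ e ∉ U, R e = ∅) (hM : ∀ v, (edgesAt U v).card ≤ M) (y : Sym2 V ⊕ V × β) :
    (univ.filter fun k => y ∈ (statSet U R k).biUnion (statVtx k)).card ≤ 4 * Q := by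
  rcases y with e | ⟨v, c⟩
  · calc _ ≤ (((e.toFinset ×ˢ R e).image fun q => (Sum.inr (Sum.inl q) : Sym2 V ⊕ (V × β) ⊕ V)) ∪
          e.toFinset.image fun v => Sum.inr (Sum.inr v)).card := by
          refine card_le_card fun k hk => ?_
          replace hk := (mem_filter.1 hk).2
          rcases k with f | ⟨v, c⟩ | v
          · replace hk : Sum.inl e ∈ (R f).biUnion fun c =>
              ({Sum.inr ((Quot.out f).1, c), Sum.inr ((Quot.out f).2, c)} :
                Finset (Sym2 V ⊕ V × β)) := hk
            simp at hk
          · replace hk : Sum.inl e ∈ (colDeg U R v c).biUnion fun f =>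
              ({Sum.inl f, Sum.inr (oth v f, c)} : Finset (Sym2 V ⊕ V × β)) := hk
            simp only [mem_biUnion, mem_insert, Sum.inl.injEq, mem_singleton, reduceCtorEq,
              or_false, exists_eq_right'] at hk
            have := (mem_filter.1 hk).2
            simp [this]
          · replace hk : Sum.inl e ∈ (edgesAt U v).biUnion fun f =>
              ({Sum.inl f} : Finset (Sym2 V ⊕ V × β)) := hk
            simp only [mem_biUnion, Sum.inl.injEq, mem_singleton, exists_eq_right'] at hk
            have := (mem_filter.1 hk).2
            simp [this]
      _ ≤ 2 * l + 2 := by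
          refine (card_union_le _ _).trans (Nat.add_le_add (card_image_le.trans ?_)
            (card_image_le.trans (card_toFinset_le_two e)))
          rw [card_product]
          exact Nat.mul_le_mul (card_toFinset_le_two e) (hR e)
      _ ≤ _ := by omega
  · calc _ ≤ (((edgesAt U v).image fun e => (Sum.inl e : Sym2 V ⊕ (V × β) ⊕ V)) ∪
          ((edgesAt U v).image fun e => Sum.inr (Sum.inl (oth v e, c)))).card := by
          refine card_le_card fun k hk => ?_
          replace hk := (mem_filter.1 hk).2
          rcases k with f | ⟨u, c'⟩ | u
          · replace hk : Sum.inr (v, c) ∈ (R f).biUnion fun c =>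
              ({Sum.inr ((Quot.out f).1, c), Sum.inr ((Quot.out f).2, c)} :
                Finset (Sym2 V ⊕ V × β)) := hk
            simp only [mem_biUnion, mem_insert, Sum.inr.injEq, mem_singleton, Prod.mk.injEq] at hk
            obtain ⟨j, hj, hy⟩ := hk
            have hf : f ∈ U := by
              by_contra hf
              rw [hR0 f hf] at hj
              exact absurd hj (notMem_empty _)
            have hv : v ∈ f := by
              rw [← mk_out f, Sym2.mem_iff]
              exact hy.imp And.left And.left
            simp [mem_edgesAt, hf, hv]
          · replace hk : Sum.inr (v, c) ∈ (colDeg U R u c').biUnion fun f =>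
              ({Sum.inl f, Sum.inr (oth u f, c')} : Finset (Sym2 V ⊕ V × β)) := hk
            simp only [mem_biUnion, mem_insert, Sum.inr.injEq, mem_singleton, Prod.mk.injEq,
              reduceCtorEq, false_or] at hk
            obtain ⟨j, hj, h1, h2⟩ := hk
            obtain ⟨h3, h4, -⟩ := mem_filter.1 hj
            have h5 : v ∈ j := h1 ▸ oth_mem h4
            have hu : oth v j = u := by
              have h6 : s(v, oth v j) = s(v, u) := by
                rw [mk_oth h5, h1, Sym2.eq_swap, mk_oth h4]
              exact Sym2.congr_right.1 h6
            refine mem_union_right _ (mem_image.2 ⟨j, mem_edgesAt.2 ⟨h3, h5⟩, ?_⟩)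
            rw [hu, h2]
          · replace hk : Sum.inr (v, c) ∈ (edgesAt U u).biUnion fun f =>
              ({Sum.inl f} : Finset (Sym2 V ⊕ V × β)) := hk
            simp at hk
      _ ≤ M + M := (card_union_le _ _).trans
          (Nat.add_le_add (card_image_le.trans (hM v)) (card_image_le.trans (hM v)))
      _ ≤ _ := by omega

/-- The expected numbers of remaining colours, and of remaining edges. -/
lemma pE_stat_ge (h : IsNibble (colInc U R t) l) (hR : ∀ e ∈ U, (R e).card = l)
    (ht : ∀ v c, (colDeg U R v c).card ≤ t) {e : Sym2 V} (he : e ∈ U) (hd : ¬ e.IsDiag) :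
    l * (1 - (t : ℝ) / (16 * l)) ^ 2 - 1 ≤
      pE (nibW (colInc U R t) l) (uncCount (colInc U R t) (R e) fun c =>
        {Sum.inr ((Quot.out e).1, c), Sum.inr ((Quot.out e).2, c)}) := by
  have hne : (Quot.out e).1 ≠ (Quot.out e).2 := by
    rw [← mk_out e] at hd
    exact hd
  have h1 := abs_pE_uncCount_pair_le h (R e) (fun c => Sum.inr ((Quot.out e).1, c))
    (fun c => Sum.inr ((Quot.out e).2, c)) (fun c _ => by simp [hne])
  simp only [card_hStar_inr (ht _ _), sum_const, hR e he, nsmul_eq_mul] at h1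
  rw [mul_comm (l : ℝ) (nibP l), nibP_mul h, abs_le] at h1
  linarith [h1.1]

lemma pE_stat_le (h : IsNibble (colInc U R t) l) (hR : ∀ e ∈ U, (R e).card = l) (htl : t ≤ l)
    (ht : ∀ v c, (colDeg U R v c).card ≤ t) (v : V) (c : β) :
    pE (nibW (colInc U R t) l) (uncCount (colInc U R t) (colDeg U R v c) fun e =>
        {Sum.inl e, Sum.inr (oth v e, c)}) ≤ 15 / 16 * t * (1 - (t : ℝ) / (16 * l)) + 1 := by
  have hl : (0 : ℝ) < l := by exact_mod_cast h.pos
  have htl' : (t : ℝ) ≤ l := by exact_mod_cast htl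
  have h1 := abs_pE_uncCount_pair_le h (colDeg U R v c) Sum.inl (fun e => Sum.inr (oth v e, c))
    (fun e _ => by simp)
  have h2 : ∑ e ∈ colDeg U R v c, (1 - ((hStar (colInc U R t) (Sum.inl e)).card : ℝ) / (16 * l)) *
      (1 - ((hStar (colInc U R t) (Sum.inr (oth v e, c))).card : ℝ) / (16 * l)) =
      (colDeg U R v c).card * ((1 - (l : ℝ) / (16 * l)) * (1 - (t : ℝ) / (16 * l))) := by
    rw [← nsmul_eq_mul, ← sum_const]
    refine sum_congr rfl fun e he => ?_
    rw [card_hStar_inl (mem_filter.1 he).1, card_hStar_inr (ht _ _), hR e (mem_filter.1 he).1]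
  rw [h2] at h1
  have h3 : (1 - (l : ℝ) / (16 * l)) = 15 / 16 := by
    field_simp
    norm_num
  rw [h3, abs_le] at h1
  have h4 : ((colDeg U R v c).card : ℝ) ≤ t := by exact_mod_cast ht v c
  have h5 : ((colDeg U R v c).card : ℝ) * nibP l ≤ 1 := by
    calc _ ≤ (l : ℝ) * nibP l := mul_le_mul_of_nonneg_right (h4.trans htl') (nibP_pos h).le
      _ ≤ 1 := by rw [mul_comm, nibP_mul h]; norm_num
  have h6 : 0 ≤ 1 - (t : ℝ) / (16 * l) := by
    rw [sub_nonneg, div_le_one (by positivity)]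
    linarith
  have h7 : ((colDeg U R v c).card : ℝ) * (15 / 16 * (1 - (t : ℝ) / (16 * l))) ≤
      t * (15 / 16 * (1 - (t : ℝ) / (16 * l))) :=
    mul_le_mul_of_nonneg_right h4 (by positivity)
  linarith [h1.2]

lemma pE_stat_eq (h : IsNibble (colInc U R t) l) (hR : ∀ e ∈ U, (R e).card = l) (v : V) :
    pE (nibW (colInc U R t) l) (uncCount (colInc U R t) (edgesAt U v) fun e =>
        {Sum.inl e}) = 15 / 16 * (edgesAt U v).card := by
  have hl : (0 : ℝ) < l := by exact_mod_cast h.pos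
  rw [pE_uncCount_singleton h, mul_comm (15 / 16 : ℝ), ← nsmul_eq_mul, ← sum_const]
  refine sum_congr rfl fun e he => ?_
  rw [card_hStar_inl (mem_filter.1 he).1, hR e (mem_filter.1 he).1]
  field_simp
  norm_num

end Step
section Counting

variable {X E γ : Type*} [DecidableEq X] [Fintype E] [DecidableEq E]
  {inc : E → Finset X} {J S : Finset γ} {Y : γ → Finset X} {ω : E → Option Bool}

lemma uncCount_le_card (h : ∀ j ∈ J, (∀ y ∈ Y j, ¬ Covered inc ω y) → j ∈ S) :
    uncCount inc J Y ω ≤ S.card := by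
  classical
  refine Nat.cast_le.2 (card_le_card fun j hj => ?_)
  rw [mem_filter] at hj
  exact h j hj.1 hj.2

lemma card_le_uncCount (h : ∀ j ∈ S, j ∈ J ∧ ∀ y ∈ Y j, ¬ Covered inc ω y) :
    S.card ≤ uncCount inc J Y ω := by
  classical
  exact Nat.cast_le.2 (card_le_card fun j hj => mem_filter.2 (h j hj))

end Counting

section Step

variable {V β : Type} [DecidableEq V] [DecidableEq β] [Fintype V] [Fintype β]
  {U : Finset (Sym2 V)} {R : Sym2 V → Finset β} {l t : ℕ}

lemma uncCount_le_card_nextList (ω : realPairs U R ⊕ dummyPairs U R t → Option Bool)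
    (e : Sym2 V) : uncCount (colInc U R t) (R e)
      (fun c => {Sum.inr ((Quot.out e).1, c), Sum.inr ((Quot.out e).2, c)}) ω ≤
      (nextList U R t ω e).card := by
  refine uncCount_le_card fun c hc h => mem_nextList.2 ⟨hc, fun v hv => h _ ?_⟩
  rw [← mk_out e, Sym2.mem_iff] at hv
  rcases hv with hv | hv <;> simp [← hv]

lemma card_colDeg_next_le (ω : realPairs U R ⊕ dummyPairs U R t → Option Bool) (v : V) (c : β) :
    ((colDeg (nextUncol U R t ω) (nextList U R t ω) v c).card : ℝ) ≤
      uncCount (colInc U R t) (colDeg U R v c)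
        (fun e => {Sum.inl e, Sum.inr (oth v e, c)}) ω := by
  refine card_le_uncCount fun e he => ?_
  rw [colDeg, mem_filter, mem_nextUncol, mem_nextList] at he
  obtain ⟨⟨h1, h2⟩, h3, h4, h5⟩ := he
  refine ⟨mem_filter.2 ⟨h1, h3, h4⟩, ?_⟩
  simp only [mem_insert, mem_singleton, forall_eq_or_imp, forall_eq]
  exact ⟨h2, h5 _ (oth_mem h3)⟩

lemma card_edgesAt_next (ω : realPairs U R ⊕ dummyPairs U R t → Option Bool) (v : V) :
    ((edgesAt (nextUncol U R t ω) v).card : ℝ) =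
      uncCount (colInc U R t) (edgesAt U v) (fun e => {Sum.inl e}) ω := by
  refine le_antisymm (card_le_uncCount fun e he => ?_) (uncCount_le_card fun e he h => ?_)
  · rw [mem_edgesAt, mem_nextUncol] at he
    simpa [mem_edgesAt, he.1.1, he.2] using he.1.2
  · rw [mem_edgesAt] at he ⊢
    exact ⟨mem_nextUncol.2 ⟨he.1, h _ (mem_singleton_self _)⟩, he.2⟩

/-- One nibble, applied to lists of size exactly `l`. -/
lemma PartialCol.exists_step {Ed : Finset (Sym2 V)} {L : Sym2 V → Finset β} {φ : Sym2 V → β}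
    (h : PartialCol Ed L U φ R) (hEd : ∀ e ∈ Ed, ¬ e.IsDiag) {M Q : ℕ} {lam : ℝ}
    (hl : 0 < l) (hR : ∀ e ∈ U, l ≤ (R e).card) (ht : ∀ v c, (colDeg U R v c).card ≤ t)
    (htl : t ≤ l) (hM : ∀ v, (edgesAt U v).card ≤ M) (hM0 : 0 < M) (hlQ : l ≤ Q) (hMQ : M ≤ Q)
    (hlam : 0 ≤ lam) (hlam1 : lam ≤ 2 * √l) (hlam2 : lam ≤ 2 * √M)
    (hQ : 6144 * (Q : ℝ) ^ 5 * Real.exp (-(lam ^ 2 / 160)) ≤ 1) :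
    ∃ U' φ' R', PartialCol Ed L U' φ' R' ∧
      (∀ e ∈ U', l * (1 - (t : ℝ) / (16 * l)) ^ 2 - 1 - lam * √l ≤ (R' e).card) ∧
      (∀ v c, ((colDeg U' R' v c).card : ℝ) ≤
        15 / 16 * t * (1 - (t : ℝ) / (16 * l)) + 1 + lam * √l) ∧
      ∀ v, |((edgesAt U' v).card : ℝ) - 15 / 16 * (edgesAt U v).card| ≤ lam * √M := by
  obtain ⟨R, h, hsub, hR, hR0⟩ := h.exists_card_eq hR
  replace ht : ∀ v c, (colDeg U R v c).card ≤ t := fun v c =>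
    (card_le_card (colDeg_subset hsub v c)).trans (ht v c)
  have hinc := isNibble_colInc hl hR ht htl
  have hRl : ∀ e, (R e).card ≤ l := fun e => by
    by_cases he : e ∈ U
    · exact (hR e he).le
    · simp [hR0 e he]
  obtain ⟨ω, hω⟩ := exists_forall_notMem_farEvent hinc (J := statSet U R) (Y := statVtx)
    (mf := statBd V β l M) disjoint_statVtx
    (card_biUnion_statVtx_le hRl (fun v c => (ht v c).trans htl) hM)
    (by rintro (_ | _ | _) <;> assumption) (by rintro (_ | _ | _) <;> assumption) hlQ
    (card_stat_mem_le hl hlQ hMQ hRl hR0 hM) hlam (by rintro (_ | _ | _) <;> assumption) hQ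
  refine ⟨nextUncol U R t ω, nextCol φ ω, nextList U R t ω, h.next, fun e he => ?_,
    fun v c => ?_, fun v => ?_⟩
  · have h1 : ω ∉ farEvent (colInc U R t) l (R e)
      (fun c => {Sum.inr ((Quot.out e).1, c), Sum.inr ((Quot.out e).2, c)}) (lam * √l) :=
      hω (Sum.inl e)
    simp only [farEvent, Set.mem_ofPred_eq, not_le, abs_lt] at h1
    have heU := (mem_nextUncol.1 he).1
    have h2 := pE_stat_ge hinc hR ht heU (hEd e (h.subset heU))
    linarith [h1.1, uncCount_le_card_nextList ω e]
  · have h1 : ω ∉ farEvent (colInc U R t) l (colDeg U R v c)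
      (fun e => {Sum.inl e, Sum.inr (oth v e, c)}) (lam * √l) := hω (Sum.inr (Sum.inl (v, c)))
    simp only [farEvent, Set.mem_ofPred_eq, not_le, abs_lt] at h1
    have h2 := pE_stat_le hinc hR htl ht v c
    linarith [h1.2, card_colDeg_next_le ω v c]
  · have h1 : ω ∉ farEvent (colInc U R t) l (edgesAt U v) (fun e => {Sum.inl e}) (lam * √M) :=
      hω (Sum.inr (Sum.inr v))
    simp only [farEvent, Set.mem_ofPred_eq, not_le] at h1
    rw [card_edgesAt_next, ← show _ = _ from pE_stat_eq hinc hR v]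
    exact h1.le

end Step
section NibbleNumerics

variable {s p P lam l : ℝ}

lemma list_step_le (hs : 0 < s) (hlam : 1 ≤ lam) (hp : 0 < p) (hpP : p ≤ P)
    (hP : 144 * lam ≤ s * P) {t : ℝ} (ht : t ≤ s ^ 2 * P * p)
    (hl : s ^ 2 * P ^ 2 ≤ l) :
    s ^ 2 * (P - p / 16 - 3 * lam / s) ^ 2 ≤ l * (1 - t / (16 * l)) ^ 2 - 1 - lam * √l := by
  have hP0 : 0 < P := hp.trans_le hpP
  have hl0 : 0 < l := lt_of_lt_of_le (by positivity) hl
  set x := √l with hx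
  have hxl : l = x ^ 2 := (Real.sq_sqrt hl0.le).symm
  have hx0 : 0 < x := Real.sqrt_pos.2 hl0
  have hxs : s * P ≤ x := by
    rw [hx]
    exact Real.le_sqrt_of_sq_le (by rw [mul_pow]; exact hl)
  set ρ := p / (16 * P) with hρ
  have hρ1 : ρ ≤ 1 / 16 := by
    rw [hρ, div_le_div_iff₀ (by positivity) (by norm_num)]
    linarith
  have hρ0 : 0 < ρ := by positivity
  have h1 : t / (16 * l) ≤ ρ := by
    rw [hρ, div_le_div_iff₀ (by positivity) (by positivity)]
    have h2 : s ^ 2 * P ^ 2 * p ≤ l * p := mul_le_mul_of_nonneg_right hl hp.le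
    have h3 : t * P ≤ s ^ 2 * P * p * P := mul_le_mul_of_nonneg_right ht hP0.le
    nlinarith
  have h2 : l * (1 - ρ) ^ 2 ≤ l * (1 - t / (16 * l)) ^ 2 := by
    gcongr
    linarith
  have h3 : (s * P) ^ 2 * (1 - ρ) ^ 2 - lam * (s * P) ≤ x ^ 2 * (1 - ρ) ^ 2 - lam * x := by
    have h4 : (15 / 16 : ℝ) ^ 2 ≤ (1 - ρ) ^ 2 := by
      gcongr
      linarith
    have h5 : lam ≤ (x + s * P) * (1 - ρ) ^ 2 := by nlinarith
    nlinarith [mul_nonneg (sub_nonneg.2 hxs) (sub_nonneg.2 h5)]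
  have h4 : (s * P) ^ 2 * (1 - ρ) ^ 2 = (s * P - s * p / 16) ^ 2 := by
    rw [hρ]
    field_simp
  have h5 : s ^ 2 * (P - p / 16 - 3 * lam / s) ^ 2 = (s * P - s * p / 16 - 3 * lam) ^ 2 := by
    field_simp
  have h6 : s * p ≤ s * P := mul_le_mul_of_nonneg_left hpP hs.le
  rw [h5]
  rw [← hxl] at h3
  nlinarith

lemma colDeg_step_le (hs : 0 < s) (hlam : 1 ≤ lam) (hp : 0 < p) (hpP : p ≤ P)
    (hP : 144 * lam ≤ s * P) {t : ℝ} (ht0 : 0 ≤ t) (ht : t ≤ s ^ 2 * P * p)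
    (hl : s ^ 2 * P ^ 2 ≤ l) (hl' : l ≤ s ^ 2 * P ^ 2 + 1) :
    15 / 16 * t * (1 - t / (16 * l)) + 1 + lam * √l ≤
      s ^ 2 * (P - p / 16 - 3 * lam / s) * (15 / 16 * p + 9 * lam / s) := by
  have hP0 : 0 < P := hp.trans_le hpP
  have hl0 : 0 < l := lt_of_lt_of_le (by positivity) hl
  set y := s * P with hy
  set z := s * p with hz
  have hzy : z ≤ y := mul_le_mul_of_nonneg_left hpP hs.le
  have hz0 : 0 < z := by positivity
  have hy0 : 0 < y := by positivity
  have hyl : y ^ 2 ≤ l := by rw [hy, mul_pow]; exact hl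
  have hyl' : l ≤ y ^ 2 + 1 := by rw [hy, mul_pow]; exact hl'
  have hT : t ≤ y * z := ht.trans_eq (by rw [hy, hz]; ring)
  have h1 : √l ≤ y + 1 := Real.sqrt_le_iff.2 ⟨by positivity, by nlinarith⟩
  have h2 : t * (1 - t / (16 * l)) ≤ y * z - z ^ 2 / 16 + 1 := by
    have h3 : t * (1 - t / (16 * l)) ≤ y * z * (1 - y * z / (16 * l)) := by
      have h4 : y * z * (1 - y * z / (16 * l)) - t * (1 - t / (16 * l)) =
          (y * z - t) * (1 - (y * z + t) / (16 * l)) := by ring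
      have h5 : (y * z + t) / (16 * l) ≤ 1 := by
        rw [div_le_one (by positivity)]
        nlinarith
      nlinarith [mul_nonneg (sub_nonneg.2 hT) (sub_nonneg.2 h5)]
    refine h3.trans ?_
    have h4 : z ^ 2 - 1 ≤ (y * z) ^ 2 / l := by
      rw [le_div_iff₀ hl0]
      rcases le_total (z ^ 2) 1 with h | h
      · nlinarith [mul_nonneg hl0.le (sub_nonneg.2 h), sq_nonneg (y * z)]
      · nlinarith [mul_le_mul_of_nonneg_left hyl' (sub_nonneg.2 h)]
    have h5 : y * z * (1 - y * z / (16 * l)) = y * z - (y * z) ^ 2 / l / 16 := by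
      field_simp
    rw [h5]
    linarith
  have h3 : s ^ 2 * (P - p / 16 - 3 * lam / s) * (15 / 16 * p + 9 * lam / s) =
      (y - z / 16 - 3 * lam) * (15 / 16 * z + 9 * lam) := by
    rw [hy, hz]
    field_simp
  rw [h3]
  have h4 : lam * √l ≤ lam * (y + 1) := by gcongr
  nlinarith

end NibbleNumerics

section Iteration

variable {V β : Type} [DecidableEq V] [DecidableEq β]

/-- There is a partial colouring whose uncoloured part is controlled by the parameters `p`
(degrees), `P` (lists) and `q` (minimum degree), in units of `s ^ 2`. -/
def NibbleState (Ed : Finset (Sym2 V)) (L : Sym2 V → Finset β) (s p P q : ℝ) : Prop :=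
  ∃ U φ R, PartialCol Ed L U φ R ∧ (∀ e ∈ U, s ^ 2 * P ^ 2 ≤ (R e).card) ∧
    (∀ v c, ((colDeg U R v c).card : ℝ) ≤ s ^ 2 * P * p) ∧
    ∀ v, ((edgesAt U v).card : ℝ) ≤ s ^ 2 * p ∧ q ≤ (edgesAt U v).card

variable [Fintype V] [Fintype β] {Ed : Finset (Sym2 V)} {L : Sym2 V → Finset β}
  {s p P q lam : ℝ} {Q : ℕ}

lemma NibbleState.step (h : NibbleState Ed L s p P q) (hEd : ∀ e ∈ Ed, ¬ e.IsDiag) (hs : 0 < s)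
    (hlam : 2 ≤ lam) (hp : 0 < p) (hp1 : p ≤ 1) (hpP : p ≤ P) (hP2 : P ≤ 2)
    (hP : 144 * lam ≤ s * P) (hps : lam ^ 2 ≤ s ^ 2 * p) (hQ : 5 * s ^ 2 ≤ Q)
    (hQ' : 6144 * (Q : ℝ) ^ 5 * Real.exp (-(lam ^ 2 / 160)) ≤ 1) :
    NibbleState Ed L s (15 / 16 * p + 9 * lam / s) (P - p / 16 - 3 * lam / s)
      (15 / 16 * q - lam * (s * √p)) := by
  obtain ⟨U, φ, R, hU, hR, hc, hd⟩ := h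
  have hP0 : 0 < P := hp.trans_le hpP
  have hs2 : lam ^ 2 ≤ s ^ 2 := hps.trans (by nlinarith [sq_nonneg s])
  have hl1 : s ^ 2 * P ^ 2 ≤ ⌈s ^ 2 * P ^ 2⌉₊ := Nat.le_ceil _
  have hl2 : (⌈s ^ 2 * P ^ 2⌉₊ : ℝ) ≤ s ^ 2 * P ^ 2 + 1 := (Nat.ceil_lt_add_one (by positivity)).le
  have ht1 : (⌊s ^ 2 * P * p⌋₊ : ℝ) ≤ s ^ 2 * P * p := Nat.floor_le (by positivity)
  have hM1 : (⌊s ^ 2 * p⌋₊ : ℝ) ≤ s ^ 2 * p := Nat.floor_le (by positivity)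
  have hM2 : lam ^ 2 / 4 ≤ (⌊s ^ 2 * p⌋₊ : ℝ) := by
    have := Nat.lt_floor_add_one (s ^ 2 * p)
    nlinarith
  have hMs : √(⌊s ^ 2 * p⌋₊ : ℝ) ≤ s * √p := by
    rw [← Real.sqrt_sq hs.le, ← Real.sqrt_mul (sq_nonneg s), Real.sqrt_sq hs.le]
    exact Real.sqrt_le_sqrt hM1
  have hPp : s ^ 2 * P * p ≤ s ^ 2 * P ^ 2 := by
    have : s ^ 2 * P * p ≤ s ^ 2 * P * P := by gcongr
    linarith
  obtain ⟨U', φ', R', hU', hR', hc', hd'⟩ := hU.exists_step hEd (l := ⌈s ^ 2 * P ^ 2⌉₊)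
    (t := ⌊s ^ 2 * P * p⌋₊) (M := ⌊s ^ 2 * p⌋₊) (Q := Q) (lam := lam)
    (Nat.ceil_pos.2 (by positivity)) (fun e he => Nat.ceil_le.2 (hR e he))
    (fun v c => Nat.le_floor (hc v c))
    (by exact_mod_cast ht1.trans (hPp.trans hl1))
    (fun v => Nat.le_floor (hd v).1)
    (by
      have h1 : (0 : ℝ) < ⌊s ^ 2 * p⌋₊ := by nlinarith
      exact_mod_cast h1)
    (by
      refine Nat.ceil_le.2 (le_trans ?_ hQ)
      nlinarith [mul_le_mul_of_nonneg_left (show P ^ 2 ≤ 4 by nlinarith) (sq_nonneg s)])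
    (by
      have h1 : (⌊s ^ 2 * p⌋₊ : ℝ) ≤ Q := hM1.trans (le_trans (by nlinarith [sq_nonneg s]) hQ)
      exact_mod_cast h1)
    (by linarith)
    (by
      have h1 : s * P ≤ √(⌈s ^ 2 * P ^ 2⌉₊ : ℝ) :=
        Real.le_sqrt_of_sq_le (by rw [mul_pow]; exact hl1)
      linarith)
    (by
      have h1 : lam / 2 ≤ √(⌊s ^ 2 * p⌋₊ : ℝ) := Real.le_sqrt_of_sq_le (by linarith)
      linarith)
    hQ'
  refine ⟨U', φ', R', hU', fun e he => (list_step_le hs (by linarith) hp hpP hP ht1 hl1).trans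
    (hR' e he), fun v c => (hc' v c).trans (colDeg_step_le hs (by linarith) hp hpP hP
    (Nat.cast_nonneg _) ht1 hl1 hl2), fun v => ?_⟩
  have h1 := abs_le.1 ((hd' v).trans (mul_le_mul_of_nonneg_left hMs (by linarith)))
  have h2 : s * √p ≤ s := by
    have : √p ≤ 1 := Real.sqrt_le_one.2 hp1
    nlinarith
  have h3 : s ^ 2 * (15 / 16 * p + 9 * lam / s) = 15 / 16 * (s ^ 2 * p) + 9 * lam * s := by
    field_simp
  have h4 : lam * (s * √p) ≤ lam * s := by gcongr
  have h5 : 0 < lam * s := by positivity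
  rw [h3]
  have h6 := hd v
  constructor <;> linarith [h1.1, h1.2]

end Iteration
section Iteration

variable {V β : Type} [DecidableEq V] [DecidableEq β] [Fintype V] [Fintype β]
  {Ed : Finset (Sym2 V)} {L : Sym2 V → Finset β}

lemma exists_pow_near {s : ℝ} (hs : 1 ≤ s) :
    ∃ N : ℕ, 1 / s ≤ (15 / 16 : ℝ) ^ N ∧ (15 / 16 : ℝ) ^ N ≤ 16 / 15 / s ∧
      (N : ℝ) ≤ 16 * Real.log s := by
  obtain ⟨N, h1, h2⟩ := exists_nat_pow_near hs (show (1 : ℝ) < 16 / 15 by norm_num)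
  have h3 : (15 / 16 : ℝ) ^ N = 1 / (16 / 15) ^ N := by
    rw [← one_div_pow]
    norm_num
  refine ⟨N, ?_, ?_, ?_⟩
  · rw [h3]
    exact one_div_le_one_div_of_le (by positivity) h1
  · rw [h3, div_le_div_iff₀ (by positivity) (by linarith)]
    rw [pow_succ] at h2
    linarith
  · have h4 := Real.log_le_log (by positivity) h1
    rw [Real.log_pow] at h4
    have h5 := Real.one_sub_inv_le_log_of_pos (show (0 : ℝ) < 16 / 15 by norm_num)
    have h6 : (1 : ℝ) / 16 ≤ Real.log (16 / 15) := le_trans (by norm_num) h5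
    nlinarith [Nat.cast_nonneg (α := ℝ) N]

lemma edge_error_le {w lam r p : ℝ} (hw : 1 ≤ w) (hlam : 1 ≤ lam) (hr : 0 < r)
    (hrw : 1 ≤ r * w ^ 2) (hp : p ≤ r + 144 * lam * r) :
    lam * (w ^ 2 * √p) ≤ 15 / 16 * r * (w ^ 2) ^ 2 / 4 * (56 * lam ^ 2 / w) := by
  have h5 : √p ≤ 13 * lam * √r := by
    rw [show 13 * lam * √r = √((13 * lam) ^ 2 * r) by
      rw [Real.sqrt_mul (by positivity), Real.sqrt_sq (by positivity)]]
    apply Real.sqrt_le_sqrt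
    nlinarith [mul_le_mul_of_nonneg_right hlam hr.le]
  have h6 : 1 ≤ √r * w := by
    have h7 : √(r * w ^ 2) = √r * w := by
      rw [Real.sqrt_mul hr.le, Real.sqrt_sq (by linarith)]
    rw [← h7]
    exact Real.one_le_sqrt.2 hrw
  have h9 : √r * √r = r := Real.mul_self_sqrt hr.le
  have h8 : 15 / 16 * r * (w ^ 2) ^ 2 / 4 * (56 * lam ^ 2 / w) =
      13.125 * lam ^ 2 * w ^ 2 * √r * (√r * w) := by
    rw [show 13.125 * lam ^ 2 * w ^ 2 * √r * (√r * w) =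
      13.125 * lam ^ 2 * w ^ 3 * (√r * √r) by ring, h9]
    field_simp
    norm_num
  rw [h8]
  calc lam * (w ^ 2 * √p) ≤ lam * (w ^ 2 * (13 * lam * √r)) := by gcongr
    _ = 13 * lam ^ 2 * w ^ 2 * √r * 1 := by ring
    _ ≤ 13.125 * lam ^ 2 * w ^ 2 * √r * (√r * w) := by gcongr; norm_num

/-- The parameters after `i` nibbles. -/
lemma nibbleState_iterate {w lam : ℝ} {Q N : ℕ} (hEd : ∀ e ∈ Ed, ¬ e.IsDiag) (hlam : 192 ≤ lam)
    (hw : 896 * lam ^ 3 ≤ w) (hQ : 5 * (w ^ 2) ^ 2 ≤ Q)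
    (hQ' : 6144 * (Q : ℝ) ^ 5 * Real.exp (-(lam ^ 2 / 160)) ≤ 1)
    (hN : 1 / w ^ 2 ≤ (15 / 16 : ℝ) ^ N) (hN' : (N : ℝ) ≤ 8 * lam)
    (h0 : NibbleState Ed L (w ^ 2) 1 (1 + lam ^ 3 / w ^ 2) ((w ^ 2) ^ 2 / 4)) {i : ℕ}
    (hi : i ≤ N) :
    NibbleState Ed L (w ^ 2) ((15 / 16) ^ i + 144 * lam / w ^ 2 * (1 - (15 / 16) ^ i))
      ((15 / 16) ^ i + 144 * lam / w ^ 2 * (1 - (15 / 16) ^ i) + lam ^ 3 / w ^ 2 -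
        12 * i * lam / w ^ 2)
      ((15 / 16) ^ i * (w ^ 2) ^ 2 / 4 * (1 - i * (56 * lam ^ 2 / w))) := by
  have hlam3 : lam ≤ lam ^ 3 := le_self_pow₀ (by linarith) (by norm_num)
  have hw1 : 1 ≤ w := by linarith
  induction i with
  | zero => simpa using h0
  | succ i ih =>
    replace ih := ih (by omega)
    set s := w ^ 2 with hs
    have hs0 : 0 < s := by positivity
    have hws : w ≤ s := le_self_pow₀ hw1 (by norm_num)
    set r : ℝ := (15 / 16) ^ i with hr
    have hr0 : 0 < r := by positivity
    have hr1 : r ≤ 1 := pow_le_one₀ (by norm_num) (by norm_num)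
    have hrs : 1 / s ≤ r :=
      hN.trans (pow_le_pow_of_le_one (by norm_num) (by norm_num) (by omega))
    have hrs' : 1 ≤ r * s := by rwa [div_le_iff₀ hs0] at hrs
    set p := r + 144 * lam / s * (1 - r) with hp
    have hrp : r ≤ p := by
      have : 0 ≤ 144 * lam / s * (1 - r) := mul_nonneg (by positivity) (by linarith)
      linarith
    have h144 : 144 * lam / s ≤ 1 := by
      rw [div_le_one hs0]
      linarith
    have hp1 : p ≤ 1 := by nlinarith
    have hi8 : (i : ℝ) ≤ 8 * lam := by
      have : (i : ℝ) ≤ N := by exact_mod_cast (by omega : i ≤ N)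
      linarith
    have hgap : lam ^ 3 / s / 2 ≤ lam ^ 3 / s - 12 * i * lam / s := by
      rw [div_div, ← sub_div, div_le_div_iff₀ (by positivity) hs0]
      have h1 : 12 * i * lam ≤ lam ^ 3 / 2 := by nlinarith
      nlinarith
    have hgap0 : 0 < lam ^ 3 / s / 2 := by positivity
    have hε1 : lam ^ 3 / s ≤ 1 := by
      rw [div_le_one hs0]
      nlinarith
    have hi0 : 0 ≤ 12 * i * lam / s := by positivity
    have hstep := ih.step hEd hs0 (by linarith) (hr0.trans_le hrp) hp1 (by linarith)
      (by linarith)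
      (by
        have h1 : s * (lam ^ 3 / s / 2) = lam ^ 3 / 2 := by field_simp
        have h2 : s * (lam ^ 3 / s / 2) ≤
            s * (p + lam ^ 3 / s - 12 * i * lam / s) :=
          mul_le_mul_of_nonneg_left (by linarith) hs0.le
        nlinarith)
      (by
        have h1 : s * (r * s) ≤ s ^ 2 * p := by nlinarith [mul_pos hs0 hs0]
        nlinarith)
      hQ hQ'
    have e1 : 15 / 16 * p + 9 * lam / s =
        (15 / 16) ^ (i + 1) + 144 * lam / s * (1 - (15 / 16) ^ (i + 1)) := by
      rw [hp, pow_succ, ← hr]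
      ring
    have e2 : p + lam ^ 3 / s - 12 * i * lam / s - p / 16 - 3 * lam / s =
        (15 / 16) ^ (i + 1) + 144 * lam / s * (1 - (15 / 16) ^ (i + 1)) + lam ^ 3 / s -
          12 * (i + 1 : ℕ) * lam / s := by
      rw [← e1]
      push_cast
      ring
    rw [e1, e2] at hstep
    obtain ⟨U, φ, R, h1, h2, h3, h4⟩ := hstep
    refine ⟨U, φ, R, h1, h2, h3, fun v => ⟨(h4 v).1, le_trans ?_ (h4 v).2⟩⟩
    have h5 : lam * (s * √p) ≤ 15 / 16 * r * s ^ 2 / 4 * (56 * lam ^ 2 / w) := by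
      refine edge_error_le hw1 (by linarith) hr0 hrs' ?_
      have h6 : 144 * lam / s ≤ 144 * lam * r := by
        rw [div_le_iff₀ hs0]
        nlinarith
      have h7 : 0 ≤ 144 * lam / s * r := by positivity
      linarith
    have h6 : 0 ≤ 56 * lam ^ 2 / w := by positivity
    push_cast
    rw [pow_succ, ← hr]
    linarith

/-- The state from which the colouring is completed. -/
lemma exists_final_state {w lam : ℝ} {Q : ℕ} (hEd : ∀ e ∈ Ed, ¬ e.IsDiag) (hlam : 192 ≤ lam)
    (hw : 896 * lam ^ 3 ≤ w) (hlog : 4 * Real.log w = lam) (hQ : 5 * (w ^ 2) ^ 2 ≤ Q)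
    (hQ' : 6144 * (Q : ℝ) ^ 5 * Real.exp (-(lam ^ 2 / 160)) ≤ 1)
    (h0 : NibbleState Ed L (w ^ 2) 1 (1 + lam ^ 3 / w ^ 2) ((w ^ 2) ^ 2 / 4)) :
    ∃ p P : ℝ, 0 < p ∧ p ≤ 146 * lam / w ^ 2 ∧ lam ^ 3 / (2 * w ^ 2) ≤ P ∧
      NibbleState Ed L (w ^ 2) p P (w ^ 2 / 8) := by
  have hlam3 : lam ≤ lam ^ 3 := le_self_pow₀ (by linarith) (by norm_num)
  have hw1 : 1 ≤ w := by linarith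
  have hs0 : 0 < w ^ 2 := by positivity
  obtain ⟨N, hN1, hN2, hN3⟩ := exists_pow_near (one_le_pow₀ hw1 : 1 ≤ w ^ 2)
  have hN4 : (N : ℝ) ≤ 8 * lam := by
    rw [Real.log_pow] at hN3
    push_cast at hN3
    linarith
  obtain ⟨U, φ, R, h1, h2, h3, h4⟩ := nibbleState_iterate hEd hlam hw hQ hQ' hN1 hN4 h0 le_rfl
  set r : ℝ := (15 / 16) ^ N with hr
  have hr0 : 0 < r := by positivity
  have hr1 : r ≤ 1 := pow_le_one₀ (by norm_num) (by norm_num)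
  have hp0 : 0 ≤ 144 * lam / w ^ 2 * (1 - r) := mul_nonneg (by positivity) (by linarith)
  refine ⟨_, _, by positivity, ?_, ?_, U, φ, R, h1, h2, h3,
    fun v => ⟨(h4 v).1, le_trans ?_ (h4 v).2⟩⟩
  · have e1 : 144 * lam / w ^ 2 * (1 - r) ≤ 144 * lam / w ^ 2 := by
      have : 0 ≤ 144 * lam / w ^ 2 * r := by positivity
      linarith
    have e2 : 16 / 15 / w ^ 2 ≤ 2 * lam / w ^ 2 := by
      gcongr
      linarith
    have e3 : 146 * lam / w ^ 2 = 2 * lam / w ^ 2 + 144 * lam / w ^ 2 := by ring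
    linarith
  · have e1 : lam ^ 3 / (2 * w ^ 2) ≤ lam ^ 3 / w ^ 2 - 12 * N * lam / w ^ 2 := by
      rw [← sub_div, div_le_div_iff₀ (by positivity) hs0]
      have e2 : 12 * N * lam ≤ lam ^ 3 / 2 := by nlinarith
      nlinarith
    linarith
  · have e1 : (N : ℝ) * (56 * lam ^ 2 / w) ≤ 1 / 2 := by
      rw [← mul_div_assoc, div_le_iff₀ (by linarith)]
      nlinarith [sq_nonneg lam]
    have e2 : 1 ≤ r * w ^ 2 := by rwa [div_le_iff₀ hs0] at hN1
    have e3 : w ^ 2 ≤ r * (w ^ 2) ^ 2 := by nlinarith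
    nlinarith

end Iteration
section Hitting

variable {ι α : Type*} [Fintype ι] [Fintype α] [DecidableEq ι] {w : ι → α → ℝ}

lemma pP_exists_le (hw : IsProbWeight w) {K : Type*} (s : Finset K) (B : K → Set (ι → α)) :
    pP w {ω | ∃ k ∈ s, ω ∈ B k} ≤ ∑ k ∈ s, pP w (B k) := by
  unfold pP
  rw [← pE_sum]
  refine pE_mono hw fun ω => ?_
  have h0 : ∀ k ∈ s, (0 : ℝ) ≤ (B k).indicator 1 ω := fun k _ =>
    Set.indicator_nonneg (fun _ _ => zero_le_one) ω
  by_cases h : ∃ k ∈ s, ω ∈ B k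
  · obtain ⟨k, hk, hω⟩ := h
    rw [Set.indicator_of_mem (by exact ⟨k, hk, hω⟩)]
    refine le_trans ?_ (single_le_sum h0 hk)
    rw [Set.indicator_of_mem hω]
  · rw [Set.indicator_of_notMem (by exact h)]
    exact sum_nonneg h0

lemma pP_le_of_piecewise (hw : IsProbWeight w) (S : Finset ι) {A : Set (ι → α)} {b : ℝ}
    (h : ∀ ω₀, pP w {ω | S.piecewise ω ω₀ ∈ A} ≤ b) : pP w A ≤ b := by
  unfold pP
  rw [← pE_pAvg hw S, ← pE_const hw b]
  exact pE_mono hw h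

variable [DecidableEq α]

/-- The probability that all elements of `X` are values of coordinates in `F`. -/
lemma pP_hit_le (hw : IsProbWeight w) (F : Finset ι) (X : Finset α) :
    pP w {ω | ∀ γ ∈ X, ∃ e ∈ F, ω e = γ} ≤ ∏ γ ∈ X, ∑ e ∈ F, w e γ := by
  have h1 : ∏ γ ∈ X, ∑ e ∈ F, w e γ =
      ∑ τ ∈ Fintype.piFinset fun _ : X => F, ∏ γ : X, w (τ γ) γ := by
    rw [← prod_coe_sort X]
    exact prod_univ_sum (fun _ : X => F) fun γ e => w e γ
  rw [h1]
  refine le_trans (pP_mono hw ?_) ((pP_exists_le hw _ fun τ : X → ι =>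
    {ω | ∀ γ : X, ω (τ γ) = γ}).trans (sum_le_sum fun τ _ => ?_))
  · intro ω hω
    choose τ hτ using fun γ : X => hω γ.1 γ.2
    exact ⟨τ, Fintype.mem_piFinset.2 fun γ => (hτ γ).1, fun γ => (hτ γ).2⟩
  by_cases hinj : Function.Injective τ
  · have h2 := pP_cylinder hw (univ.image τ) fun i => univ.filter fun a => ∀ γ, τ γ = i → a = γ.1
    rw [prod_image hinj.injOn] at h2
    refine (pP_mono hw fun ω hω => ?_).trans (h2.trans_le (prod_le_prod
      (fun γ _ => sum_nonneg fun a _ => hw.nonneg _ _) fun γ _ => ?_))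
    · intro i hi
      obtain ⟨γ, -, rfl⟩ := mem_image.1 hi
      refine mem_filter.2 ⟨mem_univ _, fun γ' h' => ?_⟩
      rw [hinj h']
      exact hω γ
    · rw [show (univ.filter fun a => ∀ γ', τ γ' = τ γ → a = γ'.1) = {γ.1} by
        ext a
        simp only [mem_filter, mem_univ, true_and, mem_singleton]
        refine ⟨fun h => h γ rfl, ?_⟩
        rintro rfl γ' h
        rw [hinj h]]
      rw [sum_singleton]
  · refine le_trans ?_ (prod_nonneg fun γ _ => hw.nonneg _ _)
    have h2 : {ω : ι → α | ∀ γ : X, ω (τ γ) = γ} = ∅ := by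
      rw [Set.eq_empty_iff_forall_notMem]
      intro ω hω
      refine hinj fun γ γ' h => Subtype.ext ?_
      rw [← hω γ, ← hω γ', h]
    rw [h2]
    simp [pP, pE]

/-- The probability that many elements of `X` are values of coordinates in `F`. -/
lemma pP_many_hit_le (hw : IsProbWeight w) {F : Finset ι} {X : Finset α} {ρ : ℝ} {m k : ℕ}
    (hρ0 : 0 ≤ ρ) (hρ1 : ρ ≤ 1) (hρ : ∀ γ ∈ X, ∑ e ∈ F, w e γ ≤ ρ) (hm : X.card ≤ m) :
    pP w {ω | k ≤ (X.filter fun γ => ∃ e ∈ F, ω e = γ).card} ≤ 2 ^ m * ρ ^ k := by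
  refine le_trans (pP_mono hw ?_) ((pP_exists_le hw (X.powerset.filter (k ≤ #·)) fun Y =>
    {ω | ∀ γ ∈ Y, ∃ e ∈ F, ω e = γ}).trans (le_trans (sum_le_card_nsmul _ _ (ρ ^ k) ?_) ?_))
  · intro ω hω
    exact ⟨_, mem_filter.2 ⟨mem_powerset.2 (filter_subset _ _), hω⟩,
      fun γ hγ => (mem_filter.1 hγ).2⟩
  · intro Y hY
    obtain ⟨h1, h2⟩ := mem_filter.1 hY
    refine (pP_hit_le hw F Y).trans ((prod_le_prod (fun γ _ => sum_nonneg fun e _ => hw.nonneg _ _)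
      fun γ hγ => hρ γ (mem_powerset.1 h1 hγ)).trans ?_)
    rw [prod_const]
    exact pow_le_pow_of_le_one hρ0 hρ1 h2
  · rw [nsmul_eq_mul]
    gcongr
    have h1 : (X.powerset.filter (k ≤ #·)).card ≤ 2 ^ m := by
      refine (card_filter_le _ _).trans ?_
      rw [card_powerset]
      exact Nat.pow_le_pow_right (by norm_num) hm
    exact_mod_cast h1

end Hitting
section Completion

variable {V β : Type} [DecidableEq V]

/-- The colouring equal to `ω` on `U` and to `φ` elsewhere. -/
def merge (U : Finset (Sym2 V)) (φ ω : Sym2 V → β) (e : Sym2 V) : β :=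
  if e ∈ U then ω e else φ e

lemma merge_of_mem {U : Finset (Sym2 V)} {φ ω : Sym2 V → β} {e : Sym2 V} (h : e ∈ U) :
    merge U φ ω e = ω e := if_pos h

lemma merge_of_notMem {U : Finset (Sym2 V)} {φ ω : Sym2 V → β} {e : Sym2 V} (h : e ∉ U) :
    merge U φ ω e = φ e := if_neg h

variable [DecidableEq β]

/-- The uniform weights on the lists of uncoloured edges, and the given colour elsewhere. -/
noncomputable def complW (U : Finset (Sym2 V)) (φ : Sym2 V → β) (R : Sym2 V → Finset β) (l : ℕ)
    (e : Sym2 V) (a : β) : ℝ :=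
  if e ∈ U then (if a ∈ R e then 1 / (l : ℝ) else 0) else if a = φ e then 1 else 0

/-- The palette of a vertex. -/
def palette (Ed : Finset (Sym2 V)) (ψ : Sym2 V → β) (v : V) : Finset β := (edgesAt Ed v).image ψ

/-- The symmetric difference of the palettes of `u` and `v`. -/
def palDiff (Ed : Finset (Sym2 V)) (ψ : Sym2 V → β) (u v : V) : Finset β :=
  (palette Ed ψ u ∪ palette Ed ψ v) \ (palette Ed ψ u ∩ palette Ed ψ v)

/-- The event that the palettes of `u` and `v` are close, for a colouring which is proper and
from the lists near `u`. -/
def closePalettes (Ed U : Finset (Sym2 V)) (φ : Sym2 V → β) (R : Sym2 V → Finset β) (S : ℕ)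
    (u v : V) : Set (Sym2 V → β) :=
  {ω | (∀ e ∈ edgesAt U u, ω e ∈ R e) ∧ Set.InjOn ω (edgesAt U u) ∧
    (palDiff Ed (merge U φ ω) u v).card < S}

/-- The uncoloured edges at `u` other than `uv`. -/
def freeAt (U : Finset (Sym2 V)) (u v : V) : Finset (Sym2 V) := (edgesAt U u).erase s(u, v)

/-- The colours at `v` that are not forced at `u`. -/
def freeCol (Ed U : Finset (Sym2 V)) (ψ : Sym2 V → β) (u v : V) : Finset β :=
  palette Ed ψ v \ (edgesAt Ed u \ freeAt U u v).image ψ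

variable {Ed U : Finset (Sym2 V)} {L R : Sym2 V → Finset β} {φ : Sym2 V → β} {l t S : ℕ}

lemma palette_congr {ψ ψ' : Sym2 V → β} {v : V} (h : ∀ e ∈ edgesAt Ed v, ψ e = ψ' e) :
    palette Ed ψ v = palette Ed ψ' v := image_congr h

lemma mem_freeAt {u v : V} {e : Sym2 V} : e ∈ freeAt U u v ↔ e ≠ s(u, v) ∧ e ∈ U ∧ u ∈ e := by
  rw [freeAt, mem_erase, mem_edgesAt]

lemma notMem_freeAt_of_mem {u v : V} (huv : u ≠ v) {e : Sym2 V} (he : v ∈ e) :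
    e ∉ freeAt U u v := by
  rw [mem_freeAt]
  rintro ⟨h1, -, h3⟩
  exact h1 ((Sym2.mem_and_mem_iff huv).1 ⟨h3, he⟩)

lemma freeCol_congr {ψ ψ' : Sym2 V → β} {u v : V} (huv : u ≠ v)
    (h : ∀ e ∉ freeAt U u v, ψ e = ψ' e) : freeCol Ed U ψ u v = freeCol Ed U ψ' u v := by
  unfold freeCol
  rw [palette_congr fun e he => h e (notMem_freeAt_of_mem huv (mem_edgesAt.1 he).2),
    image_congr fun e he => h e (mem_sdiff.1 he).2]

/-- When the palettes are close, the free edges at `u` use up almost all free colours. -/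
lemma freeCol_of_close {ψ : Sym2 V → β} {u v : V} (hU : U ⊆ Ed)
    (hinj : Set.InjOn ψ (freeAt U u v))
    (hdisj : ∀ e ∈ freeAt U u v, ∀ f ∈ edgesAt Ed u, f ∉ freeAt U u v → ψ e ≠ ψ f)
    (hS : (palDiff Ed ψ u v).card < S) :
    (freeCol Ed U ψ u v).card ≤ (freeAt U u v).card + S ∧ (freeAt U u v).card ≤
      ((freeCol Ed U ψ u v).filter fun γ => ∃ e ∈ freeAt U u v, ψ e = γ).card + S := by
  set F := freeAt U u v with hF
  have hFE : F ⊆ edgesAt Ed u := fun e he =>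
    mem_edgesAt.2 ⟨hU (mem_freeAt.1 he).2.1, (mem_freeAt.1 he).2.2⟩
  have hI : (F.image ψ).card = F.card := card_image_of_injOn hinj
  have hmem : ∀ γ, γ ∈ freeCol Ed U ψ u v ↔
      γ ∈ palette Ed ψ v ∧ γ ∉ (edgesAt Ed u \ F).image ψ := fun γ => mem_sdiff
  have hu : ∀ γ, γ ∈ palette Ed ψ u ↔ γ ∈ F.image ψ ∨ γ ∈ (edgesAt Ed u \ F).image ψ := by
    intro γ
    rw [← mem_union, ← image_union, union_sdiff_of_subset hFE, palette]
  have hIM : ∀ γ ∈ F.image ψ, γ ∉ (edgesAt Ed u \ F).image ψ := by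
    intro γ hγ hγ'
    obtain ⟨e, he, rfl⟩ := mem_image.1 hγ
    obtain ⟨f, hf, hef⟩ := mem_image.1 hγ'
    exact hdisj e he f (mem_sdiff.1 hf).1 (mem_sdiff.1 hf).2 hef.symm
  have hpal : ∀ γ, γ ∈ palDiff Ed ψ u v ↔ (γ ∈ palette Ed ψ u ∨ γ ∈ palette Ed ψ v) ∧
      ¬(γ ∈ palette Ed ψ u ∧ γ ∈ palette Ed ψ v) := fun γ => by
    rw [palDiff, mem_sdiff, mem_union, mem_inter]
  constructor
  · have h1 : freeCol Ed U ψ u v ⊆ F.image ψ ∪ palDiff Ed ψ u v := by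
      intro γ hγ
      have := hmem γ
      have := hu γ
      have := hpal γ
      rw [mem_union]
      tauto
    have h2 := (card_le_card h1).trans (card_union_le _ _)
    omega
  · have h1 : F.image ψ ⊆ ((freeCol Ed U ψ u v).filter fun γ => ∃ e ∈ F, ψ e = γ) ∪
        palDiff Ed ψ u v := by
      intro γ hγ
      have := hmem γ
      have := hu γ
      have := hpal γ
      have := hIM γ hγ
      rw [mem_union, mem_filter, ← mem_image (s := F)]
      tauto
    have h2 := (card_le_card h1).trans (card_union_le _ _)
    omega

lemma sum_complW_le (ht : ∀ v c, (colDeg U R v c).card ≤ t) (u v : V) (γ : β) :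
    ∑ e ∈ freeAt U u v, complW U φ R l e γ ≤ t / l := by
  calc ∑ e ∈ freeAt U u v, complW U φ R l e γ
      = ∑ e ∈ freeAt U u v, if γ ∈ R e then 1 / (l : ℝ) else 0 :=
        sum_congr rfl fun e he => if_pos (mem_freeAt.1 he).2.1
    _ = ((freeAt U u v).filter (γ ∈ R ·)).card * (1 / (l : ℝ)) := by
        rw [← sum_filter, sum_const, nsmul_eq_mul]
    _ ≤ t * (1 / (l : ℝ)) := by
        gcongr
        refine (card_le_card fun e he => ?_).trans (ht u γ)
        obtain ⟨h1, h2⟩ := mem_filter.1 he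
        exact mem_filter.2 ⟨(mem_freeAt.1 h1).2.1, (mem_freeAt.1 h1).2.2, h2⟩
    _ = t / l := by ring

variable [Fintype β]

lemma isProbWeight_complW (hl : 0 < l) (hR : ∀ e ∈ U, (R e).card = l) :
    IsProbWeight (complW U φ R l) where
  nonneg e a := by
    unfold complW
    split_ifs <;> positivity
  sum_eq_one e := by
    unfold complW
    by_cases he : e ∈ U
    · simp only [he, if_true, sum_ite_mem, univ_inter, sum_const, hR e he, nsmul_eq_mul]
      field_simp
    · simp [he]

variable [Fintype V]

/-- The palettes of adjacent vertices are unlikely to be close. -/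
lemma pP_closePalettes_le (h : PartialCol Ed L U φ R) (hl : 0 < l)
    (hR : ∀ e ∈ U, (R e).card = l) (ht : ∀ v c, (colDeg U R v c).card ≤ t) (htl : t ≤ l)
    {u v : V} (huv : u ≠ v) :
    pP (complW U φ R l) (closePalettes Ed U φ R S u v) ≤
      2 ^ ((freeAt U u v).card + S) * ((t : ℝ) / l) ^ ((freeAt U u v).card - S) := by
  have hw := isProbWeight_complW (φ := φ) hl hR
  have hρ1 : (t : ℝ) / l ≤ 1 := div_le_one_of_le₀ (by exact_mod_cast htl) (Nat.cast_nonneg _)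
  set F := freeAt U u v with hF
  refine pP_le_of_piecewise hw F fun ω₀ => ?_
  set X := freeCol Ed U (merge U φ ω₀) u v with hX
  have key : ∀ ω, F.piecewise ω ω₀ ∈ closePalettes Ed U φ R S u v →
      X.card ≤ F.card + S ∧ F.card - S ≤ (X.filter fun γ => ∃ e ∈ F, ω e = γ).card := by
    intro ω hω
    obtain ⟨h1, h2, h3⟩ := hω
    set ω' := F.piecewise ω ω₀ with hω'
    have hFU : ∀ e ∈ F, e ∈ edgesAt U u := fun e he => mem_of_mem_erase he
    have hFm : ∀ e ∈ F, merge U φ ω' e = ω e := fun e he => by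
      rw [merge_of_mem (mem_edgesAt.1 (hFU e he)).1, hω', piecewise_eq_of_mem _ _ _ he]
    have hmF : ∀ e ∈ F, merge U φ ω' e = ω' e := fun e he =>
      merge_of_mem (mem_edgesAt.1 (hFU e he)).1
    have h4 := freeCol_of_close (U := U) (u := u) (v := v) h.subset ?_ ?_ h3
    · rw [freeCol_congr (ψ' := merge U φ ω₀) huv] at h4
      · rw [filter_congr (q := fun γ => ∃ e ∈ F, ω e = γ)] at h4
        · exact ⟨h4.1, Nat.sub_le_iff_le_add.2 h4.2⟩
        · intro γ _
          exact exists_congr fun e => and_congr_right fun he => by rw [hFm e he]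
      · intro e he
        unfold merge
        rw [hω', piecewise_eq_of_notMem _ _ _ he]
    · intro e he f hf hef
      rw [hmF e he, hmF f hf] at hef
      exact h2 (hFU e he) (hFU f hf) hef
    · intro e he f hf hfF hef
      obtain ⟨hfE, huf⟩ := mem_edgesAt.1 hf
      have heU := hFU e he
      by_cases hfU : f ∈ U
      · rw [hmF e he, merge_of_mem hfU] at hef
        have := h2 heU (mem_edgesAt.2 ⟨hfU, huf⟩) hef
        exact hfF (this ▸ he)
      · rw [hmF e he, merge_of_notMem hfU] at hef
        refine h.avail e (mem_edgesAt.1 heU).1 f hfE hfU u (mem_edgesAt.1 heU).2 huf ?_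
        rw [← hef]
        exact h1 e heU
  by_cases hc : X.card ≤ F.card + S
  · exact (pP_mono hw fun ω hω => (key ω hω).2).trans
      (pP_many_hit_le hw (by positivity) hρ1 (fun γ _ => sum_complW_le ht u v γ) hc)
  · have h0 : {ω | F.piecewise ω ω₀ ∈ closePalettes Ed U φ R S u v} = ∅ :=
      Set.eq_empty_iff_forall_notMem.2 fun ω hω => hc (key ω hω).1
    rw [h0]
    simp only [pP, pE, Set.indicator_empty, mul_zero, sum_const_zero]
    positivity

end Completion
section Completion

variable {V β : Type} [DecidableEq V]

lemma merge_congr {Ed U : Finset (Sym2 V)} {φ ω ω' : Sym2 V → β} {v : V}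
    (h : ∀ e ∈ edgesAt U v, ω e = ω' e) :
    ∀ e ∈ edgesAt Ed v, merge U φ ω e = merge U φ ω' e := by
  intro e he
  by_cases heU : e ∈ U
  · rw [merge_of_mem heU, merge_of_mem heU]
    exact h e (mem_edgesAt.2 ⟨heU, (mem_edgesAt.1 he).2⟩)
  · rw [merge_of_notMem heU, merge_of_notMem heU]

variable [DecidableEq β]

lemma closePalettes_congr {Ed U : Finset (Sym2 V)} {R : Sym2 V → Finset β}
    {φ ω ω' : Sym2 V → β} {S : ℕ} {u v : V}
    (h : ∀ e ∈ edgesAt U u ∪ edgesAt U v, ω e = ω' e) :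
    ω ∈ closePalettes Ed U φ R S u v ↔ ω' ∈ closePalettes Ed U φ R S u v := by
  have hu : Set.EqOn ω ω' (edgesAt U u) := fun e he => h e (mem_union_left _ he)
  have hv : ∀ e ∈ edgesAt U v, ω e = ω' e := fun e he => h e (mem_union_right _ he)
  have h1 : palDiff Ed (merge U φ ω) u v = palDiff Ed (merge U φ ω') u v := by
    rw [palDiff, palDiff, palette_congr (merge_congr hu), palette_congr (merge_congr hv)]
  simp only [closePalettes, Set.mem_ofPred_eq, h1, hu.injOn_iff]
  refine and_congr_left' (forall₂_congr fun e he => ?_)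
  rw [hu he]

variable [Fintype V] [Fintype β]

/-- The pairs of adjacent uncoloured edges with a common colour in their lists. -/
noncomputable def conflicts (U : Finset (Sym2 V)) (R : Sym2 V → Finset β) :
    Finset (Sym2 V × Sym2 V × β) :=
  univ.filter fun k => (k.1 ∈ U ∧ k.2.1 ∈ U) ∧ k.1 ≠ k.2.1 ∧ (∃ v, v ∈ k.1 ∧ v ∈ k.2.1) ∧
    k.2.2 ∈ R k.1 ∧ k.2.2 ∈ R k.2.1

/-- The ordered pairs of vertices joined by an edge of `Ed`. -/
def adjPairs (Ed : Finset (Sym2 V)) : Finset (V × V) := univ.filter fun p => s(p.1, p.2) ∈ Ed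

variable {Ed U : Finset (Sym2 V)} {L R : Sym2 V → Finset β} {φ : Sym2 V → β} {l t S Δ : ℕ}

lemma mem_conflicts {e f : Sym2 V} {c : β} : (e, f, c) ∈ conflicts U R ↔
    (e ∈ U ∧ f ∈ U) ∧ e ≠ f ∧ (∃ v, v ∈ e ∧ v ∈ f) ∧ c ∈ R e ∧ c ∈ R f := by
  simp [conflicts]

lemma card_conflicts_fst (hR : ∀ e ∈ U, (R e).card = l)
    (ht : ∀ v c, (colDeg U R v c).card ≤ t) (i : Sym2 V) :
    ((conflicts U R).filter fun k => k.1 = i).card ≤ l * (2 * t) := by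
  by_cases hi : i ∈ U
  · have h1 : ((conflicts U R).filter fun k => k.1 = i) ⊆ (R i).biUnion fun c =>
        i.toFinset.biUnion fun v => (colDeg U R v c).image fun f => (i, f, c) := by
      rintro ⟨e, f, c⟩ hk
      obtain ⟨hk', rfl : e = i⟩ := mem_filter.1 hk
      obtain ⟨⟨-, hf⟩, -, ⟨v, hve, hvf⟩, hce, hcf⟩ := mem_conflicts.1 hk'
      simp only [mem_biUnion, mem_image, Sym2.mem_toFinset]
      exact ⟨c, hce, v, hve, f, mem_filter.2 ⟨hf, hvf, hcf⟩, rfl⟩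
    refine (card_le_card h1).trans ?_
    rw [← hR i hi]
    refine card_biUnion_le_card_mul _ _ _ fun c _ => ?_
    refine (card_biUnion_le_card_mul _ _ t fun v _ => card_image_le.trans (ht v c)).trans ?_
    exact Nat.mul_le_mul_right _ (card_toFinset_le_two i)
  · rw [filter_false_of_mem, card_empty]
    · exact Nat.zero_le _
    · rintro ⟨e, f, c⟩ hk rfl
      exact hi (mem_conflicts.1 hk).1.1

lemma card_conflicts_snd (hR : ∀ e ∈ U, (R e).card = l)
    (ht : ∀ v c, (colDeg U R v c).card ≤ t) (i : Sym2 V) :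
    ((conflicts U R).filter fun k => k.2.1 = i).card ≤ l * (2 * t) := by
  refine (card_le_card_of_injOn (fun k => (k.2.1, k.1, k.2.2)) ?_ ?_).trans
    (card_conflicts_fst hR ht i)
  · rintro ⟨e, f, c⟩ hk
    obtain ⟨hk, hi⟩ := mem_filter.1 (mem_coe.1 hk)
    obtain ⟨⟨he, hf⟩, hne, ⟨v, hve, hvf⟩, hce, hcf⟩ := mem_conflicts.1 hk
    exact mem_coe.2 (mem_filter.2
      ⟨mem_conflicts.2 ⟨⟨hf, he⟩, hne.symm, ⟨v, hvf, hve⟩, hcf, hce⟩, hi⟩)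
  · rintro ⟨e, f, c⟩ - ⟨e', f', c'⟩ - h
    simp only [Prod.mk.injEq] at h ⊢
    tauto

lemma card_adjPairs (hΔ : ∀ v, (edgesAt Ed v).card ≤ Δ) (i : Sym2 V) :
    ((adjPairs Ed).filter fun p => i ∈ edgesAt U p.1 ∪ edgesAt U p.2).card ≤ 4 * Δ := by
  have h1 : ((adjPairs Ed).filter fun p => i ∈ edgesAt U p.1 ∪ edgesAt U p.2) ⊆
      (i.toFinset.biUnion fun v => (edgesAt Ed v).image fun e => (v, oth v e)) ∪
      (i.toFinset.biUnion fun v => (edgesAt Ed v).image fun e => (oth v e, v)) := by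
    rintro ⟨u, v⟩ hp
    obtain ⟨hp, hi⟩ := mem_filter.1 hp
    have hp : s(u, v) ∈ Ed := (mem_filter.1 hp).2
    simp only [mem_union, mem_biUnion, mem_image, Sym2.mem_toFinset] at hi ⊢
    rcases hi with hi | hi
    · refine Or.inl ⟨u, (mem_edgesAt.1 hi).2, s(u, v), mem_edgesAt.2 ⟨hp, Sym2.mem_mk_left u v⟩,
        ?_⟩
      have h := mk_oth (Sym2.mem_mk_left u v)
      rw [Sym2.congr_right] at h
      rw [h]
    · refine Or.inr ⟨v, (mem_edgesAt.1 hi).2, s(u, v), mem_edgesAt.2 ⟨hp, Sym2.mem_mk_right u v⟩,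
        ?_⟩
      have h := mk_oth (Sym2.mem_mk_right u v)
      rw [Sym2.eq_swap, Sym2.congr_left] at h
      rw [h]
  refine (card_le_card h1).trans ((card_union_le _ _).trans ?_)
  have h2 := card_biUnion_le_card_mul i.toFinset
    (fun v => (edgesAt Ed v).image fun e => (v, oth v e)) Δ fun v _ => card_image_le.trans (hΔ v)
  have h3 := card_biUnion_le_card_mul i.toFinset
    (fun v => (edgesAt Ed v).image fun e => (oth v e, v)) Δ fun v _ => card_image_le.trans (hΔ v)
  have h4 := Nat.mul_le_mul_right Δ (card_toFinset_le_two i)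
  omega

lemma pP_conflict_le (hl : 0 < l) (hR : ∀ e ∈ U, (R e).card = l) {k : Sym2 V × Sym2 V × β}
    (hk : k ∈ conflicts U R) :
    pP (complW U φ R l) {ω | ω k.1 = k.2.2 ∧ ω k.2.1 = k.2.2} ≤ 1 / (l : ℝ) ^ 2 := by
  obtain ⟨e, f, c⟩ := k
  obtain ⟨⟨he, hf⟩, hne, -, hce, hcf⟩ := mem_conflicts.1 hk
  have h := pP_cylinder (isProbWeight_complW (φ := φ) hl hR) {e, f} fun _ => {c}
  simp only [mem_insert, mem_singleton, forall_eq_or_imp, forall_eq, sum_singleton] at h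
  rw [h, prod_pair hne, complW, complW, if_pos he, if_pos hf, if_pos hce, if_pos hcf]
  exact le_of_eq (by ring)

/-- A partial colouring with large lists, few conflicts and many uncoloured edges at every vertex
extends to a colouring with distant palettes at adjacent vertices. -/
theorem PartialCol.exists_completion {dm : ℕ} {dp ξ y : ℝ} (h : PartialCol Ed L U φ R)
    (hEd : ∀ e ∈ Ed, ¬e.IsDiag) (hR : ∀ e ∈ U, (R e).card = l)
    (ht : ∀ v c, (colDeg U R v c).card ≤ t) (htl : t ≤ l) (hl : 2 ≤ l)
    (hΔ : ∀ v, (edgesAt Ed v).card ≤ Δ) (hdp : ∀ v, ((edgesAt U v).card : ℝ) ≤ dp)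
    (hdm : ∀ v, dm ≤ (edgesAt U v).card) (hy0 : 0 ≤ y) (hy1 : y ≤ 1 / 2)
    (hξ : 8 * ((t : ℝ) / l) + 4 * Δ * y ≤ ξ) (hξ1 : 1 ≤ 2 * Real.exp (-(2 * (ξ * 2))))
    (hnum : ∀ n, dm ≤ n + 1 →
      2 ^ (n + S) * ((t : ℝ) / l) ^ (n - S) ≤ y * Real.exp (-(2 * (ξ * (2 * dp))))) :
    ∃ ψ : Sym2 V → β, (∀ e ∈ Ed, ψ e ∈ L e) ∧
      (∀ e ∈ Ed, ∀ f ∈ Ed, e ≠ f → ∀ w, w ∈ e → w ∈ f → ψ e ≠ ψ f) ∧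
      ∀ u v, s(u, v) ∈ Ed → S ≤ (palDiff Ed ψ u v).card := by
  have hl0 : 0 < l := by omega
  have hl' : (2 : ℝ) ≤ l := by exact_mod_cast hl
  have hw := isProbWeight_complW (φ := φ) hl0 hR
  have hξ0 : 0 ≤ ξ := le_trans (by positivity) hξ
  have hexp : ∀ {a b : ℝ}, a ≤ b → Real.exp (-(2 * (ξ * b))) ≤ Real.exp (-(2 * (ξ * a))) :=
    fun hab => Real.exp_le_exp.2 (by nlinarith [mul_le_mul_of_nonneg_left hab hξ0])
  suffices hLLL : ∃ ω, (∀ j : conflicts U R ⊕ adjPairs Ed, ω ∉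
      (Sum.elim (fun k => {ω | ω k.1.1 = k.1.2.2 ∧ ω k.1.2.1 = k.1.2.2})
        fun p => closePalettes Ed U φ R S p.1.1 p.1.2 : _ → Set (Sym2 V → β)) j) ∧
      ∀ e, 0 < complW U φ R l e (ω e) by
    obtain ⟨ω, hω, hpos⟩ := hLLL
    have hmem : ∀ e ∈ U, ω e ∈ R e := by
      intro e he
      by_contra hc
      have := hpos e
      rw [complW, if_pos he, if_neg hc] at this
      exact this.false
    have hinj : ∀ e ∈ U, ∀ f ∈ U, e ≠ f → ∀ w, w ∈ e → w ∈ f → ω e ≠ ω f := by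
      intro e he f hf hne w hwe hwf heq
      exact hω (Sum.inl ⟨(e, f, ω e), mem_conflicts.2
        ⟨⟨he, hf⟩, hne, ⟨w, hwe, hwf⟩, hmem e he, heq ▸ hmem f hf⟩⟩) ⟨rfl, heq.symm⟩
    refine ⟨merge U φ ω, fun e he => ?_, fun e he f hf hne w hwe hwf => ?_, fun u v huv => ?_⟩
    · by_cases heU : e ∈ U
      · rw [merge_of_mem heU]
        exact h.list_subset e heU (hmem e heU)
      · rw [merge_of_notMem heU]
        exact h.mem e he heU
    · by_cases heU : e ∈ U <;> by_cases hfU : f ∈ U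
      · rw [merge_of_mem heU, merge_of_mem hfU]
        exact hinj e heU f hfU hne w hwe hwf
      · rw [merge_of_mem heU, merge_of_notMem hfU]
        exact fun heq => h.avail e heU f hf hfU w hwe hwf (heq ▸ hmem e heU)
      · rw [merge_of_notMem heU, merge_of_mem hfU]
        exact fun heq => h.avail f hfU e he heU w hwf hwe (heq ▸ hmem f hfU)
      · rw [merge_of_notMem heU, merge_of_notMem hfU]
        exact h.proper e he heU f hf hfU hne w hwe hwf
    · by_contra hc
      refine hω (Sum.inr ⟨(u, v), mem_filter.2 ⟨mem_univ _, huv⟩⟩)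
        ⟨fun e he => hmem e (mem_edgesAt.1 he).1, fun e he f hf heq => ?_, not_le.1 hc⟩
      by_contra hne
      have he := mem_edgesAt.1 (mem_coe.1 he)
      have hf := mem_edgesAt.1 (mem_coe.1 hf)
      exact hinj e he.1 f hf.1 hne u he.2 hf.2 heq
  refine exists_avoiding_of_sum_le hw _
    (Sum.elim (fun k => {k.1.1, k.1.2.1}) fun p => edgesAt U p.1.1 ∪ edgesAt U p.1.2)
    ?_ (Sum.elim (fun _ => 2 / (l : ℝ) ^ 2) fun _ => y) ?_ ?_ ξ ?_ ?_
  · rintro (k | p) ω ω' hω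
    · simp only [Sum.elim_inl, mem_insert, mem_singleton, forall_eq_or_imp, forall_eq] at hω
      simp only [Sum.elim_inl, Set.mem_ofPred_eq, hω.1, hω.2]
    · exact closePalettes_congr hω
  · rintro (k | p)
    · simp only [Sum.elim_inl]
      positivity
    · exact hy0
  · rintro (k | p)
    · simp only [Sum.elim_inl]
      rw [div_le_div_iff₀ (by positivity) (by norm_num)]
      nlinarith
    · exact hy1
  · intro i
    rw [sum_filter, Fintype.sum_sum_type]
    refine (congrArg₂ (· + ·) (sum_coe_sort (conflicts U R)
        (fun k => if i ∈ ({k.1, k.2.1} : Finset (Sym2 V)) then 2 / (l : ℝ) ^ 2 else 0))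
      (sum_coe_sort (adjPairs Ed)
        (fun p => if i ∈ edgesAt U p.1 ∪ edgesAt U p.2 then y else 0))).trans_le ?_
    simp only [← sum_filter, sum_const, nsmul_eq_mul]
    have h1 : ((conflicts U R).filter fun k => i ∈ ({k.1, k.2.1} : Finset (Sym2 V))).card ≤
        4 * (l * t) := by
      have h2 : ((conflicts U R).filter fun k => i ∈ ({k.1, k.2.1} : Finset (Sym2 V))) =
          ((conflicts U R).filter fun k => k.1 = i) ∪
            ((conflicts U R).filter fun k => k.2.1 = i) := by
        rw [← filter_or]
        refine filter_congr fun k _ => ?_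
        rw [mem_insert, mem_singleton, eq_comm, eq_comm (a := i)]
      rw [h2]
      have := card_union_le ((conflicts U R).filter fun k => k.1 = i)
        ((conflicts U R).filter fun k => k.2.1 = i)
      have h3 := card_conflicts_fst hR ht i
      have h4 := card_conflicts_snd hR ht i
      linarith
    have h2 := card_adjPairs (U := U) hΔ i
    have h1' : (((conflicts U R).filter fun k => i ∈ ({k.1, k.2.1} : Finset (Sym2 V))).card : ℝ) ≤
        4 * (l * t) := by exact_mod_cast h1
    have h2' : (((adjPairs Ed).filter fun p => i ∈ edgesAt U p.1 ∪ edgesAt U p.2).card : ℝ) ≤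
        4 * Δ := by exact_mod_cast h2
    calc _ ≤ 4 * (l * t) * (2 / (l : ℝ) ^ 2) + 4 * Δ * y :=
          add_le_add (mul_le_mul_of_nonneg_right h1' (by positivity))
            (mul_le_mul_of_nonneg_right h2' hy0)
      _ = 8 * ((t : ℝ) / l) + 4 * Δ * y := by
          field_simp
          ring
      _ ≤ ξ := hξ
  · rintro (k | p)
    · simp only [Sum.elim_inl]
      have hc : ((({k.1.1, k.1.2.1} : Finset (Sym2 V)).card : ℕ) : ℝ) ≤ 2 := by
        exact_mod_cast card_le_two
      calc _ ≤ 1 / (l : ℝ) ^ 2 := pP_conflict_le hl0 hR k.2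
        _ ≤ 1 / (l : ℝ) ^ 2 * (2 * Real.exp (-(2 * (ξ * 2)))) :=
            le_mul_of_one_le_right (by positivity) hξ1
        _ = 2 / (l : ℝ) ^ 2 * Real.exp (-(2 * (ξ * 2))) := by ring
        _ ≤ _ := mul_le_mul_of_nonneg_left (hexp hc) (by positivity)
    · obtain ⟨⟨u, v⟩, hp⟩ := p
      simp only [Sum.elim_inr]
      have huv : u ≠ v := fun huv => hEd _ (mem_filter.1 hp).2 huv
      have hc : ((edgesAt U u ∪ edgesAt U v).card : ℝ) ≤ 2 * dp := by
        have : ((edgesAt U u ∪ edgesAt U v).card : ℝ) ≤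
            (edgesAt U u).card + (edgesAt U v).card := by exact_mod_cast card_union_le _ _
        linarith [hdp u, hdp v]
      have hn : dm ≤ (freeAt U u v).card + 1 :=
        (hdm u).trans (by have := pred_card_le_card_erase (s := edgesAt U u) (a := s(u, v))
                          unfold freeAt
                          omega)
      exact (pP_closePalettes_le h hl0 hR ht htl huv).trans ((hnum _ hn).trans
        (mul_le_mul_of_nonneg_left (hexp hc) hy0))

end Completion
section Final

lemma two_pow_mul_pow_le {ρ a : ℝ} {n S : ℕ} (hρ0 : 0 ≤ ρ) (hρ : 2 * ρ ≤ 1 / 3)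
    (ha : a + 3 * S ≤ n) : 2 ^ (n + S) * ρ ^ (n - S) ≤ Real.exp (-a) := by
  have he : 2 * ρ ≤ Real.exp (-1) := by
    rw [Real.exp_neg]
    refine hρ.trans ?_
    rw [one_div]
    exact inv_anti₀ (Real.exp_pos 1) (by linarith [Real.exp_one_lt_d9])
  have h2 : (2 : ℝ) ≤ Real.exp 1 := by linarith [Real.exp_one_gt_d9]
  have hn : (n : ℝ) ≤ (n - S : ℕ) + S := by
    have : n ≤ n - S + S := by omega
    exact_mod_cast this
  calc (2 : ℝ) ^ (n + S) * ρ ^ (n - S)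
      ≤ 2 ^ (n - S + 2 * S) * ρ ^ (n - S) :=
        mul_le_mul_of_nonneg_right (pow_le_pow_right₀ (by norm_num) (by omega)) (by positivity)
    _ = (2 * ρ) ^ (n - S) * 2 ^ (2 * S) := by
        rw [mul_pow, pow_add]
        ring
    _ ≤ Real.exp (-1) ^ (n - S) * Real.exp 1 ^ (2 * S) := by gcongr
    _ = Real.exp (-((n - S : ℕ) : ℝ) + 2 * S) := by
        rw [← Real.exp_nat_mul, ← Real.exp_nat_mul, ← Real.exp_add]
        congr 1
        push_cast
        ring
    _ ≤ Real.exp (-a) := Real.exp_le_exp.2 (by linarith)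

variable {V β : Type} [Fintype V] [DecidableEq V] [Fintype β] [DecidableEq β]

/-- A good final state of the nibble extends to a list colouring with distant palettes. -/
theorem exists_colouring_of_final_state {Ed : Finset (Sym2 V)} {L : Sym2 V → Finset β}
    {s lam p P : ℝ} {Δ : ℕ} (hEd : ∀ e ∈ Ed, ¬e.IsDiag) (hlam : 30000000 ≤ lam)
    (hs : 896 * lam ^ 3 ≤ s) (hΔs : (Δ : ℝ) = s ^ 2) (hlog : s ^ 2 = Real.exp lam)
    (hΔ : ∀ v, (edgesAt Ed v).card ≤ Δ) (hp0 : 0 < p) (hp : p ≤ 146 * lam / s)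
    (hP : lam ^ 3 / (2 * s) ≤ P) (h : NibbleState Ed L s p P (s / 8)) :
    ∃ ψ : Sym2 V → β, (∀ e ∈ Ed, ψ e ∈ L e) ∧
      (∀ e ∈ Ed, ∀ f ∈ Ed, e ≠ f → ∀ w, w ∈ e → w ∈ f → ψ e ≠ ψ f) ∧
      ∀ u v, s(u, v) ∈ Ed → lam ^ 2 / 64 ≤ (palDiff Ed ψ u v).card := by
  obtain ⟨U, φ, R, hcol, hRcard, hdeg, hedges⟩ := h
  have hlam0 : 0 < lam := by linarith
  have hs0 : 0 < s := lt_of_lt_of_le (by positivity) hs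
  have hP0 : 0 < P := lt_of_lt_of_le (by positivity) hP
  have hsp : s * p ≤ 146 * lam := by rwa [le_div_iff₀ hs0, mul_comm] at hp
  have hsP : lam ^ 3 / 2 ≤ s * P := by
    rw [div_le_iff₀ (by positivity)] at hP
    linarith
  set l := ⌈s ^ 2 * P ^ 2⌉₊ with hl
  set t := ⌊s ^ 2 * P * p⌋₊ with ht
  obtain ⟨R', hcol', hR', hcard', -⟩ := hcol.exists_card_eq (l := l)
    fun e he => Nat.ceil_le.2 (hRcard e he)
  have hlr : s ^ 2 * P ^ 2 ≤ l := Nat.le_ceil _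
  have htr : (t : ℝ) ≤ s ^ 2 * P * p := Nat.floor_le (by positivity)
  have hpP : p ≤ 292 / lam ^ 2 * P := by
    have h1 : s * p ≤ s * (292 / lam ^ 2 * P) :=
      calc s * p ≤ 146 * lam := hsp
        _ = 292 / lam ^ 2 * (lam ^ 3 / 2) := by
          field_simp
          norm_num
        _ ≤ 292 / lam ^ 2 * (s * P) := by gcongr
        _ = s * (292 / lam ^ 2 * P) := by ring
    exact le_of_mul_le_mul_left h1 hs0
  have hlam2 : 292 / lam ^ 2 ≤ 1 / 10000 := by
    rw [div_le_div_iff₀ (by positivity) (by norm_num)]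
    nlinarith
  have htl' : (t : ℝ) ≤ 292 / lam ^ 2 * l :=
    calc (t : ℝ) ≤ s ^ 2 * P * p := htr
      _ ≤ s ^ 2 * P * (292 / lam ^ 2 * P) := by gcongr
      _ = 292 / lam ^ 2 * (s ^ 2 * P ^ 2) := by ring
      _ ≤ _ := by gcongr
  have hl2 : (2 : ℝ) ≤ l := by
    refine le_trans ?_ hlr
    have h1 : (2 : ℝ) ≤ s * P := by
      refine le_trans ?_ hsP
      have : (30000000 : ℝ) ^ 3 ≤ lam ^ 3 := by gcongr
      linarith
    nlinarith
  have hl0 : (0 : ℝ) < l := by linarith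
  have htl : t ≤ l := by
    have : (t : ℝ) ≤ l := htl'.trans (mul_le_of_le_one_left hl0.le (by linarith))
    exact_mod_cast this
  have hρ : (t : ℝ) / l ≤ 292 / lam ^ 2 := (div_le_iff₀ hl0).2 htl'
  have hS : (⌈lam ^ 2 / 64⌉₊ : ℝ) ≤ lam ^ 2 / 64 + 1 := (Nat.ceil_lt_add_one (by positivity)).le
  suffices hc : ∃ ψ : Sym2 V → β, (∀ e ∈ Ed, ψ e ∈ L e) ∧
      (∀ e ∈ Ed, ∀ f ∈ Ed, e ≠ f → ∀ w, w ∈ e → w ∈ f → ψ e ≠ ψ f) ∧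
      ∀ u v, s(u, v) ∈ Ed → ⌈lam ^ 2 / 64⌉₊ ≤ (palDiff Ed ψ u v).card by
    obtain ⟨ψ, h1, h2, h3⟩ := hc
    exact ⟨ψ, h1, h2, fun u v huv => Nat.ceil_le.1 (h3 u v huv)⟩
  refine hcol'.exists_completion (S := ⌈lam ^ 2 / 64⌉₊) (dm := ⌈s / 8⌉₊)
    (dp := 146 * lam * s) (ξ := 2340 / lam ^ 2) (y := 1 / (lam ^ 2 * s ^ 2)) hEd hcard'
    (fun v c => (card_le_card (colDeg_subset hR' v c)).trans (Nat.le_floor (hdeg v c))) htl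
    (by exact_mod_cast hl2) hΔ
    (fun v => (hedges v).1.trans (by nlinarith [mul_le_mul_of_nonneg_left hsp hs0.le]))
    (fun v => Nat.ceil_le.2 (hedges v).2) (by positivity) ?_ ?_ ?_ ?_
  · have hs1 : 1 ≤ s ^ 2 := by
      rw [hlog]
      exact Real.one_le_exp hlam0.le
    rw [div_le_div_iff₀ (by positivity) (by norm_num)]
    nlinarith
  · rw [hΔs]
    calc 8 * ((t : ℝ) / l) + 4 * s ^ 2 * (1 / (lam ^ 2 * s ^ 2))
        ≤ 8 * (292 / lam ^ 2) + 4 * s ^ 2 * (1 / (lam ^ 2 * s ^ 2)) := by gcongr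
      _ = 2340 / lam ^ 2 := by
          field_simp
          norm_num
  · have h4 := Real.add_one_le_exp (-(2 * (2340 / lam ^ 2 * 2)))
    have h5 : 2340 / lam ^ 2 = 2340 / 292 * (292 / lam ^ 2) := by ring
    rw [h5] at h4 ⊢
    linarith
  · intro n hn
    have hn' : s / 8 ≤ n + 1 := by
      have := Nat.ceil_le.1 hn
      exact_mod_cast this
    have hy : (1 : ℝ) / (lam ^ 2 * s ^ 2) ≥ Real.exp (-(3 * lam)) := by
      have h6 : lam ≤ Real.exp lam := by linarith [Real.add_one_le_exp lam]
      rw [Real.exp_neg, hlog, ← one_div]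
      refine one_div_le_one_div_of_le (by positivity) ?_
      have h7 : Real.exp (3 * lam) = Real.exp lam ^ 2 * Real.exp lam := by
        rw [← pow_succ, ← Real.exp_nat_mul]
        norm_num
      rw [h7]
      gcongr
    have hexp : 2 * (2340 / lam ^ 2 * (2 * (146 * lam * s))) ≤ s / 16 := by
      have h8 : 2 * (2340 / lam ^ 2 * (2 * (146 * lam * s))) = 1366560 * s / lam := by
        field_simp
        norm_num
      rw [h8, div_le_div_iff₀ hlam0 (by norm_num)]
      nlinarith
    have hl3 : 30000000 * lam ^ 2 ≤ lam ^ 3 := by nlinarith [sq_nonneg lam]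
    have hl22 : 30000000 * lam ≤ lam ^ 2 := by nlinarith
    calc _ ≤ Real.exp (-(3 * lam + s / 16)) := by
          refine two_pow_mul_pow_le (by positivity) (by linarith) ?_
          linarith
      _ = Real.exp (-(3 * lam)) * Real.exp (-(s / 16)) := by
          rw [← Real.exp_add]
          congr 1
          ring
      _ ≤ _ := by
          gcongr

end Final
section Main

lemma cube_le_exp {x : ℝ} (hx : 6000000 ≤ x) : 896 * x ^ 3 ≤ Real.exp (x / 4) := by
  have h := Real.pow_div_factorial_le_exp (x / 4) (by linarith) 4
  have h1 : (x / 4) ^ 4 / (Nat.factorial 4 : ℝ) = x * x ^ 3 / 6144 := by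
    rw [show Nat.factorial 4 = 24 from rfl]
    push_cast
    ring
  rw [h1] at h
  refine le_trans ?_ h
  have h2 : 6000000 * x ^ 3 ≤ x * x ^ 3 := by gcongr
  have h3 : 0 ≤ x ^ 3 := by positivity
  linarith

variable {V β : Type} [DecidableEq V] [DecidableEq β]

lemma card_palDiff_comp {γ : Type} [DecidableEq γ] {g : β → γ} (hg : Function.Injective g)
    (Ed : Finset (Sym2 V)) (ψ : Sym2 V → β) (u v : V) :
    (palDiff Ed (g ∘ ψ) u v).card = (palDiff Ed ψ u v).card := by
  have h : palDiff Ed (g ∘ ψ) u v = (palDiff Ed ψ u v).image g := by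
    simp only [palDiff, palette, ← image_image]
    rw [← image_union, ← image_inter _ _ hg, ← image_sdiff _ _ hg]
  rw [h, card_image_of_injective _ hg]

variable [Fintype V]

/-- The main theorem for colours from a finite type. -/
theorem exists_colouring_of_large_lists [Fintype β] [Nonempty β] {Ed : Finset (Sym2 V)}
    {L : Sym2 V → Finset β} {Δ : ℕ} {lam s : ℝ} (hEd : ∀ e ∈ Ed, ¬e.IsDiag)
    (hlam : 30000000 ≤ lam) (hΔ : (Δ : ℝ) = Real.exp lam) (hs : s = Real.exp (lam / 2))
    (hdeg : ∀ v, (edgesAt Ed v).card ≤ Δ) (hdeg' : ∀ v, (Δ : ℝ) / 4 ≤ (edgesAt Ed v).card)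
    (hL : ∀ e ∈ Ed, Δ + s * lam ^ 4 - 1 ≤ (L e).card) :
    ∃ ψ : Sym2 V → β, (∀ e ∈ Ed, ψ e ∈ L e) ∧
      (∀ e ∈ Ed, ∀ f ∈ Ed, e ≠ f → ∀ w, w ∈ e → w ∈ f → ψ e ≠ ψ f) ∧
      ∀ u v, s(u, v) ∈ Ed → lam ^ 2 / 64 ≤ (palDiff Ed ψ u v).card := by
  have hlam0 : 0 < lam := by linarith
  obtain ⟨w, hw⟩ : ∃ w, w = Real.exp (lam / 4) := ⟨_, rfl⟩
  have hw0 : 0 < w := hw ▸ Real.exp_pos _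
  have hw3 : 896 * lam ^ 3 ≤ w := hw ▸ cube_le_exp (by linarith)
  have hws : w ^ 2 = s := by
    rw [hw, hs, ← Real.exp_nat_mul]
    congr 1
    push_cast
    ring
  have hsΔ : (Δ : ℝ) = s ^ 2 := by
    rw [hΔ, hs, ← Real.exp_nat_mul]
    congr 1
    push_cast
    ring
  have hlam3 : 1 ≤ lam ^ 3 := one_le_pow₀ (by linarith)
  have hw1 : 1 ≤ w := by linarith
  have hws' : w ≤ s := by
    rw [← hws]
    nlinarith
  have hs0 : 0 < s := by linarith
  obtain ⟨p, P, hp0, hp, hP, hst⟩ := exists_final_state (Ed := Ed) (L := L) (w := w) (lam := lam)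
    (Q := 5 * Δ) hEd (by linarith) hw3 (by rw [hw, Real.log_exp]; ring)
    (by push_cast; rw [hws, hsΔ]) (by
      push_cast
      rw [hΔ]
      calc 6144 * (5 * Real.exp lam) ^ 5 * Real.exp (-(lam ^ 2 / 160))
          = 19200000 * Real.exp (5 * lam + -(lam ^ 2 / 160)) := by
            rw [mul_pow, ← Real.exp_nat_mul, Real.exp_add]
            push_cast
            ring
        _ ≤ Real.exp lam * Real.exp (-lam) := by
            gcongr
            · linarith [Real.add_one_le_exp lam]
            · nlinarith
        _ = 1 := by rw [← Real.exp_add, add_neg_cancel, Real.exp_zero]) (by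
      rw [hws]
      obtain ⟨b⟩ := ‹Nonempty β›
      refine ⟨Ed, fun _ => b, L, ⟨Subset.rfl, fun e he h => absurd he h,
        fun e he h => absurd he h, fun _ _ => Subset.rfl, fun _ _ f hf h => absurd hf h⟩,
        fun e he => le_trans ?_ (hL e he), fun v c => ?_, fun v => ⟨?_, ?_⟩⟩
      · have h1 : s ^ 2 * (1 + lam ^ 3 / s) ^ 2 =
            s ^ 2 + 2 * (s * lam ^ 3) + lam ^ 3 * lam ^ 3 := by
          field_simp
          ring
        have h2 : 30000000 * (s * lam ^ 3) ≤ lam * (s * lam ^ 3) := by gcongr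
        have h3 : lam ^ 3 * lam ^ 3 ≤ s * lam ^ 3 := by
          gcongr
          linarith
        have h4 : 1 ≤ s * lam ^ 3 := by nlinarith
        rw [h1, hsΔ]
        linarith
      · have h1 : ((colDeg Ed L v c).card : ℝ) ≤ s ^ 2 := by
          rw [← hsΔ]
          refine Nat.cast_le.2 (le_trans (card_le_card fun e he => ?_) (hdeg v))
          obtain ⟨h2, h3⟩ := mem_filter.1 he
          exact mem_edgesAt.2 ⟨h2, h3.1⟩
        rw [mul_one]
        refine h1.trans (le_mul_of_one_le_right (by positivity) ?_)
        have : 0 ≤ lam ^ 3 / s := by positivity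
        linarith
      · rw [mul_one, ← hsΔ]
        exact Nat.cast_le.2 (hdeg v)
      · rw [← hsΔ]
        exact hdeg' v)
  rw [hws] at hp hP hst
  exact exists_colouring_of_final_state hEd hlam (hw3.trans hws') hsΔ (hsΔ ▸ hΔ) hdeg hp0 hp hP hst

/-- The lists can be assumed to consist of colours from a finite type. -/
theorem exists_colouring_of_large_lists_of_nonempty {Ed : Finset (Sym2 V)}
    {L : Sym2 V → Finset β} {Δ : ℕ} {lam s : ℝ} (hEd : ∀ e ∈ Ed, ¬e.IsDiag) (hne : Ed.Nonempty)
    (hlam : 30000000 ≤ lam) (hΔ : (Δ : ℝ) = Real.exp lam) (hs : s = Real.exp (lam / 2))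
    (hdeg : ∀ v, (edgesAt Ed v).card ≤ Δ) (hdeg' : ∀ v, (Δ : ℝ) / 4 ≤ (edgesAt Ed v).card)
    (hL : ∀ e ∈ Ed, Δ + s * lam ^ 4 - 1 ≤ (L e).card) :
    ∃ ψ : Sym2 V → β, (∀ e ∈ Ed, ψ e ∈ L e) ∧
      (∀ e ∈ Ed, ∀ f ∈ Ed, e ≠ f → ∀ w, w ∈ e → w ∈ f → ψ e ≠ ψ f) ∧
      ∀ u v, s(u, v) ∈ Ed → lam ^ 2 / 64 ≤ (palDiff Ed ψ u v).card := by
  set B := Ed.biUnion L with hB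
  have hcard : ∀ e ∈ Ed, ((L e).subtype (· ∈ B)).card = (L e).card := fun e he => by
    rw [card_subtype, filter_true_of_mem]
    exact fun c hc => mem_biUnion.2 ⟨e, he, hc⟩
  have hB0 : Nonempty {c // c ∈ B} := by
    obtain ⟨e, he⟩ := hne
    have h1 : (0 : ℝ) < (L e).card := by
      refine lt_of_lt_of_le ?_ (hL e he)
      have h2 := Real.add_one_le_exp lam
      have h3 : 0 ≤ s * lam ^ 4 := by
        rw [hs]
        positivity
      rw [hΔ]
      linarith
    obtain ⟨c, hc⟩ := card_pos.1 (Nat.cast_pos.1 h1)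
    exact ⟨c, mem_biUnion.2 ⟨e, he, hc⟩⟩
  obtain ⟨ψ, h1, h2, h3⟩ := exists_colouring_of_large_lists
    (L := fun e => (L e).subtype (· ∈ B)) hEd hlam hΔ hs hdeg hdeg' fun e he => by
      rw [hcard e he]
      exact hL e he
  refine ⟨Subtype.val ∘ ψ, fun e he => mem_subtype.1 (h1 e he),
    fun e he f hf hne w hwe hwf heq => h2 e he f hf hne w hwe hwf (Subtype.ext heq),
    fun u v huv => ?_⟩
  rw [card_palDiff_comp Subtype.val_injective]
  exact h3 u v huv

end Main
end AVD

/-- There are constants `C₀ > 0` and `Δ₀` such that for every finite simple graph `G`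
with maximum degree `Δ ≥ Δ₀` and minimum degree `δ ≥ Δ/4`, and lists of size at least
`Δ + ⌊C₀·Δ^(1/2)·(log Δ)^4⌋` on the edges, there is a proper edge colouring from the
lists in which the palettes of any two adjacent vertices of equal degree have symmetric
difference of size at least `(1/64)·(log Δ)²`. -/
theorem avd_edge_choosability_large_symmDiff :
    ∃ (C₀ : ℝ) (Δ₀ : ℕ), 0 < C₀ ∧
      ∀ (V β : Type) [Fintype V] [DecidableEq V] [DecidableEq β]
        (G : SimpleGraph V) [DecidableRel G.Adj] (L : Sym2 V → Finset β),
        -- maximum degree at least Δ₀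
        Δ₀ ≤ G.maxDegree →
        -- minimum degree at least Δ/4
        (∀ v : V, (G.maxDegree : ℝ) / 4 ≤ (G.degree v : ℝ)) →
        -- lists are large enough
        (∀ e ∈ G.edgeFinset,
          G.maxDegree + ⌊C₀ * Real.sqrt (G.maxDegree) * (Real.log (G.maxDegree)) ^ 4⌋₊
            ≤ (L e).card) →
        ∃ c : Sym2 V → β,
          -- colours chosen from the lists
          (∀ e ∈ G.edgeFinset, c e ∈ L e) ∧
          -- proper edge colouring
          (∀ e ∈ G.edgeFinset, ∀ f ∈ G.edgeFinset,
            e ≠ f → (∃ w : V, w ∈ e ∧ w ∈ f) → c e ≠ c f) ∧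
          -- palettes of adjacent vertices of equal degree differ a lot
          (∀ u v : V, G.Adj u v → G.degree u = G.degree v →
            (1 / 64 : ℝ) * (Real.log (G.maxDegree)) ^ 2 ≤
              (((((G.incidenceFinset u).image c ∪ (G.incidenceFinset v).image c) \
                ((G.incidenceFinset u).image c ∩ (G.incidenceFinset v).image c)).card : ℝ))) := by
  refine ⟨1, ⌈Real.exp 30000000⌉₊, one_pos, ?_⟩
  intro V β _ _ _ G _ L hmax hmin hL
  have hmax' : Real.exp 30000000 ≤ G.maxDegree := Nat.ceil_le.1 hmax
  have hpos : (0 : ℝ) < G.maxDegree := (Real.exp_pos _).trans_le hmax'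
  have hinc : ∀ v, G.incidenceFinset v = AVD.edgesAt G.edgeFinset v := fun v =>
    G.incidenceFinset_eq_filter v
  have hcard : ∀ v, (AVD.edgesAt G.edgeFinset v).card = G.degree v := fun v => by
    rw [← hinc, G.card_incidenceFinset_eq_degree]
  have hne : G.edgeFinset.Nonempty := by
    rw [Finset.nonempty_iff_ne_empty]
    intro h0
    have h : G.maxDegree ≤ 0 := G.maxDegree_le_of_forall_degree_le 0 fun v => by
      rw [← hcard, h0, AVD.edgesAt, Finset.filter_empty, Finset.card_empty]
    exact hpos.not_ge (by exact_mod_cast h)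
  have hsqrt : √(G.maxDegree : ℝ) = Real.exp (Real.log G.maxDegree / 2) := by
    rw [Real.exp_half, Real.exp_log hpos]
  obtain ⟨ψ, h1, h2, h3⟩ := AVD.exists_colouring_of_large_lists_of_nonempty (L := L)
    (Δ := G.maxDegree) (lam := Real.log G.maxDegree)
    (fun e he => G.not_isDiag_of_mem_edgeFinset he) hne
    ((Real.le_log_iff_exp_le hpos).2 hmax') (Real.exp_log hpos).symm rfl
    (fun v => (hcard v).trans_le (G.degree_le_maxDegree v))
    (fun v => by rw [hcard]; exact hmin v) (fun e he => by
      have h4 := hL e he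
      rw [one_mul, hsqrt] at h4
      have h5 := Nat.lt_floor_add_one (Real.exp (Real.log G.maxDegree / 2) *
        Real.log G.maxDegree ^ 4)
      have h6 : (G.maxDegree : ℝ) + (⌊Real.exp (Real.log G.maxDegree / 2) *
        Real.log G.maxDegree ^ 4⌋₊ : ℝ) ≤ (L e).card := by exact_mod_cast h4
      linarith)
  refine ⟨ψ, h1, fun e he f hf hef ⟨w, hwe, hwf⟩ => h2 e he f hf hef w hwe hwf,
    fun u v huv _ => ?_⟩
  have h4 := h3 u v (G.mem_edgeFinset.2 huv)
  rw [hinc, hinc, one_div_mul_eq_div]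
  exact h4
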